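/- Let E|k be a field extension inside End_D(V) such that d/gcd(d, e(E|k)) is coprime to f(E|k), and suppose (E, 𝔞) and (E, 𝔞′) are embeddings, i.e. 𝔞 and 𝔞′ are hereditary orders of End_D(V) normalized by E^×. Then there exists g̃ ∈ Aut_D(V) commuting with every element of E such that g̃ 𝔞 g̃^{−1} = 𝔞′ if and only if there exists g ∈ Aut_D(V) with g 𝔞 g^{−1} = 𝔞′. -/

import Mathlib

noncomputable section

/-- Axioms expressing that `ν : K → EReal` is the additive valuation of a
non-Archimedean local (skew) field structure on `K`, normalized relatively to a base
field with valuation group `ℤ`, so that the value group of `K` is `(1/e)ℤ`; `K` is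
complete and its residue field has exactly `q` elements (encoded by a complete finite
set of residue representatives). -/
structure IsLocalValuation (K : Type*) [DivisionRing K] (ν : K → EReal) (e q : ℕ) : Prop where
  e_pos : 0 < e
  one_lt_q : 1 < q
  eq_top_iff : ∀ x : K, ν x = ⊤ ↔ x = 0
  map_mul : ∀ x y : K, ν (x * y) = ν x + ν y
  min_le_add : ∀ x y : K, min (ν x) (ν y) ≤ ν (x + y)
  values : ∀ x : K, x ≠ 0 → ∃ m : ℤ, ν x = ((m / e : ℝ) : EReal)
  exists_uniformizer : ∃ π : K, ν π = (((e : ℝ)⁻¹ : ℝ) : EReal)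
  complete : ∀ x : ℕ → K,
      (∀ M : ℝ, ∃ N : ℕ, ∀ m ≥ N, ∀ n ≥ N, (M : EReal) ≤ ν (x m - x n)) →
      ∃ l : K, ∀ M : ℝ, ∃ N : ℕ, ∀ n ≥ N, (M : EReal) ≤ ν (x n - l)
  residue : ∃ s : Finset K, s.card = q ∧ (∀ y ∈ s, 0 ≤ ν y) ∧
      ∀ x : K, 0 ≤ ν x → ∃! y, y ∈ s ∧ 0 < ν (x - y)

/-- `M` is an `o_D`-lattice in the right `D`-vector space `V`: a finitely generated
`o_D`-submodule (where `o_D = {y | 0 ≤ νD y}`) containing a `D`-basis of `V`. -/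
def IsODLattice {D V : Type*} [DivisionRing D] [AddCommGroup V] [Module Dᵐᵒᵖ V]
    (νD : D → EReal) (M : AddSubgroup V) : Prop :=
  (∀ v ∈ M, ∀ y : D, 0 ≤ νD y → MulOpposite.op y • v ∈ M) ∧
  (∃ s : Finset V, ↑s ⊆ (M : Set V) ∧ ∀ v ∈ M,
    v ∈ AddSubgroup.closure
      {w : V | ∃ u ∈ s, ∃ y : D, 0 ≤ νD y ∧ w = MulOpposite.op y • u}) ∧
  Submodule.span Dᵐᵒᵖ (M : Set V) = ⊤

/-- `Λ` is an `o_D`-lattice function on the right `D`-vector space `V`, where `D` has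
index `d`: a decreasing, left-continuous family of `o_D`-lattices with
`Λ(t)·π_D = Λ(t + 1/d)` for every prime element `π_D` of `D`. -/
def IsLatticeFunction {D V : Type*} [DivisionRing D] [AddCommGroup V] [Module Dᵐᵒᵖ V]
    (νD : D → EReal) (d : ℕ) (Λ : ℝ → AddSubgroup V) : Prop :=
  (∀ t : ℝ, IsODLattice νD (Λ t)) ∧
  (∀ s t : ℝ, s ≤ t → Λ t ≤ Λ s) ∧
  (∀ (t : ℝ) (v : V), v ∈ Λ t ↔ ∀ r : ℝ, r < t → v ∈ Λ r) ∧
  (∀ π : D, νD π = (((d : ℝ)⁻¹ : ℝ) : EReal) →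
    ∀ (t : ℝ) (w : V), w ∈ Λ (t + (d : ℝ)⁻¹) ↔ ∃ v ∈ Λ t, w = MulOpposite.op π • v)

/-- The hereditary order `𝔤_Λ(0)` of `End_D(V)` attached to a lattice function `Λ`:
the endomorphisms preserving every lattice `Λ(t)`. -/
def latticeOrder {D V : Type*} [DivisionRing D] [AddCommGroup V] [Module Dᵐᵒᵖ V]
    (Λ : ℝ → AddSubgroup V) : Set (Module.End Dᵐᵒᵖ V) :=
  {a | ∀ t : ℝ, ∀ v ∈ Λ t, a v ∈ Λ t}

/-- The integer-valued data underlying a normalized discrete valuation on a division ring;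
the value at `0` is irrelevant. -/
structure IsDiscVal {K : Type*} [DivisionRing K] (v : K → ℤ) : Prop where
  map_mul : ∀ x y : K, x ≠ 0 → y ≠ 0 → v (x * y) = v x + v y
  min_le_add : ∀ x y : K, x ≠ 0 → y ≠ 0 → x + y ≠ 0 → min (v x) (v y) ≤ v (x + y)

namespace IsDiscVal

variable {K : Type*} [DivisionRing K] {v : K → ℤ}

theorem map_one (hv : IsDiscVal v) : v 1 = 0 := by
  have := hv.map_mul 1 1 one_ne_zero one_ne_zero
  rw [mul_one] at this
  omega

theorem map_inv (hv : IsDiscVal v) {x : K} (hx : x ≠ 0) : v x⁻¹ = - v x := by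
  have := hv.map_mul x x⁻¹ hx (inv_ne_zero hx)
  rw [mul_inv_cancel₀ hx, hv.map_one] at this
  omega

theorem map_pow (hv : IsDiscVal v) {x : K} (hx : x ≠ 0) (n : ℕ) : v (x ^ n) = n * v x := by
  induction n with
  | zero => simp [hv.map_one]
  | succ n ih => rw [pow_succ, hv.map_mul _ _ (pow_ne_zero _ hx) hx, ih]; push_cast; ring

theorem map_zpow (hv : IsDiscVal v) {x : K} (hx : x ≠ 0) (n : ℤ) : v (x ^ n) = n * v x := by
  obtain ⟨m, rfl | rfl⟩ := n.eq_nat_or_neg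
  · rw [zpow_natCast, hv.map_pow hx]
  · rw [zpow_neg, zpow_natCast, hv.map_inv (pow_ne_zero _ hx), hv.map_pow hx, neg_mul]

theorem map_neg_one (hv : IsDiscVal v) : v (-1) = 0 := by
  have h0 : (-1 : K) ≠ 0 := neg_ne_zero.2 one_ne_zero
  have := hv.map_mul (-1) (-1) h0 h0
  rw [neg_one_mul, neg_neg, hv.map_one] at this
  omega

theorem map_neg (hv : IsDiscVal v) {x : K} (hx : x ≠ 0) : v (-x) = v x := by
  rw [← neg_one_mul, hv.map_mul _ _ (neg_ne_zero.2 one_ne_zero) hx, hv.map_neg_one, zero_add]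

/-- The fractional ideal of elements of valuation at least `j`. -/
def ball (hv : IsDiscVal v) (j : ℤ) : AddSubgroup K where
  carrier := {x | x = 0 ∨ j ≤ v x}
  zero_mem' := Or.inl rfl
  add_mem' := by
    intro x y hx hy
    by_cases x0 : x = 0
    · simpa [x0] using hy
    by_cases y0 : y = 0
    · simpa [y0] using hx
    by_cases h0 : x + y = 0
    · exact Or.inl h0
    · exact Or.inr ((le_min (hx.resolve_left x0) (hy.resolve_left y0)).trans
        (hv.min_le_add x y x0 y0 h0))
  neg_mem' := by
    intro x hx
    by_cases x0 : x = 0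
    · simp [x0]
    · exact Or.inr (by rw [hv.map_neg x0]; exact hx.resolve_left x0)

theorem mem_ball (hv : IsDiscVal v) {j : ℤ} {x : K} : x ∈ hv.ball j ↔ x = 0 ∨ j ≤ v x := Iff.rfl

theorem mem_ball_of_ne (hv : IsDiscVal v) {j : ℤ} {x : K} (hx : x ≠ 0) :
    x ∈ hv.ball j ↔ j ≤ v x := by simp [mem_ball, hx]

theorem mem_ball_self (hv : IsDiscVal v) (x : K) : x ∈ hv.ball (v x) := Or.inr le_rfl

theorem ball_anti (hv : IsDiscVal v) {i j : ℤ} (h : i ≤ j) : hv.ball j ≤ hv.ball i := by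
  rintro x (hx | hx)
  · exact Or.inl hx
  · exact Or.inr (h.trans hx)

theorem mul_mem_ball (hv : IsDiscVal v) {i j : ℤ} {x y : K} (hx : x ∈ hv.ball i)
    (hy : y ∈ hv.ball j) : x * y ∈ hv.ball (i + j) := by
  by_cases x0 : x = 0
  · exact Or.inl (by simp [x0])
  by_cases y0 : y = 0
  · exact Or.inl (by simp [y0])
  · refine Or.inr ?_
    rw [hv.map_mul _ _ x0 y0]
    exact add_le_add (hx.resolve_left x0) (hy.resolve_left y0)

theorem one_mem_ball (hv : IsDiscVal v) : (1 : K) ∈ hv.ball 0 := Or.inr hv.map_one.ge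

theorem pow_mem_ball_zero (hv : IsDiscVal v) {x : K} (hx : x ∈ hv.ball 0) (n : ℕ) :
    x ^ n ∈ hv.ball 0 := by
  induction n with
  | zero => simp [hv.one_mem_ball]
  | succ n ih => rw [pow_succ]; simpa using hv.mul_mem_ball ih hx

theorem eq_zero_of_forall_mem_ball (hv : IsDiscVal v) {x : K} (h : ∀ n : ℕ, x ∈ hv.ball n) :
    x = 0 := by
  by_contra h0
  have := (hv.mem_ball_of_ne h0).1 (h ((v x).toNat + 1))
  push_cast at this
  omega

/-- An element congruent to a nonzero element modulo higher valuation has the same valuation. -/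
theorem map_eq_of_sub_mem (hv : IsDiscVal v) {x y : K} (hx : x ≠ 0)
    (h : y - x ∈ hv.ball (v x + 1)) : y ≠ 0 ∧ v y = v x := by
  have hxn : x ∉ hv.ball (v x + 1) := by rw [hv.mem_ball_of_ne hx]; omega
  have h0 : y ≠ 0 := by
    rintro rfl
    exact hxn (by simpa using neg_mem h)
  refine ⟨h0, le_antisymm ?_ ?_⟩
  · by_contra! hlt
    refine hxn ?_
    have h1 : y ∈ hv.ball (v x + 1) := (hv.mem_ball_of_ne h0).2 hlt
    simpa using sub_mem h1 h
  · have h1 : y ∈ hv.ball (v x) := by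
      simpa using add_mem (hv.ball_anti (by omega) h) (hv.mem_ball_self x)
    exact (hv.mem_ball_of_ne h0).1 h1

/-- The valuation ring. -/
def integers (hv : IsDiscVal v) : Subring K where
  __ := hv.ball 0
  one_mem' := hv.one_mem_ball
  mul_mem' := fun hx hy => by simpa using hv.mul_mem_ball hx hy

/-- Congruent integers have congruent powers. -/
theorem pow_sub_pow_mem (hv : IsDiscVal v) {x y : K} {n : ℤ} (hx : x ∈ hv.ball 0)
    (hy : y ∈ hv.ball 0) (h : x - y ∈ hv.ball n) (m : ℕ) : x ^ m - y ^ m ∈ hv.ball n := by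
  induction m with
  | zero => simp
  | succ m ih =>
    have : x ^ (m + 1) - y ^ (m + 1) = (x ^ m - y ^ m) * x + y ^ m * (x - y) := by
      simp only [pow_succ]; noncomm_ring
    rw [this]
    exact add_mem (by simpa using hv.mul_mem_ball ih hx)
      (by simpa using hv.mul_mem_ball (hv.pow_mem_ball_zero hy m) h)

/-- High `q`-powers of one-units tend to one. -/
theorem one_unit_pow_sub_one_mem (hv : IsDiscVal v) {q : ℕ} (hq : (q : K) ∈ hv.ball 1) {u : K}
    (hu : u - 1 ∈ hv.ball 1) (n : ℕ) : u ^ q ^ n - 1 ∈ hv.ball (n + 1) := by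
  induction n with
  | zero => simpa using hu
  | succ n ih =>
    set w := u ^ q ^ n with hw
    have hw1 : w - 1 ∈ hv.ball 1 := hv.ball_anti (by omega) ih
    have hw0 : w ∈ hv.ball 0 := by
      simpa using add_mem (hv.ball_anti (by omega) hw1) hv.one_mem_ball
    have hgeom : ∑ i ∈ Finset.range q, w ^ i ∈ hv.ball 1 := by
      have : ∑ i ∈ Finset.range q, w ^ i = ∑ i ∈ Finset.range q, (w ^ i - 1 ^ i) + q := by
        simp
      rw [this]
      exact add_mem (sum_mem fun i _ => hv.pow_sub_pow_mem hw0 hv.one_mem_ball hw1 i) hq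
    have : u ^ q ^ (n + 1) - 1 = (w - 1) * ∑ i ∈ Finset.range q, w ^ i := by
      rw [mul_geom_sum, pow_succ, pow_mul]
    rw [this]
    have := hv.mul_mem_ball ih hgeom
    push_cast
    exact this

/-- Sequential completeness for a discrete valuation. -/
def Complete (hv : IsDiscVal v) : Prop :=
  ∀ a : ℕ → K, (∀ n : ℕ, a (n + 1) - a n ∈ hv.ball n) → ∃ l, ∀ n : ℕ, l - a n ∈ hv.ball n

end IsDiscVal

/-- The integral valuation attached to an `EReal`-valued one with value group `(1/e)ℤ`. -/
def intVal {K : Type*} (ν : K → EReal) (e : ℕ) (x : K) : ℤ := round ((ν x).toReal * e)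

namespace IsLocalValuation

variable {K : Type*} [DivisionRing K] {ν : K → EReal} {e q : ℕ}

theorem eq_intVal (h : IsLocalValuation K ν e q) {x : K} (hx : x ≠ 0) :
    ν x = ((intVal ν e x / e : ℝ) : EReal) := by
  obtain ⟨m, hm⟩ := h.values x hx
  have he : (e : ℝ) ≠ 0 := by exact_mod_cast h.e_pos.ne'
  have : intVal ν e x = m := by
    rw [intVal, hm, EReal.toReal_coe, div_mul_cancel₀ _ he, round_intCast]
  rw [this, hm]

theorem intVal_eq_iff (h : IsLocalValuation K ν e q) {x : K} (hx : x ≠ 0) {m : ℤ} :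
    intVal ν e x = m ↔ ν x = ((m / e : ℝ) : EReal) := by
  have he : (e : ℝ) ≠ 0 := by exact_mod_cast h.e_pos.ne'
  rw [h.eq_intVal hx, EReal.coe_eq_coe_iff, div_left_inj' he]
  exact_mod_cast Iff.rfl

theorem isDiscVal (h : IsLocalValuation K ν e q) : IsDiscVal (intVal ν e) where
  map_mul x y hx hy := by
    rw [h.intVal_eq_iff (mul_ne_zero hx hy), h.map_mul, h.eq_intVal hx, h.eq_intVal hy,
      ← EReal.coe_add]
    push_cast
    rw [add_div, EReal.coe_add]
  min_le_add x y hx hy hxy := by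
    have := h.min_le_add x y
    have he : (0 : ℝ) < e := by exact_mod_cast h.e_pos
    rw [h.eq_intVal hx, h.eq_intVal hy, h.eq_intVal hxy, min_le_iff, EReal.coe_le_coe_iff,
      EReal.coe_le_coe_iff, div_le_div_iff_of_pos_right he, div_le_div_iff_of_pos_right he] at this
    exact_mod_cast min_le_iff.2 this

theorem le_iff_mem_ball (h : IsLocalValuation K ν e q) {x : K} {j : ℤ} :
    ((j / e : ℝ) : EReal) ≤ ν x ↔ x ∈ h.isDiscVal.ball j := by
  have he : (0 : ℝ) < e := by exact_mod_cast h.e_pos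
  by_cases hx : x = 0
  · simp [hx, (h.eq_top_iff 0).2 rfl, zero_mem]
  · rw [h.isDiscVal.mem_ball_of_ne hx, h.eq_intVal hx, EReal.coe_le_coe_iff,
      div_le_div_iff_of_pos_right he]
    exact_mod_cast Iff.rfl

theorem nonneg_iff (h : IsLocalValuation K ν e q) {x : K} : 0 ≤ ν x ↔ x ∈ h.isDiscVal.ball 0 := by
  rw [← h.le_iff_mem_ball]; simp

theorem pos_iff (h : IsLocalValuation K ν e q) {x : K} : 0 < ν x ↔ x ∈ h.isDiscVal.ball 1 := by
  have he : (0 : ℝ) < e := by exact_mod_cast h.e_pos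
  by_cases hx : x = 0
  · simp [hx, (h.eq_top_iff 0).2 rfl, zero_mem]
  · rw [h.isDiscVal.mem_ball_of_ne hx, h.eq_intVal hx, EReal.coe_pos, div_pos_iff_of_pos_right he]
    exact_mod_cast Iff.rfl

theorem exists_intVal_eq_one (h : IsLocalValuation K ν e q) :
    ∃ π : K, π ≠ 0 ∧ intVal ν e π = 1 := by
  obtain ⟨π, hπ⟩ := h.exists_uniformizer
  have h0 : π ≠ 0 := by
    intro h0
    rw [(h.eq_top_iff π).2 h0] at hπ
    exact (EReal.coe_ne_top _) hπ.symm
  exact ⟨π, h0, (h.intVal_eq_iff h0).2 (by rw [hπ]; simp)⟩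

theorem isComplete (h : IsLocalValuation K ν e q) : h.isDiscVal.Complete := by
  intro a ha
  have he : (0 : ℝ) < e := by exact_mod_cast h.e_pos
  have step : ∀ n k : ℕ, a (n + k) - a n ∈ h.isDiscVal.ball n := by
    intro n k
    induction k with
    | zero => simp
    | succ k ih =>
      have : a (n + (k + 1)) - a n = (a (n + k + 1) - a (n + k)) + (a (n + k) - a n) := by
        rw [← add_assoc]; abel
      rw [this]
      exact add_mem (h.isDiscVal.ball_anti (by push_cast; omega) (ha (n + k))) ih
  have key : ∀ n m : ℕ, n ≤ m → a m - a n ∈ h.isDiscVal.ball n := by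
    intro n m hnm
    obtain ⟨k, rfl⟩ := Nat.exists_eq_add_of_le hnm
    exact step n k
  have hbig : ∀ (M : ℝ) (n : ℕ) (x : K), ⌈M * e⌉₊ ≤ n → x ∈ h.isDiscVal.ball n →
      (M : EReal) ≤ ν x := by
    intro M n x hn hx
    refine le_trans ?_ (h.le_iff_mem_ball.2 hx)
    rw [EReal.coe_le_coe_iff, le_div_iff₀ he]
    exact (Nat.le_ceil _).trans (by exact_mod_cast hn)
  obtain ⟨l, hl⟩ := h.complete a (fun M => ⟨⌈M * e⌉₊, fun m hm n hn => by
    rcases le_total n m with hnm | hnm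
    · exact hbig M n _ hn (key n m hnm)
    · refine hbig M m _ hm ?_
      simpa using neg_mem (key m n hnm)⟩)
  refine ⟨l, fun n => ?_⟩
  obtain ⟨N, hN⟩ := hl (n / e)
  have h1 := hN (max N n) (le_max_left _ _)
  have h2 : a (max N n) - l ∈ h.isDiscVal.ball n := by
    rw [← h.le_iff_mem_ball, Int.cast_natCast]; exact h1
  simpa using sub_mem (key n (max N n) (le_max_right _ _)) h2

theorem exists_residueField.{u} {K : Type u} [DivisionRing K] {ν : K → EReal} {e q : ℕ}
    (h : IsLocalValuation K ν e q) :
    ∃ (κ : Type u) (_ : Field κ) (_ : Finite κ) (r : h.isDiscVal.integers →+* κ),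
      Function.Surjective r ∧ (∀ x, r x = 0 ↔ (x : K) ∈ h.isDiscVal.ball 1) ∧ Nat.card κ = q := by
  set hv := h.isDiscVal
  let I : Ideal hv.integers :=
    { carrier := {x | (x : K) ∈ hv.ball 1}
      zero_mem' := (hv.ball 1).zero_mem
      add_mem' := fun hx hy => (hv.ball 1).add_mem hx hy
      smul_mem' := fun c x hx => by simpa using hv.mul_mem_ball c.2 hx }
  have hI : ∀ x : hv.integers, x ∈ I ↔ (x : K) ∈ hv.ball 1 := fun x => Iff.rfl
  have : I.IsTwoSided := ⟨fun b hx => by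
    rw [hI] at hx ⊢; simpa using hv.mul_mem_ball hx b.2⟩
  obtain ⟨s, hs, hs0, hsu⟩ := h.residue
  let f : s → hv.integers ⧸ I := fun y => Ideal.Quotient.mk I ⟨y, h.nonneg_iff.1 (hs0 y y.2)⟩
  have hf : Function.Bijective f := by
    constructor
    · intro y y' hyy
      have h1 : (⟨y, h.nonneg_iff.1 (hs0 y y.2)⟩ : hv.integers) -
        ⟨y', h.nonneg_iff.1 (hs0 y' y'.2)⟩ ∈ I := Ideal.Quotient.eq.1 hyy
      have h2 : (0 : EReal) < ν ((y : K) - y') := h.pos_iff.2 h1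
      have h3 : (0 : EReal) < ν ((y : K) - y) := h.pos_iff.2 (by simp)
      exact Subtype.ext ((hsu y (hs0 y y.2)).unique ⟨y.2, h3⟩ ⟨y'.2, h2⟩)
    · intro x
      obtain ⟨x, rfl⟩ := Ideal.Quotient.mk_surjective x
      obtain ⟨y, ⟨hy, hxy⟩, -⟩ := hsu x (h.nonneg_iff.2 x.2)
      refine ⟨⟨y, hy⟩, Eq.symm (Ideal.Quotient.eq.2 ?_)⟩
      rw [hI]
      exact h.pos_iff.1 hxy
  have hcard : Nat.card (hv.integers ⧸ I) = q := by
    rw [← Nat.card_congr (Equiv.ofBijective f hf)]; simp [hs]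
  have hfin : Finite (hv.integers ⧸ I) := Finite.of_surjective f hf.2
  have hnt : Nontrivial (hv.integers ⧸ I) := by
    rw [← Finite.one_lt_card_iff_nontrivial, hcard]; exact h.one_lt_q
  have hunit : ∀ a : hv.integers ⧸ I, IsUnit a ∨ a = 0 := by
    intro a
    obtain ⟨x, rfl⟩ := Ideal.Quotient.mk_surjective a
    by_cases hx : x ∈ I
    · exact Or.inr (Ideal.Quotient.eq_zero_iff_mem.2 hx)
    left
    have hx0 : (x : K) ≠ 0 := fun h0 => hx (by rw [hI, h0]; exact zero_mem _)
    have hvx : intVal ν e (x : K) = 0 := by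
      have h1 := (hv.mem_ball_of_ne hx0).1 x.2
      have h2 := mt (hv.mem_ball_of_ne hx0).2 hx
      omega
    have hy : (x : K)⁻¹ ∈ hv.integers :=
      (hv.mem_ball_of_ne (inv_ne_zero hx0)).2 (by rw [hv.map_inv hx0, hvx]; simp)
    have hu : IsUnit x := ⟨⟨x, ⟨_, hy⟩, Subtype.ext (mul_inv_cancel₀ hx0),
      Subtype.ext (inv_mul_cancel₀ hx0)⟩, rfl⟩
    exact hu.map _
  let := DivisionRing.ofIsUnitOrEqZero hunit
  refine ⟨hv.integers ⧸ I, littleWedderburn _, hfin, Ideal.Quotient.mk I, ?_, ?_, ?_⟩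
  · exact Ideal.Quotient.mk_surjective
  · intro x; exact Ideal.Quotient.eq_zero_iff_mem
  · exact hcard

end IsLocalValuation

namespace IsDiscVal

variable {K : Type*} [DivisionRing K] {v : K → ℤ}

/-- `r` is a residue map of the valuation ring onto a finite field. -/
structure IsResidueMap (hv : IsDiscVal v) {κ : Type*} [Field κ] (r : hv.integers →+* κ) :
    Prop where
  surj : Function.Surjective r
  eq_zero_iff : ∀ x, r x = 0 ↔ (x : K) ∈ hv.ball 1

variable {κ : Type*} [Field κ]

namespace IsResidueMap

variable {hv : IsDiscVal v} {r : hv.integers →+* κ}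

theorem eq_iff (hr : hv.IsResidueMap r) {x y : hv.integers} :
    r x = r y ↔ (x : K) - y ∈ hv.ball 1 := by
  rw [← sub_eq_zero, ← map_sub, hr.eq_zero_iff]; rfl

theorem ne_zero_iff (hr : hv.IsResidueMap r) (x : hv.integers) :
    r x ≠ 0 ↔ (x : K) ≠ 0 ∧ v x = 0 := by
  rw [Ne, hr.eq_zero_iff, mem_ball, not_or]
  refine and_congr_right fun h => ?_
  have := (hv.mem_ball_of_ne h).1 x.2
  omega

theorem natCast_mem [Finite κ] (hr : hv.IsResidueMap r) {m : ℕ} (hm : Nat.card κ ∣ m) :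
    (m : K) ∈ hv.ball 1 := by
  have h0 : r (m : hv.integers) = 0 := by
    obtain ⟨t, rfl⟩ := hm
    have := Fintype.ofFinite κ
    rw [Nat.card_eq_fintype_card, map_natCast, Nat.cast_mul, Nat.cast_card_eq_zero, zero_mul]
  have := (hr.eq_zero_iff _).1 h0
  simpa using this

theorem pow_card [Finite κ] (x : κ) : x ^ Nat.card κ = x := by
  have := Fintype.ofFinite κ
  rw [Nat.card_eq_fintype_card, FiniteField.pow_card]

/-- Teichmüller lifting. -/
theorem exists_pow_card_eq [Finite κ] (hr : hv.IsResidueMap r) (hc : hv.Complete) {z : κ}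
    (hz : z ≠ 0) : ∃ ζ : hv.integers, r ζ = z ∧ ζ ^ Nat.card κ = ζ := by
  obtain ⟨c, rfl⟩ := hr.surj z
  obtain ⟨c0, vc⟩ := (hr.ne_zero_iff c).1 hz
  set Q := Nat.card κ with hQ
  have hQ1 : 1 < Q := Finite.one_lt_card
  set u : K := (c : K) ^ (Q - 1) with hu
  have hcu : ∀ n, (c : K) ^ Q ^ (n + 1) = (c : K) ^ Q ^ n * u ^ Q ^ n := by
    intro n
    rw [hu, ← pow_mul, ← pow_add, pow_succ]
    congr 1
    obtain ⟨s, hs⟩ : ∃ s, Q = s + 1 := ⟨Q - 1, by omega⟩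
    rw [show Q - 1 = s by omega]
    nth_rewrite 2 [hs]
    ring
  have hu1 : u - 1 ∈ hv.ball 1 := by
    have : r (c ^ (Q - 1)) = r 1 := by
      have h1 : r c ^ (Q - 1) * r c = r c := by
        rw [← pow_succ, Nat.sub_add_cancel hQ1.le, pow_card]
      rw [_root_.map_pow, _root_.map_one]
      exact mul_right_cancel₀ hz (by rw [h1, one_mul])
    simpa using hr.eq_iff.1 this
  obtain ⟨l, hl⟩ := hc (fun n => (c : K) ^ Q ^ n) (fun n => by
    have : (c : K) ^ Q ^ (n + 1) - (c : K) ^ Q ^ n = (c : K) ^ Q ^ n * (u ^ Q ^ n - 1) := by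
      rw [hcu, mul_sub, mul_one]
    rw [this]
    have h1 := hv.one_unit_pow_sub_one_mem (hr.natCast_mem dvd_rfl) hu1 n
    have h2 := hv.pow_mem_ball_zero c.2 (Q ^ n)
    exact hv.ball_anti (by omega) (hv.mul_mem_ball h2 h1))
  have hcn : ∀ n : ℕ, (c : K) ^ n ∈ hv.ball 0 := fun n => hv.pow_mem_ball_zero c.2 n
  have hl0 : l ∈ hv.ball 0 := by
    have h : l - (c : K) ^ Q ^ 0 ∈ hv.ball 0 := hl 0
    rw [← sub_add_cancel l ((c : K) ^ Q ^ 0)]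
    exact add_mem h (hcn _)
  refine ⟨⟨l, hl0⟩, ?_, ?_⟩
  · have h1 : l - (c : K) ^ Q ∈ hv.ball 1 := by simpa using hl 1
    have h2 : r ⟨l, hl0⟩ = r (c ^ Q) := hr.eq_iff.2 (by simpa using h1)
    rw [h2, _root_.map_pow, pow_card]
  · refine Subtype.ext ?_
    change l ^ Q = l
    rw [← sub_eq_zero]
    refine hv.eq_zero_of_forall_mem_ball fun n => ?_
    have h1 := hv.pow_sub_pow_mem hl0 (hcn _) (hl n) Q
    rw [← pow_mul, ← pow_succ] at h1
    have h2 := hv.ball_anti (i := n) (by push_cast; omega) (hl (n + 1))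
    simpa using sub_mem h1 h2

end IsResidueMap

section Commutative

variable {E : Type*} [Field E] {v : E → ℤ} {hv : IsDiscVal v} {r : hv.integers →+* κ}

theorem exists_pow_mul_eq (hc : hv.Complete) {Q : ℕ} (hQ : (Q : E) ∈ hv.ball 1) {u : E}
    (hu : u - 1 ∈ hv.ball 1) : ∃ w : E, w - 1 ∈ hv.ball 1 ∧ w ^ Q * u = w := by
  let a : ℕ → E := fun n => ∏ i ∈ Finset.range n, u ^ Q ^ i
  have hpow := hv.one_unit_pow_sub_one_mem hQ hu
  have ha1 : ∀ n, a n - 1 ∈ hv.ball 1 := by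
    intro n
    induction n with
    | zero => simp [a]
    | succ n ih =>
      have h0 : a n ∈ hv.ball 0 := by
        simpa using add_mem (hv.ball_anti (by omega) ih) hv.one_mem_ball
      have : a (n + 1) - 1 = a n * (u ^ Q ^ n - 1) + (a n - 1) := by
        simp only [a, Finset.prod_range_succ]; ring
      rw [this]
      exact add_mem (hv.ball_anti (by omega) (hv.mul_mem_ball h0 (hpow n))) ih
  have ha0 : ∀ n, a n ∈ hv.ball 0 := fun n => by
    simpa using add_mem (hv.ball_anti (by omega) (ha1 n)) hv.one_mem_ball
  have hsucc : ∀ n, a (n + 1) = a n ^ Q * u := by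
    intro n
    simp only [a]
    rw [Finset.prod_range_succ', ← Finset.prod_pow, pow_zero, pow_one]
    simp only [← pow_mul, pow_succ]
  obtain ⟨w, hw⟩ := hc a (fun n => by
    have : a (n + 1) - a n = a n * (u ^ Q ^ n - 1) := by
      simp only [a, Finset.prod_range_succ]; ring
    rw [this]
    exact hv.ball_anti (by omega) (hv.mul_mem_ball (ha0 n) (hpow n)))
  have hu0 : u ∈ hv.ball 0 := by
    simpa using add_mem (hv.ball_anti (by omega) hu) hv.one_mem_ball
  have hw0 : w ∈ hv.ball 0 := by simpa using add_mem (hw 0) (ha0 0)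
  refine ⟨w, ?_, ?_⟩
  · simpa using add_mem (hw 1) (ha1 1)
  · rw [← sub_eq_zero]
    refine hv.eq_zero_of_forall_mem_ball fun n => ?_
    have h1 := hv.mul_mem_ball (hv.pow_sub_pow_mem hw0 (ha0 n) (hw n) Q) hu0
    have h2 := hv.ball_anti (i := n) (by push_cast; omega) (hw (n + 1))
    rw [hsucc] at h2
    have := sub_mem (by simpa using h1) h2
    ring_nf at this ⊢
    exact this

/-- Every integer-valued character of the multiplicative group is trivial on units. -/
theorem character_unit_eq_zero [Finite κ] (hr : hv.IsResidueMap r) (hc : hv.Complete)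
    (n : E → ℤ) (hn : ∀ x y, x ≠ 0 → y ≠ 0 → n (x * y) = n x + n y) {u : E} (hu : u ≠ 0)
    (hvu : v u = 0) : n u = 0 := by
  have hn1 : n 1 = 0 := by
    have := hn 1 1 one_ne_zero one_ne_zero
    rw [mul_one] at this
    omega
  have hpow : ∀ (x : E) (m : ℕ), x ≠ 0 → n (x ^ m) = m * n x := by
    intro x m hx
    induction m with
    | zero => simp [hn1]
    | succ m ih => rw [pow_succ, hn _ _ (pow_ne_zero _ hx) hx, ih]; push_cast; ring
  have hne : ∀ x : E, x - 1 ∈ hv.ball 1 → x ≠ 0 := fun x hx =>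
    (hv.map_eq_of_sub_mem one_ne_zero (by simpa [hv.map_one] using hx)).1
  set q := Nat.card κ with hq
  have hq1 : 1 < q := Finite.one_lt_card
  set Q := q ^ 2 with hQ
  have hQ4 : 4 ≤ Q := by nlinarith
  have hQm := hr.natCast_mem (m := Q) (Dvd.intro_left _ (pow_succ q 1).symm)
  have hdvd : ∀ m : ℕ, ∀ x : E, x - 1 ∈ hv.ball 1 → ((Q : ℤ) - 1) ^ m ∣ n x := by
    intro m
    induction m with
    | zero => intro x _; simp
    | succ m ih =>
      intro x hx
      obtain ⟨w, hw1, hw⟩ := exists_pow_mul_eq hc hQm hx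
      have h1 := congrArg n hw
      rw [hn _ _ (pow_ne_zero _ (hne w hw1)) (hne x hx), hpow _ _ (hne w hw1)] at h1
      have h2 : n x = ((Q : ℤ) - 1) * (- n w) := by linear_combination h1
      rw [h2, pow_succ']
      exact mul_dvd_mul_left _ ((dvd_neg).2 (ih w hw1))
  have hone : ∀ x : E, x - 1 ∈ hv.ball 1 → n x = 0 := by
    intro x hx
    have h1 := hdvd (n x).natAbs x hx
    refine Int.eq_zero_of_abs_lt_dvd h1 ?_
    have h2 : (n x).natAbs < 3 ^ (n x).natAbs := Nat.lt_pow_self (by norm_num)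
    have h3 : (3 : ℤ) ^ (n x).natAbs ≤ ((Q : ℤ) - 1) ^ (n x).natAbs :=
      pow_le_pow_left₀ (by norm_num) (by have : (4 : ℤ) ≤ Q := by exact_mod_cast hQ4
                                         omega) _
    rw [Int.abs_eq_natAbs]
    refine lt_of_lt_of_le ?_ h3
    exact_mod_cast h2
  have hui : u ∈ hv.integers := (hv.mem_ball_of_ne hu).2 hvu.ge
  have hru : r ⟨u, hui⟩ ≠ 0 := (hr.ne_zero_iff _).2 ⟨hu, hvu⟩
  have h1 : u ^ (q - 1) - 1 ∈ hv.ball 1 := by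
    have : r (⟨u, hui⟩ ^ (q - 1)) = r 1 := by
      rw [_root_.map_pow, _root_.map_one]
      refine mul_right_cancel₀ hru ?_
      rw [← pow_succ, Nat.sub_add_cancel hq1.le, IsResidueMap.pow_card, one_mul]
    simpa using hr.eq_iff.1 this
  have h2 := hone _ h1
  rw [hpow _ _ hu] at h2
  refine (mul_eq_zero.1 h2).resolve_left ?_
  have : 0 < q - 1 := by omega
  exact_mod_cast this.ne'

end Commutative

end IsDiscVal

namespace IsDiscVal

section Independence

variable {k D : Type*} [Field k] [DivisionRing D] [Algebra k D] {vk : k → ℤ} {v : D → ℤ}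
  {hk : IsDiscVal vk} {hv : IsDiscVal v} {κ₀ κ : Type*} [Field κ₀] [Field κ] [Algebra κ₀ κ]
  {rk : hk.integers →+* κ₀} {r : hv.integers →+* κ} {d : ℕ}

/-- A sum `∑ πⁱ yᵢ`, `i < d`, with all `v yᵢ` divisible by `d`, vanishes only trivially. -/
theorem eq_zero_of_sum_pow_mul_eq_zero (hv : IsDiscVal v) {π : D} (hπ : π ≠ 0) (vπ : v π = 1)
    (y : Fin d → D) (hy : ∀ i, y i ≠ 0 → (d : ℤ) ∣ v (y i))
    (hsum : ∑ i : Fin d, π ^ (i : ℕ) * y i = 0) (i : Fin d) : y i = 0 := by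
  classical
  by_contra hi
  let S : Finset (Fin d) := Finset.univ.filter fun i => y i ≠ 0
  obtain ⟨m, hmS, hm⟩ := S.exists_min_image (fun i => v (π ^ (i : ℕ) * y i)) ⟨i, by simp [S, hi]⟩
  have hym : y m ≠ 0 := by simpa [S] using hmS
  have hval : ∀ j, y j ≠ 0 → v (π ^ (j : ℕ) * y j) = j + v (y j) := by
    intro j hj
    rw [hv.map_mul _ _ (pow_ne_zero _ hπ) hj, hv.map_pow hπ, vπ, mul_one]
  have hx0 : π ^ (m : ℕ) * y m ≠ 0 := mul_ne_zero (pow_ne_zero _ hπ) hym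
  refine (hv.map_eq_of_sub_mem (y := 0) hx0 ?_).1 rfl
  rw [← Finset.add_sum_erase _ _ (Finset.mem_univ m)] at hsum
  rw [zero_sub, neg_eq_of_add_eq_zero_right hsum]
  refine sum_mem fun j hj => ?_
  have hjm : j ≠ m := (Finset.mem_erase.1 hj).1
  by_cases hyj : y j = 0
  · exact Or.inl (by simp [hyj])
  refine Or.inr ?_
  have h1 := hm j (by simp [S, hyj])
  rw [hval j hyj, hval m hym] at h1 ⊢
  refine Int.add_one_le_iff.2 (lt_of_le_of_ne h1 fun h2 => hjm ?_)
  obtain ⟨a, ha⟩ := hy j hyj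
  obtain ⟨b, hb⟩ := hy m hym
  rw [ha, hb] at h2
  have hj' := j.2
  have hm' := m.2
  have h3 : ((m : ℕ) : ℤ) % d = ((j : ℕ) : ℤ) % d := by
    have := congrArg (· % (d : ℤ)) h2
    simpa using this
  rw [Int.emod_eq_of_lt (by omega) (by omega), Int.emod_eq_of_lt (by omega) (by omega)] at h3
  exact Fin.ext (by omega)

theorem dvd_val_sum_smul {ι : Type*} [Fintype ι]
    (hcompat : ∀ c : k, c ≠ 0 → v (algebraMap k D c) = d * vk c)
    (hr : hv.IsResidueMap r)
    (hrk : ∀ (c : hk.integers) (x : hv.integers), (x : D) = algebraMap k D c →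
      r x = algebraMap κ₀ κ (rk c)) (hrkk : hk.IsResidueMap rk)
    (B : ι → hv.integers) (hB : LinearIndependent κ₀ (fun j => r (B j))) (c : ι → k)
    (hc : ∃ j, c j ≠ 0) :
    ∑ j, c j • (B j : D) ≠ 0 ∧ (d : ℤ) ∣ v (∑ j, c j • (B j : D)) := by
  classical
  let S : Finset ι := Finset.univ.filter fun j => c j ≠ 0
  obtain ⟨j0, hj0⟩ := hc
  obtain ⟨m, hmS, hm⟩ := S.exists_min_image (fun j => vk (c j)) ⟨j0, by simp [S, hj0]⟩
  have hcm : c m ≠ 0 := by simpa [S] using hmS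
  have hinteg : ∀ j, (c m)⁻¹ * c j ∈ hk.integers := by
    intro j
    by_cases hj : c j = 0
    · exact Or.inl (by simp [hj])
    · refine Or.inr ?_
      rw [hk.map_mul _ _ (inv_ne_zero hcm) hj, hk.map_inv hcm]
      have := hm j (by simp [S, hj])
      omega
  have hintegD : ∀ x : hk.integers, algebraMap k D x ∈ hv.integers := by
    intro x
    by_cases hx : (x : k) = 0
    · exact Or.inl (by simp [hx])
    · refine Or.inr ?_
      rw [hcompat _ hx]
      exact mul_nonneg (by positivity) ((hk.mem_ball_of_ne hx).1 x.2)
  let s : hv.integers := ∑ j, ⟨algebraMap k D ((c m)⁻¹ * c j), hintegD ⟨_, hinteg j⟩⟩ * B j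
  have hs : (s : D) = algebraMap k D (c m)⁻¹ * ∑ j, c j • (B j : D) := by
    simp only [s, AddSubmonoidClass.coe_finsetSum, Subring.coe_mul, Finset.mul_sum]
    refine Finset.sum_congr rfl fun j _ => ?_
    rw [Algebra.smul_def, _root_.map_mul, mul_assoc]
  have hrs : r s ≠ 0 := by
    intro h0
    have h1 : ∑ j, rk ⟨_, hinteg j⟩ • r (B j) = 0 := by
      rw [← h0, map_sum]
      refine Finset.sum_congr rfl fun j _ => ?_
      rw [_root_.map_mul, hrk ⟨_, hinteg j⟩ ⟨algebraMap k D _, hintegD ⟨_, hinteg j⟩⟩ rfl,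
        Algebra.smul_def]
    have h2 := Fintype.linearIndependent_iff.1 hB _ h1 m
    refine (hrkk.ne_zero_iff _).2 ?_ h2
    simp [hcm, hk.map_one]
  obtain ⟨hs0, hvs⟩ := (hr.ne_zero_iff s).1 hrs
  rw [hs] at hs0 hvs
  have hsum0 := right_ne_zero_of_mul hs0
  refine ⟨hsum0, ?_⟩
  rw [hv.map_mul _ _ (left_ne_zero_of_mul hs0) hsum0, hcompat _ (inv_ne_zero hcm)] at hvs
  exact ⟨- vk (c m)⁻¹, by linear_combination hvs⟩

theorem finrank_residue_le [FiniteDimensional k D] [FiniteDimensional κ₀ κ]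
    (hcompat : ∀ c : k, c ≠ 0 → v (algebraMap k D c) = d * vk c)
    (hr : hv.IsResidueMap r)
    (hrk : ∀ (c : hk.integers) (x : hv.integers), (x : D) = algebraMap k D c →
      r x = algebraMap κ₀ κ (rk c)) (hrkk : hk.IsResidueMap rk)
    {π : D} (hπ : π ≠ 0) (vπ : v π = 1) :
    d * Module.finrank κ₀ κ ≤ Module.finrank k D := by
  classical
  let b := Module.finBasis κ₀ κ
  choose B hB using fun j => hr.surj (b j)
  have hBi : LinearIndependent κ₀ (fun j => r (B j)) := by simpa only [hB] using b.linearIndependent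
  have hli : LinearIndependent k
      (fun p : Fin d × Fin (Module.finrank κ₀ κ) => π ^ (p.1 : ℕ) * (B p.2 : D)) := by
    rw [Fintype.linearIndependent_iff]
    intro c hc
    have hy := hv.eq_zero_of_sum_pow_mul_eq_zero hπ vπ
      (fun i => ∑ j, c (i, j) • (B j : D)) (fun i hi => by
        refine (dvd_val_sum_smul hcompat hr hrk hrkk B hBi (fun j => c (i, j)) ?_).2
        by_contra! h0
        exact hi (by simp [h0])) (by
        rw [← hc, Fintype.sum_prod_type]
        refine Finset.sum_congr rfl fun i _ => ?_
        rw [Finset.mul_sum]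
        exact Finset.sum_congr rfl fun j _ => by rw [mul_smul_comm])
    rintro ⟨i, j⟩
    by_contra hij
    exact (dvd_val_sum_smul hcompat hr hrk hrkk B hBi (fun j => c (i, j)) ⟨j, hij⟩).1 (hy i)
  simpa using hli.fintype_card_le_finrank

end Independence

section Conjugation

variable {D : Type*} [DivisionRing D] {v : D → ℤ} {κ : Type*} [Field κ]

theorem conj_mem_ball (hv : IsDiscVal v) {π : D} (hπ : π ≠ 0) {x : D} {j : ℤ}
    (hx : x ∈ hv.ball j) : π * x * π⁻¹ ∈ hv.ball j := by
  have := hv.mul_mem_ball (hv.mul_mem_ball (hv.mem_ball_self π) hx) (hv.mem_ball_self π⁻¹)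
  rw [hv.map_inv hπ] at this
  simpa using this

/-- Conjugation by a nonzero element, on the valuation ring. -/
def conj (hv : IsDiscVal v) {π : D} (hπ : π ≠ 0) : hv.integers →+* hv.integers where
  toFun x := ⟨π * x * π⁻¹, hv.conj_mem_ball hπ x.2⟩
  map_one' := Subtype.ext (by simp [hπ])
  map_zero' := Subtype.ext (by simp)
  map_add' x y := Subtype.ext (by simp [mul_add, add_mul])
  map_mul' x y := Subtype.ext (by simp [mul_assoc, hπ])

theorem coe_conj (hv : IsDiscVal v) {π : D} (hπ : π ≠ 0) (x : hv.integers) :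
    (hv.conj hπ x : D) = π * x * π⁻¹ := rfl

variable {hv : IsDiscVal v} {r : hv.integers →+* κ}

/-- The automorphism of the residue field induced by conjugation. -/
theorem IsResidueMap.exists_conj {κ₀ : Type*} [Field κ₀] [Algebra κ₀ κ] [FiniteDimensional κ₀ κ]
    (hr : hv.IsResidueMap r)
    (hcentral : ∀ c : κ₀, ∃ x : hv.integers, r x = algebraMap κ₀ κ c ∧ ∀ y : D, x * y = y * x)
    {π : D} (hπ : π ≠ 0) :
    ∃ σ : κ ≃ₐ[κ₀] κ, ∀ x, r (hv.conj hπ x) = σ (r x) := by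
  have hker : RingHom.ker r ≤ RingHom.ker (r.comp (hv.conj hπ)) := by
    intro x hx
    rw [RingHom.mem_ker, hr.eq_zero_iff] at hx
    rw [RingHom.mem_ker, RingHom.comp_apply, hr.eq_zero_iff]
    exact hv.conj_mem_ball hπ hx
  let σ₀ : κ →+* κ := RingHom.liftOfSurjective r hr.surj ⟨r.comp (hv.conj hπ), hker⟩
  have hσ₀ : ∀ x, σ₀ (r x) = r (hv.conj hπ x) := by
    intro x
    exact RingHom.liftOfRightInverse_comp_apply _ _ _ _ _
  let σ₁ : κ →ₐ[κ₀] κ :=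
    { σ₀ with
      commutes' := by
        intro c
        obtain ⟨x, hx, hxc⟩ := hcentral c
        change σ₀ (algebraMap κ₀ κ c) = _
        rw [← hx, hσ₀]
        congr 1
        exact Subtype.ext (by rw [coe_conj, ← hxc, mul_assoc, mul_inv_cancel₀ hπ, mul_one]) }
  exact ⟨AlgEquiv.ofBijective σ₁ (Algebra.IsAlgebraic.algHom_bijective σ₁), fun x => (hσ₀ x).symm⟩

/-- Modifying a uniformizer so that it normalizes a given Teichmüller element. -/
theorem exists_uniformizer_semicomm [Finite κ] (hr : hv.IsResidueMap r) {π₀ : D}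
    (hπ₀ : π₀ ≠ 0) (vπ₀ : v π₀ = 1) {ζ : hv.integers} (hζ : ζ ^ (Nat.card κ - 1) = 1) {a : ℕ}
    (ha : r (hv.conj hπ₀ ζ) = r ζ ^ a) :
    ∃ π : D, π ≠ 0 ∧ v π = 1 ∧ π * ζ = (ζ : D) ^ a * π := by
  set q := Nat.card κ with hq
  have hq1 : 1 < q := Finite.one_lt_card
  obtain ⟨m, hm⟩ : ∃ m, q = m + 1 := ⟨q - 1, by omega⟩
  have hζm : ζ ^ m = 1 := by rw [← hζ, hm, Nat.add_sub_cancel]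
  have hm0 : 0 < m := by omega
  -- `ζ⁻¹ = ζ ^ (m - 1)`
  let η : hv.integers := ζ ^ (m - 1)
  have hηζ : η * ζ = 1 := by
    change ζ ^ (m - 1) * ζ = 1
    rw [← pow_succ, Nat.sub_add_cancel hm0, hζm]
  have hζη : ζ * η = 1 := by
    change ζ * ζ ^ (m - 1) = 1
    rw [← pow_succ', Nat.sub_add_cancel hm0, hζm]
  have hηm : η ^ m = 1 := by
    change (ζ ^ (m - 1)) ^ m = 1
    rw [← pow_mul, mul_comm, pow_mul, hζm, one_pow]
  let t : ℕ → hv.integers := fun i => (ζ ^ a) ^ i * hv.conj hπ₀ (η ^ i)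
  let T : hv.integers := ∑ i ∈ Finset.range m, t i
  have hrt : ∀ i, r (t i) = 1 := by
    intro i
    have h1 : r ζ ^ a * r (hv.conj hπ₀ η) = 1 := by
      rw [← ha, ← _root_.map_mul, ← _root_.map_mul, hζη, _root_.map_one, _root_.map_one]
    simp only [t, _root_.map_mul, _root_.map_pow]
    rw [← mul_pow, h1, one_pow]
  have hrT : r T ≠ 0 := by
    have h1 : r T + 1 = 0 := by
      have h2 : ((q : ℕ) : κ) = 0 := by
        have := Fintype.ofFinite κ
        rw [hq, Nat.card_eq_fintype_card, Nat.cast_card_eq_zero]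
      rw [← h2, hm]
      simp [T, map_sum, hrt]
    intro h0
    rw [h0, zero_add] at h1
    exact one_ne_zero h1
  obtain ⟨hT0, hvT⟩ := (hr.ne_zero_iff T).1 hrT
  refine ⟨T * π₀, mul_ne_zero hT0 hπ₀, by rw [hv.map_mul _ _ hT0 hπ₀, hvT, vπ₀, zero_add], ?_⟩
  have hconj : ∀ x : hv.integers, (hv.conj hπ₀ x : D) * π₀ = π₀ * x := fun x => by
    rw [coe_conj, mul_assoc, inv_mul_cancel₀ hπ₀, mul_one]
  have key : T * hv.conj hπ₀ ζ = ζ ^ a * T := by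
    have hstep : ∀ i, t (i + 1) * hv.conj hπ₀ ζ = ζ ^ a * t i := by
      intro i
      simp only [t]
      rw [mul_assoc, ← _root_.map_mul, pow_succ η, mul_assoc, hηζ, mul_one, pow_succ' (ζ ^ a),
        mul_assoc]
    have hper : t m = t 0 := by
      simp only [t, hηm, pow_zero]
      rw [← pow_mul, mul_comm, pow_mul, hζm, one_pow]
    have hT' : T = ∑ i ∈ Finset.range m, t (i + 1) := by
      have h1 := Finset.sum_range_succ t m
      rw [Finset.sum_range_succ', hper] at h1
      exact (add_right_cancel h1).symm
    calc T * hv.conj hπ₀ ζ = ∑ i ∈ Finset.range m, t (i + 1) * hv.conj hπ₀ ζ := by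
          rw [hT', Finset.sum_mul]
      _ = ζ ^ a * T := by simp only [hstep, T, Finset.mul_sum]
  have keyD := congrArg (fun x : hv.integers => (x : D) * π₀) key
  simp only [Subring.coe_mul, Subring.coe_pow] at keyD
  rw [mul_assoc, hconj] at keyD
  rw [mul_assoc, keyD, mul_assoc]

/-- An element commuting with a uniformizer and a generating Teichmüller element is central. -/
theorem comm_of_comm_generators (hr : hv.IsResidueMap r) {π w : D} (hπ : π ≠ 0) (vπ : v π = 1)
    {ζ : hv.integers} (hgen : ∀ z : κ, z ≠ 0 → ∃ n : ℕ, r ζ ^ n = z) (hwπ : w * π = π * w)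
    (hwζ : w * ζ = ζ * w) (y : D) : w * y = y * w := by
  by_cases hw : w = 0
  · simp [hw]
  have hstep : ∀ (j : ℤ) (x : D), x ∈ hv.ball j → ∃ s : D, w * s = s * w ∧
      x - s ∈ hv.ball (j + 1) := by
    intro j x hx
    have hπj : π ^ j ≠ 0 := zpow_ne_zero _ hπ
    have ho : π ^ (-j) * x ∈ hv.integers := by
      have := hv.mul_mem_ball (hv.mem_ball_self (π ^ (-j))) hx
      rw [hv.map_zpow hπ, vπ, mul_one, neg_add_cancel] at this
      exact this
    have hx' : x = π ^ j * (π ^ (-j) * x) := by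
      rw [← mul_assoc, ← zpow_add₀ hπ, add_neg_cancel, zpow_zero, one_mul]
    by_cases h0 : r ⟨_, ho⟩ = 0
    · refine ⟨0, by simp, ?_⟩
      have := hv.mul_mem_ball (hv.mem_ball_self (π ^ j)) ((hr.eq_zero_iff _).1 h0)
      rw [hv.map_zpow hπ, vπ, mul_one] at this
      rw [sub_zero, hx']
      exact this
    · obtain ⟨n, hn⟩ := hgen _ h0
      refine ⟨π ^ j * (ζ : D) ^ n, ?_, ?_⟩
      · have h1 : Commute w (π ^ j) := Commute.zpow_right₀ hwπ j
        have h2 : Commute w ((ζ : D) ^ n) := Commute.pow_right hwζ n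
        exact h1.mul_right h2
      · rw [← _root_.map_pow] at hn
        have h1 := hr.eq_iff.1 hn.symm
        have := hv.mul_mem_ball (hv.mem_ball_self (π ^ j)) h1
        rw [hv.map_zpow hπ, vπ, mul_one, mul_sub] at this
        nth_rewrite 1 [hx']
        exact this
  have happrox : ∀ n : ℕ, ∃ s : D, w * s = s * w ∧ y - s ∈ hv.ball (v y + n) := by
    intro n
    induction n with
    | zero => exact ⟨0, by simp, by simpa using hv.mem_ball_self y⟩
    | succ n ih =>
      obtain ⟨s, hs, hys⟩ := ih
      obtain ⟨s', hs', hys'⟩ := hstep _ _ hys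
      refine ⟨s + s', by rw [mul_add, add_mul, hs, hs'], ?_⟩
      rw [← sub_sub]
      push_cast
      rw [← add_assoc]
      exact hys'
  rw [← sub_eq_zero]
  refine hv.eq_zero_of_forall_mem_ball fun n => ?_
  obtain ⟨s, hs, hys⟩ := happrox ((n : ℤ) - v y - v w).toNat
  have h1 : w * y - y * w = w * (y - s) - (y - s) * w := by
    rw [mul_sub, sub_mul, hs]; abel
  rw [h1]
  refine sub_mem (hv.ball_anti ?_ (hv.mul_mem_ball (hv.mem_ball_self w) hys))
    (hv.ball_anti ?_ (hv.mul_mem_ball hys (hv.mem_ball_self w))) <;> omega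

end Conjugation

/-- Structure of a central division algebra of index `d` over a local field: there is a
uniformizer `π` with `π ^ d` in the base field, conjugation by which generates the Galois group
of the residue field extension, which has degree `d`. -/
theorem exists_central_uniformizer {k D : Type*} [Field k] [DivisionRing D] [Algebra k D]
    {vk : k → ℤ} {v : D → ℤ}
    {hk : IsDiscVal vk} {hv : IsDiscVal v} {κ₀ κ : Type*} [Field κ₀] [Field κ] [Algebra κ₀ κ]
    [Finite κ] {rk : hk.integers →+* κ₀} {r : hv.integers →+* κ} {d : ℕ}
    (hd : 0 < d) (hcompat : ∀ c : k, c ≠ 0 → v (algebraMap k D c) = d * vk c)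
    (hr : hv.IsResidueMap r)
    (hrk : ∀ (c : hk.integers) (x : hv.integers), (x : D) = algebraMap k D c →
      r x = algebraMap κ₀ κ (rk c)) (hrkk : hk.IsResidueMap rk)
    (hc : hv.Complete) (hπ : ∃ π : D, π ≠ 0 ∧ v π = 1)
    (hcentral : ∀ z : D, (∀ w, z * w = w * z) → ∃ c : k, algebraMap k D c = z)
    (hdim : Module.finrank k D = d * d) :
    ∃ (π : D) (hπ : π ≠ 0), v π = 1 ∧ (∃ c : k, algebraMap k D c = π ^ d) ∧
      Module.finrank κ₀ κ = d ∧
      ∃ σ : κ ≃ₐ[κ₀] κ, orderOf σ = d ∧ ∀ x, r (hv.conj hπ x) = σ (r x) := by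
  obtain ⟨π₀, hπ₀, vπ₀⟩ := hπ
  have : FiniteDimensional κ₀ κ := inferInstance
  have : Finite κ₀ := Finite.of_injective _ (algebraMap κ₀ κ).injective
  have : FiniteDimensional k D := FiniteDimensional.of_finrank_pos (by rw [hdim]; positivity)
  have hcent : ∀ c : κ₀, ∃ x : hv.integers, r x = algebraMap κ₀ κ c ∧ ∀ y : D, x * y = y * x := by
    intro c
    obtain ⟨c, rfl⟩ := hrkk.surj c
    have hcD : algebraMap k D c ∈ hv.integers := by
      by_cases hx : (c : k) = 0
      · exact Or.inl (by simp [hx])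
      · refine Or.inr ?_
        rw [hcompat _ hx]
        exact mul_nonneg (by positivity) ((hk.mem_ball_of_ne hx).1 c.2)
    exact ⟨⟨_, hcD⟩, hrk c _ rfl, fun y => Algebra.commutes _ _⟩
  obtain ⟨g, hg⟩ := IsCyclic.exists_generator (α := κˣ)
  have hgenκ : ∀ z : κ, z ≠ 0 → ∃ n : ℕ, (g : κ) ^ n = z := by
    intro z hz
    obtain ⟨n, hn⟩ := (mem_powers_iff_mem_zpowers).2 (hg (Units.mk0 z hz))
    exact ⟨n, by simpa using congrArg Units.val hn⟩
  obtain ⟨ζ, hrζ, hζ⟩ := hr.exists_pow_card_eq hc g.ne_zero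
  have hq1 : 1 < Nat.card κ := Finite.one_lt_card
  obtain ⟨hζ0, hvζ⟩ := (hr.ne_zero_iff ζ).1 (by rw [hrζ]; exact g.ne_zero)
  have hζ1 : ζ ^ (Nat.card κ - 1) = 1 := by
    refine Subtype.ext (mul_right_cancel₀ hζ0 ?_)
    have := congrArg (Subtype.val) hζ
    rw [← Nat.sub_add_cancel hq1.le, pow_succ] at this
    simpa using this
  obtain ⟨σ₀, hσ₀⟩ := hr.exists_conj hcent hπ₀
  obtain ⟨a, ha⟩ := hgenκ (r (hv.conj hπ₀ ζ)) (by
    rw [hσ₀, hrζ]; simp)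
  obtain ⟨π, hπ, vπ, hπζ⟩ := exists_uniformizer_semicomm hr hπ₀ vπ₀ hζ1 (a := a)
    (by rw [hrζ, ha])
  obtain ⟨σ, hσ⟩ := hr.exists_conj hcent hπ
  have hσζ : σ g = g ^ a := by
    rw [← hrζ, ← hσ, ← _root_.map_pow]
    congr 1
    exact Subtype.ext (by rw [coe_conj, hπζ, mul_assoc, mul_inv_cancel₀ hπ, mul_one]; rfl)
  set m := orderOf σ with hm
  have hσn : ∀ n : ℕ, (σ ^ n) g = (g : κ) ^ a ^ n := by
    intro n
    induction n with
    | zero => simp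
    | succ n ih => rw [pow_succ', AlgEquiv.mul_apply, ih, _root_.map_pow, hσζ, ← pow_mul, pow_succ']
  have hπn : ∀ n : ℕ, π ^ n * ζ = (ζ : D) ^ a ^ n * π ^ n := by
    intro n
    induction n with
    | zero => simp
    | succ n ih =>
      have h1 : ∀ b : ℕ, π * (ζ : D) ^ b = (ζ : D) ^ (a * b) * π := by
        intro b
        induction b with
        | zero => simp
        | succ b ihb =>
          rw [pow_succ, ← mul_assoc, ihb, mul_assoc, hπζ, ← mul_assoc, ← pow_add, mul_add, mul_one]
      rw [pow_succ', mul_assoc, ih, ← mul_assoc, h1, mul_assoc, pow_succ']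
  have hmpow : (ζ : D) ^ a ^ m = ζ := by
    have h1 := hσn m
    rw [pow_orderOf_eq_one, AlgEquiv.one_apply] at h1
    have h2 : g ^ a ^ m = g ^ 1 := Units.ext (by simpa using h1.symm)
    rw [pow_eq_pow_iff_modEq, orderOf_eq_card_of_forall_mem_zpowers hg] at h2
    have h3 : ζ ^ a ^ m = ζ ^ 1 := by
      have : Nat.card κˣ = Nat.card κ - 1 := by rw [Nat.card_units]
      rw [this] at h2
      exact pow_eq_pow_of_modEq h2 hζ1
    simpa using congrArg Subtype.val h3
  have hcomm := comm_of_comm_generators hr hπ vπ (w := π ^ m) (ζ := ζ) (by rw [hrζ]; exact hgenκ)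
    (by rw [← pow_succ, ← pow_succ']) (by rw [hπn, hmpow])
  obtain ⟨c, hc'⟩ := hcentral (π ^ m) hcomm
  have hdm : d ∣ m := by
    have hc0 : c ≠ 0 := by
      rintro rfl
      rw [map_zero] at hc'
      exact pow_ne_zero m hπ hc'.symm
    have h1 := hcompat c hc0
    rw [hc', hv.map_pow hπ, vπ, mul_one] at h1
    exact_mod_cast Dvd.intro _ h1.symm
  have hm0 : 0 < m := orderOf_pos σ
  have hmf : m ∣ Module.finrank κ₀ κ := by
    rw [← IsGalois.card_aut_eq_finrank κ₀ κ]
    exact orderOf_dvd_natCard σ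
  have hfd : Module.finrank κ₀ κ ≤ d := by
    have := finrank_residue_le hcompat hr hrk hrkk hπ vπ
    rw [hdim] at this
    exact Nat.le_of_mul_le_mul_left this hd
  have h1 := Nat.le_of_dvd hm0 hdm
  have h2 := Nat.le_of_dvd Module.finrank_pos hmf
  have hmd : m = d := by omega
  exact ⟨π, hπ, vπ, ⟨c, by rw [hc', hmd]⟩, by omega, σ, by omega, hσ⟩

end IsDiscVal

open TensorProduct in
/-- In a tensor product `B ⊗ A` of field extensions, a nonzero ideal stable under an automorphism
`τ` of `B` is everything, provided the degrees of `A` and of the fixed field of `τ` are coprime. -/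
theorem eq_top_of_stable_ideal {F A B : Type*} [Field F] [Field A] [Field B] [Algebra F A]
    [Algebra F B] [FiniteDimensional F A] [FiniteDimensional F B] [Finite F]
    (τ : B ≃ₐ[F] B)
    (hcop : Nat.Coprime (Module.finrank F B / orderOf τ) (Module.finrank F A))
    (J : Ideal (B ⊗[F] A))
    (hJτ : ∀ t ∈ J, Algebra.TensorProduct.map (τ : B →ₐ[F] B) (AlgHom.id F A) t ∈ J)
    {t : B ⊗[F] A} (htJ : t ∈ J) (ht : t ≠ 0) : J = ⊤ := by
  classical
  have : Finite B := Module.finite_of_finite F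
  set g := orderOf τ with hg
  have hg0 : 0 < g := orderOf_pos τ
  let K : IntermediateField F B := IntermediateField.fixedField (Subgroup.zpowers τ)
  have hK : Module.finrank F K = Module.finrank F B / g := by
    have h1 : Module.finrank K B = g := by
      rw [IntermediateField.finrank_fixedField_eq_card, Nat.card_zpowers]
    have h2 := Module.finrank_mul_finrank F K B
    rw [← h2, h1, Nat.mul_div_cancel _ hg0]
  have hdom : IsDomain (K ⊗[F] A) := by
    let Ω := AlgebraicClosure F
    let fa : K →ₐ[F] Ω := IsAlgClosed.lift
    let fb : A →ₐ[F] Ω := IsAlgClosed.lift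
    refine IntermediateField.LinearDisjoint.isDomain' (fa := fa) (fb := fb) ?_
    refine IntermediateField.LinearDisjoint.of_finrank_coprime ?_
    have h1 : Module.finrank F fa.fieldRange = Module.finrank F K :=
      (AlgEquiv.ofInjectiveField fa).toLinearEquiv.finrank_eq.symm
    have h2 : Module.finrank F fb.fieldRange = Module.finrank F A :=
      (AlgEquiv.ofInjectiveField fb).toLinearEquiv.finrank_eq.symm
    rwa [h1, h2, hK]
  have hfin : Finite (K ⊗[F] A) := Module.finite_of_finite F
  let Tr : B → B := fun y => ∑ i ∈ Finset.range g, (τ ^ i) y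
  have hTrK : ∀ y, Tr y ∈ K := by
    intro y
    have h1 : τ (Tr y) = Tr y := by
      have h2 := Finset.sum_range_succ (fun i => (τ ^ i) y) g
      rw [Finset.sum_range_succ', hg, pow_orderOf_eq_one, pow_zero] at h2
      simp only [Tr, map_sum]
      refine Eq.trans (Finset.sum_congr rfl fun i _ => ?_) (add_right_cancel h2)
      rw [pow_succ', AlgEquiv.mul_apply]
    have h3 : Subgroup.zpowers τ ≤ MulAction.stabilizer (B ≃ₐ[F] B) (Tr y) := by
      rw [Subgroup.zpowers_le]; exact h1
    exact fun σ => h3 σ.2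
  obtain ⟨c, hc⟩ : ∃ c, Tr c ≠ 0 := by
    by_contra! h0
    have hinj : Function.Injective (fun i : Fin g => ((τ ^ (i : ℕ) : B ≃ₐ[F] B) : B →* B)) := by
      intro i j hij
      have h1 : τ ^ (i : ℕ) = τ ^ (j : ℕ) := AlgEquiv.ext fun y => DFunLike.congr_fun hij y
      exact Fin.ext (pow_injOn_Iio_orderOf i.2 j.2 h1)
    have hli := (linearIndependent_monoidHom B B).comp _ hinj
    rw [Fintype.linearIndependent_iff] at hli
    refine one_ne_zero (hli (fun _ => (1 : B)) ?_ ⟨0, hg0⟩)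
    ext y
    have := h0 y
    simp only [Tr, ← Fin.sum_univ_eq_sum_range (fun i => (τ ^ i) y)] at this
    simpa [Finset.sum_apply] using this
  let e := Module.finBasis F A
  let E := Algebra.TensorProduct.basis B e
  obtain ⟨j0, hj0⟩ : ∃ j, E.repr t j ≠ 0 := by
    by_contra! h0
    exact ht (E.ext_elem fun j => by simp [h0])
  let b : B := (E.repr t j0)⁻¹ * c
  have hE : ∀ j, E j = 1 ⊗ₜ e j := fun j => by simp [E]
  have hsum : t = ∑ j, E.repr t j ⊗ₜ[F] e j := by
    conv_lhs => rw [← E.sum_repr t]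
    refine Finset.sum_congr rfl fun j _ => ?_
    rw [hE, TensorProduct.smul_tmul', smul_eq_mul, mul_one]
  let s := Algebra.TensorProduct.map (τ : B →ₐ[F] B) (AlgHom.id F A)
  have hs : ∀ (i : ℕ) (x : B ⊗[F] A), x ∈ J → (s ^ i) x ∈ J := by
    intro i x hx
    induction i with
    | zero => simpa using hx
    | succ i ih => rw [pow_succ']; exact hJτ _ ih
  have hst : ∀ (i : ℕ) (y : B) (a : A), (s ^ i) (y ⊗ₜ a) = (τ ^ i) y ⊗ₜ a := by
    intro i y a
    induction i with
    | zero => simp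
    | succ i ih => rw [pow_succ', AlgHom.mul_apply, ih, pow_succ']; simp [s]
  let u : K ⊗[F] A := ∑ j, (⟨Tr (E.repr t j * b), hTrK _⟩ : K) ⊗ₜ e j
  let φ : K ⊗[F] A →ₐ[F] B ⊗[F] A := Algebra.TensorProduct.map K.val (AlgHom.id F A)
  have hφu : φ u = ∑ j, Tr (E.repr t j * b) ⊗ₜ e j := by simp [φ, u]
  have hφJ : φ u ∈ J := by
    have h1 : φ u = ∑ i ∈ Finset.range g, (s ^ i) (t * (b ⊗ₜ 1)) := by
      rw [hφu]
      conv_rhs => rw [hsum]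
      simp only [Finset.sum_mul, Algebra.TensorProduct.tmul_mul_tmul, mul_one, map_sum, hst, Tr,
        TensorProduct.sum_tmul]
      exact Finset.sum_comm
    rw [h1]
    exact sum_mem fun i _ => hs i _ (J.mul_mem_right _ htJ)
  have hu0 : u ≠ 0 := by
    intro h0
    have h1 := congrArg (fun x => E.repr x j0) hφu
    have h2 : ∑ j, Tr (E.repr t j * b) ⊗ₜ[F] e j = ∑ j, Tr (E.repr t j * b) • E j := by
      refine Finset.sum_congr rfl fun j _ => ?_
      rw [hE, TensorProduct.smul_tmul', smul_eq_mul, mul_one]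
    simp only [h0, map_zero, h2, E.repr_sum_self] at h1
    simp only [b, ← mul_assoc, mul_inv_cancel₀ hj0, one_mul] at h1
    exact hc h1.symm
  have hu : IsUnit u := by
    obtain ⟨w, hw⟩ := (Finite.isField_of_domain (K ⊗[F] A)).mul_inv_cancel hu0
    exact IsUnit.of_mul_eq_one w hw
  exact J.eq_top_of_isUnit_mem hφJ (hu.map φ.toRingHom)

open TensorProduct in
/-- A criterion for a crossed-product-like ring over a finite field to be finite and simple. -/
theorem isSimpleRing_of_generators {F A B R : Type*} [Field F] [Field A] [Field B] [Algebra F A]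
    [Algebra F B] [FiniteDimensional F A] [FiniteDimensional F B] [Finite F] [Ring R] [Nontrivial R]
    [Algebra F R] (α : A →ₐ[F] R) (β : B →ₐ[F] R) (hαβ : ∀ x y, Commute (β y) (α x)) (z : Rˣ)
    (hzα : ∀ x, Commute (z : R) (α x)) (τ : B ≃ₐ[F] B) (hzβ : ∀ y, z * β y = β (τ y) * z) (ε : A)
    (hz : (z : R) ^ orderOf τ = α ε)
    (hgen : AddSubgroup.closure {w : R | ∃ x y, ∃ i : ℤ, w = α x * β y * (z ^ i : Rˣ)} = ⊤)
    (hcop : Nat.Coprime (Module.finrank F B / orderOf τ) (Module.finrank F A)) :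
    Finite R ∧ IsSimpleRing R := by
  classical
  have : Finite B := Module.finite_of_finite F
  have : Finite A := Module.finite_of_finite F
  set g := orderOf τ with hg
  have hg0 : 0 < g := orderOf_pos τ
  let θ : B ⊗[F] A →ₐ[F] R := Algebra.TensorProduct.lift β α fun y x => hαβ x y
  have hθ : ∀ y x, θ (y ⊗ₜ x) = β y * α x := fun y x => by simp [θ]
  have hfinT : Finite (B ⊗[F] A) := Module.finite_of_finite F
  have hziβ : ∀ (i : ℕ) y, (z : R) ^ i * β y = β ((τ ^ i) y) * (z : R) ^ i := by
    intro i y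
    induction i with
    | zero => simp
    | succ i ih => rw [pow_succ', mul_assoc, ih, ← mul_assoc, hzβ, mul_assoc, pow_succ',
        AlgEquiv.mul_apply]
  have hziα : ∀ (i : ℕ) x, Commute ((z : R) ^ i) (α x) := fun i x => (hzα x).pow_left i
  have hε : ε ≠ 0 := by
    rintro rfl
    rw [map_zero] at hz
    exact (z ^ g).ne_zero (by simpa using hz)
  let Φ : (Fin g → B ⊗[F] A) →+ R :=
    { toFun := fun t => ∑ i, θ (t i) * (z : R) ^ (i : ℕ)
      map_zero' := by simp
      map_add' := fun s t => by simp [add_mul, Finset.sum_add_distrib] }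
  have hΦ : Function.Surjective Φ := by
    rw [← AddMonoidHom.range_eq_top, eq_top_iff, ← hgen, AddSubgroup.closure_le]
    rintro w ⟨x, y, i, rfl⟩
    obtain ⟨m, hm⟩ : ∃ m : ℤ, m = i / g := ⟨_, rfl⟩
    obtain ⟨j, hj⟩ :=
      Int.eq_ofNat_of_zero_le (Int.emod_nonneg i (by exact_mod_cast hg0.ne' : (g : ℤ) ≠ 0))
    have hjg : j < g := by
      have := Int.emod_lt_of_pos i (by exact_mod_cast hg0 : (0 : ℤ) < g)
      omega
    have hzg : ((z ^ i : Rˣ) : R) = α (ε ^ m) * (z : R) ^ j := by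
      let εu : Rˣ := Units.map (α : A →* R) (Units.mk0 ε hε)
      have h1 : z ^ g = εu := Units.ext (by simpa [εu] using hz)
      have h2 : z ^ i = εu ^ m * z ^ j := by
        rw [← h1, ← zpow_natCast, ← zpow_mul, ← zpow_natCast, ← zpow_add]
        congr 1
        rw [hm, ← hj]
        exact (Int.mul_ediv_add_emod i g).symm
      rw [h2]
      simp [εu, ← map_zpow]
    refine ⟨fun l => if l = ⟨j, hjg⟩ then y ⊗ₜ (x * ε ^ m) else 0, ?_⟩
    change ∑ l : Fin g, _ * _ = _
    rw [Finset.sum_eq_single ⟨j, hjg⟩ (fun l _ hl => by simp [hl]) (by simp)]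
    simp only [if_true]
    rw [hθ, hzg, map_mul, ← mul_assoc, ← mul_assoc, (hαβ x y).eq]
  refine ⟨Finite.of_surjective Φ hΦ, ?_⟩
  rw [isSimpleRing_iff_isTwoSided_imp]
  refine ⟨inferInstance, fun I hI => ?_⟩
  rw [or_iff_not_imp_left]
  intro hI0
  have key : ∀ (s : Finset ℕ), s ⊆ Finset.range g → ∀ t : ℕ → B ⊗[F] A,
      ∑ i ∈ s, θ (t i) * (z : R) ^ i ∈ I → ∀ i ∈ s, θ (t i) ∈ I := by
    intro s
    induction s using Finset.induction_on with
    | empty => simp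
    | insert i0 s hi0 ih =>
      intro hs t ht
      have hs' : s ⊆ Finset.range g := (Finset.subset_insert _ _).trans hs
      have h1 : ∀ i ∈ s, θ (t i) ∈ I := by
        intro i hi
        obtain ⟨y, hy⟩ : ∃ y, (τ ^ i) y ≠ (τ ^ i0) y := by
          by_contra! h
          have := pow_injOn_Iio_orderOf (Finset.mem_range.1 (hs' hi))
            (Finset.mem_range.1 (hs (Finset.mem_insert_self _ _))) (AlgEquiv.ext h)
          exact hi0 (this ▸ hi)
        have h2 := ih hs' (fun i => t i * ((τ ^ i) y - (τ ^ i0) y) ⊗ₜ 1) ?_ i hi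
        · have h3 := I.mul_mem_right (β ((τ ^ i) y - (τ ^ i0) y)⁻¹) h2
          rw [map_mul, hθ, map_one, mul_one, mul_assoc, ← map_mul,
            mul_inv_cancel₀ (sub_ne_zero.2 hy), map_one, mul_one] at h3
          exact h3
        · have h4 : ∀ x w, θ x * β w = θ (x * w ⊗ₜ 1) := fun x w => by
            rw [map_mul, hθ, map_one, mul_one]
          have h5 : ∀ x w, β w * θ x = θ (x * w ⊗ₜ 1) := fun x w => by
            rw [mul_comm, map_mul, hθ, map_one, mul_one]
          have h6 := sub_mem (I.mul_mem_right (β y) ht) (I.mul_mem_left (β ((τ ^ i0) y)) ht)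
          rw [Finset.sum_mul, Finset.mul_sum, ← Finset.sum_sub_distrib,
            Finset.sum_insert hi0] at h6
          have h7 : ∀ i, θ (t i) * (z : R) ^ i * β y - β ((τ ^ i0) y) * (θ (t i) * (z : R) ^ i) =
              θ (t i * ((τ ^ i) y - (τ ^ i0) y) ⊗ₜ 1) * (z : R) ^ i := by
            intro i
            rw [mul_assoc, hziβ, ← mul_assoc, ← mul_assoc, h4, h5, ← sub_mul, ← map_sub,
              ← mul_sub, TensorProduct.sub_tmul]
          simp only [h7] at h6
          simpa using h6
      intro i hi
      obtain rfl | hi := Finset.mem_insert.1 hi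
      · rw [Finset.sum_insert hi0] at ht
        have h2 := (add_mem_cancel_right (sum_mem fun j hj => I.mul_mem_right _ (h1 j hj))).1 ht
        have h3 := I.mul_mem_right ((z⁻¹ ^ i : Rˣ) : R) h2
        rw [mul_assoc, ← Units.val_pow_eq_pow_val, ← Units.val_mul, inv_pow, mul_inv_cancel,
          Units.val_one, mul_one] at h3
        exact h3
      · exact h1 i hi
  obtain ⟨w, hwI, hw0⟩ := Submodule.exists_mem_ne_zero_of_ne_bot hI0
  obtain ⟨t, rfl⟩ := hΦ w
  obtain ⟨i0, hi0⟩ : ∃ i, θ (t i) ≠ 0 := by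
    by_contra! h0
    exact hw0 (by simp [Φ, h0])
  have hmem : θ (t i0) ∈ I := by
    have h1 := key (Finset.range g) subset_rfl (fun i => if h : i < g then t ⟨i, h⟩ else 0) (by
      rw [← Fin.sum_univ_eq_sum_range (n := g)
        (fun i => θ (if h : i < g then t ⟨i, h⟩ else 0) * (z : R) ^ i)]
      simpa [Φ] using hwI) i0 (by simp)
    simpa using h1
  have htop := eq_top_of_stable_ideal τ hcop (I.comap θ) (fun x hx => by
    have h1 : θ (Algebra.TensorProduct.map (τ : B →ₐ[F] B) (AlgHom.id F A) x) =
        z * θ x * (z⁻¹ : Rˣ) := by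
      clear hx
      induction x with
      | zero => simp
      | add x y hx' hy' => rw [map_add, map_add, map_add, hx', hy', mul_add, add_mul]
      | tmul y x =>
        rw [Algebra.TensorProduct.map_tmul, hθ, hθ, ← mul_assoc, hzβ, mul_assoc, mul_assoc,
          ← mul_assoc, ← mul_assoc, mul_assoc (β _), (hzα x).eq, mul_assoc, mul_assoc, 
          Units.mul_inv, mul_one]
        rfl
    rw [Ideal.mem_comap, h1]
    exact I.mul_mem_right _ (I.mul_mem_left _ hx)) (t := t i0) hmem
    (fun h => hi0 (by rw [h, map_zero]))
  rw [Ideal.eq_top_iff_one] at htop ⊢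
  simpa using htop

/-- Over a finite simple ring there is only one simple module. -/
theorem IsSimpleRing.exists_simple (R : Type*) [Ring R] [IsSimpleRing R] [Finite R] :
    ∃ S : Submodule R R, IsSimpleModule R S ∧ ∀ (M : Type*) [AddCommGroup M] [Module R M]
      [Finite M], ∃ a : ℕ, Nonempty (M ≃ₗ[R] Fin a → S) := by
  obtain ⟨n, -, S, hS, -⟩ := (IsSimpleRing.isIsotypic R R).linearEquiv_fun
  refine ⟨S, hS, fun M _ _ _ => ?_⟩
  let e : S ≃ₗ[R] S.map (LinearMap.inl R R M) :=
    S.equivMapOfInjective _ LinearMap.inl_injective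
  have : IsSimpleModule R (S.map (LinearMap.inl R R M)) := IsSimpleModule.congr e.symm
  have h1 : IsIsotypicOfType R (R × M) (S.map (LinearMap.inl R R M)) :=
    IsSimpleRing.isIsotypic R (R × M) _
  exact ((h1.of_linearEquiv_type e.symm).of_injective (LinearMap.inr R R M)
    LinearMap.inr_injective).linearEquiv_fun

/-- Over a finite simple ring, finite modules of equal cardinality are isomorphic. -/
theorem IsSimpleRing.nonempty_linearEquiv_of_card_eq.{u, w} {R : Type u} {M N : Type w} [Ring R]
    [IsSimpleRing R] [Finite R] [AddCommGroup M] [Module R M] [AddCommGroup N] [Module R N]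
    [Finite M] [Finite N] (h : Nat.card M = Nat.card N) : Nonempty (M ≃ₗ[R] N) := by
  obtain ⟨S, hS, hM⟩ := IsSimpleRing.exists_simple.{u, w} R
  obtain ⟨a, ⟨eM⟩⟩ := hM M
  obtain ⟨b, ⟨eN⟩⟩ := hM N
  have : Nontrivial S := IsSimpleModule.nontrivial R S
  have hab : a = b := by
    rw [Nat.card_congr eM.toEquiv, Nat.card_congr eN.toEquiv, Nat.card_fun, Nat.card_fun,
      Nat.card_fin, Nat.card_fin] at h
    exact Nat.pow_right_injective Finite.one_lt_card h
  subst hab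
  exact ⟨eM.trans eN.symm⟩

/-- Over a finite simple ring, some positive power of every finite module is free. -/
theorem IsSimpleRing.exists_free_pi.{u} (R : Type u) [Ring R] [IsSimpleRing R] [Finite R] :
    ∃ n : ℕ, 0 < n ∧ ∀ (M : Type u) [AddCommGroup M] [Module R M] [Finite M],
      Module.Free R (Fin n → M) := by
  obtain ⟨S, hS, hM⟩ := IsSimpleRing.exists_simple.{u, u} R
  obtain ⟨n, ⟨eR⟩⟩ := hM R
  refine ⟨n, Nat.pos_of_ne_zero ?_, fun M _ _ _ => ?_⟩
  · rintro rfl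
    exact not_subsingleton R eR.subsingleton
  obtain ⟨a, ⟨eM⟩⟩ := hM M
  let e₁ : (Fin n → M) ≃ₗ[R] (Fin n → Fin a → S) := LinearEquiv.piCongrRight fun _ => eM
  let e₂ : (Fin n → Fin a → S) ≃ₗ[R] (Fin a → Fin n → S) :=
    { Equiv.piComm _ with
      map_add' := fun _ _ => rfl
      map_smul' := fun _ _ => rfl }
  let e₃ : (Fin a → Fin n → S) ≃ₗ[R] (Fin a → R) := LinearEquiv.piCongrRight fun _ => eR.symm
  exact Module.Free.of_equiv (e₁.trans (e₂.trans e₃)).symm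

/-- A subset of the line which is unbounded in both directions and locally finite is order
isomorphic to the integers. -/
theorem exists_orderIso_int (T : Set ℝ) (h0 : T.Nonempty) (hmax : ∀ t ∈ T, ∃ s ∈ T, t < s)
    (hmin : ∀ t ∈ T, ∃ s ∈ T, s < t) (hfin : ∀ a b, (T ∩ Set.Icc a b).Finite) :
    Nonempty (T ≃o ℤ) := by
  classical
  have : Nonempty T := h0.to_subtype
  have : NoMaxOrder T := ⟨fun t => by
    obtain ⟨s, hs, hts⟩ := hmax t t.2
    exact ⟨⟨s, hs⟩, hts⟩⟩
  have : NoMinOrder T := ⟨fun t => by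
    obtain ⟨s, hs, hts⟩ := hmin t t.2
    exact ⟨⟨s, hs⟩, hts⟩⟩
  have hf : ∀ a b : T, (Set.Icc a b).Finite := fun a b => by
    refine Set.Finite.of_finite_image ((hfin a b).subset ?_) Subtype.val_injective.injOn
    rintro _ ⟨x, hx, rfl⟩
    exact ⟨x.2, hx⟩
  let : LocallyFiniteOrder T := LocallyFiniteOrder.ofFiniteIcc hf
  let : SuccOrder T := LinearLocallyFiniteOrder.succOrder T
  let : PredOrder T := LinearLocallyFiniteOrder.predOrder T
  exact ⟨orderIsoIntOfLinearSuccPredArch⟩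

section Filtration

variable {V : Type*} [AddCommGroup V]

theorem AddSubgroup.finite_setOf_between {A B : AddSubgroup V} (h : A.relIndex B ≠ 0) :
    {H : AddSubgroup V | A ≤ H ∧ H ≤ B}.Finite := by
  have : Finite (B ⧸ A.addSubgroupOf B) := by
    by_contra hinf
    rw [not_finite_iff_infinite] at hinf
    exact h (AddSubgroup.index_eq_zero_iff_infinite.2 hinf)
  let F : AddSubgroup V → AddSubgroup (B ⧸ A.addSubgroupOf B) := fun H =>
    (H.addSubgroupOf B).map (QuotientAddGroup.mk' _)
  refine Set.Finite.of_finite_image (f := F) (Set.toFinite _) ?_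
  have key : ∀ H H' : AddSubgroup V, A ≤ H' → H ≤ B → F H = F H' → H ≤ H' := by
    intro H H' hA hB hF x hx
    have h1 : (QuotientAddGroup.mk' (A.addSubgroupOf B)) ⟨x, hB hx⟩ ∈ F H' := by
      rw [← hF]
      exact ⟨⟨x, hB hx⟩, hx, rfl⟩
    obtain ⟨y, hy, hxy⟩ := h1
    have h2 : -(y : V) + x ∈ A :=
      (QuotientAddGroup.eq (s := A.addSubgroupOf B) (a := y) (b := ⟨x, hB hx⟩)).1 hxy
    have h3 := add_mem (show (y : V) ∈ H' from hy) (hA h2)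
    simpa using h3
  rintro H ⟨h1, h2⟩ H' ⟨h3, h4⟩ hF
  exact le_antisymm (key _ _ h3 h2 hF) (key _ _ h1 h4 hF.symm)

/-- A left continuous decreasing filtration with finite quotients can be indexed by `ℤ`. -/
theorem exists_int_indexing (Λ : ℝ → AddSubgroup V) (δ : ℝ) (hδ : 0 < δ) (hanti : Antitone Λ)
    (hleft : ∀ t x, x ∈ Λ t ↔ ∀ r, r < t → x ∈ Λ r)
    (hind : ∀ t, (Λ (t + δ)).relIndex (Λ t) ≠ 0) (hne : ∀ t, Λ (t + δ) ≠ Λ t) :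
    ∃ L : ℤ → AddSubgroup V, StrictAnti L ∧ Set.range L = Set.range Λ := by
  have hindn : ∀ (n : ℕ) t, (Λ (t + n * δ)).relIndex (Λ t) ≠ 0 := by
    intro n t
    induction n with
    | zero => simp
    | succ n ih =>
      refine AddSubgroup.relIndex_ne_zero_trans ?_ ih
      have := hind (t + n * δ)
      rw [add_assoc] at this
      push_cast
      rwa [add_mul, one_mul]
  let T : Set ℝ := {t | ∀ s, t < s → Λ s ≠ Λ t}
  have hinj : Set.InjOn Λ T := by
    intro s hs t ht hst
    rcases lt_trichotomy s t with h | h | h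
    · exact absurd hst.symm (hs t h)
    · exact h
    · exact absurd hst (ht s h)
  have hjump : ∀ t, ∃ s ∈ T, t ≤ s ∧ Λ s = Λ t := by
    intro t
    let S : Set ℝ := {s | Λ s = Λ t}
    have hS : S.Nonempty := ⟨t, rfl⟩
    have hlt : ∀ s, t + δ ≤ s → Λ s ≠ Λ t := fun s hs h =>
      hne t (le_antisymm (hanti (by linarith)) (h ▸ hanti hs))
    have hbdd : BddAbove S := ⟨t + δ, fun s hs => le_of_not_ge fun h => hlt s h hs⟩
    have hle : t ≤ sSup S := le_csSup hbdd rfl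
    have hmem : Λ (sSup S) = Λ t := by
      refine le_antisymm (hanti hle) fun x hx => ?_
      rw [hleft]
      intro r hr
      obtain ⟨s, hs, hrs⟩ := exists_lt_of_lt_csSup hS hr
      have hs' : Λ s = Λ t := hs
      exact hanti hrs.le (hs' ▸ hx)
    exact ⟨sSup S, fun s hs h => hs.not_ge (le_csSup hbdd (h.trans hmem)), hle, hmem⟩
  obtain ⟨e⟩ := exists_orderIso_int T
    (by obtain ⟨s, hs, -⟩ := hjump 0; exact ⟨s, hs⟩)
    (fun t _ => by
      obtain ⟨s, hs, h1, -⟩ := hjump (t + δ)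
      exact ⟨s, hs, by linarith⟩)
    (fun t ht => by
      obtain ⟨s, hs, h1, h2⟩ := hjump (t - δ)
      refine ⟨s, hs, lt_of_not_ge fun h => hne (t - δ) ?_⟩
      rw [sub_add_cancel]
      exact le_antisymm (hanti (by linarith)) (h2 ▸ hanti h))
    (fun a b => by
      obtain ⟨n, hn⟩ := exists_nat_gt ((b - a) / δ)
      rw [div_lt_iff₀ hδ] at hn
      refine Set.Finite.of_finite_image (f := Λ)
        ((AddSubgroup.finite_setOf_between (hindn n a)).subset ?_)
        (hinj.mono Set.inter_subset_left)
      rintro _ ⟨t, ⟨-, h1, h2⟩, rfl⟩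
      exact ⟨hanti (by linarith), hanti h1⟩)
  refine ⟨fun i => Λ (e.symm i), fun i j hij => ?_, ?_⟩
  · have h1 : (e.symm i : ℝ) < e.symm j := e.symm.lt_iff_lt.2 hij
    exact lt_of_le_of_ne (hanti h1.le) ((e.symm i).2 _ h1)
  · apply Set.Subset.antisymm
    · rintro _ ⟨i, rfl⟩
      exact ⟨_, rfl⟩
    · rintro _ ⟨t, rfl⟩
      obtain ⟨s, hs, -, h2⟩ := hjump t
      exact ⟨e ⟨s, hs⟩, by simpa using h2⟩

theorem eq_add_of_strictMono_surjective {f : ℤ → ℤ} (hf : StrictMono f)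
    (hs : Function.Surjective f) (i : ℤ) : f i = i + f 0 := by
  have hstep : ∀ i, f (i + 1) = f i + 1 := by
    intro i
    refine le_antisymm ?_ (Int.add_one_le_iff.2 (hf (by omega)))
    by_contra! h
    obtain ⟨j, hj⟩ := hs (f i + 1)
    rw [← hj, hf.lt_iff_lt] at h
    have h2 : f i < f j := by omega
    rw [hf.lt_iff_lt] at h2
    omega
  induction i with
  | zero => simp
  | succ i ih => rw [hstep, ih]; ring
  | pred i ih =>
    have := hstep (-i - 1)
    rw [sub_add_cancel, ih] at this
    omega

/-- A map carrying one chain of subgroups onto another is a shift. -/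
theorem exists_shift {L L' : ℤ → AddSubgroup V} (hL : StrictAnti L) (hL' : StrictAnti L')
    (h : V ≃+ V) (h1 : ∀ i, ∃ j, (L i).map (h : V →+ V) = L' j)
    (h2 : ∀ j, ∃ i, (L i).map (h : V →+ V) = L' j) :
    ∃ c : ℤ, ∀ i, (L i).map (h : V →+ V) = L' (i + c) := by
  choose f hf using h1
  have hmono : StrictMono f := by
    intro i j hij
    rw [← hL'.lt_iff_gt, ← hf, ← hf, AddSubgroup.map_lt_map_iff_of_injective h.injective]
    exact hL hij
  have hsurj : Function.Surjective f := by
    intro j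
    obtain ⟨i, hi⟩ := h2 j
    exact ⟨i, hL'.injective (by rw [← hf, hi])⟩
  exact ⟨f 0, fun i => by rw [hf, eq_add_of_strictMono_surjective hmono hsurj]⟩

end Filtration

/-- A lattice chain of period `r` in a vector space over a discretely valued skew field. -/
structure IsDChain {D V : Type*} [DivisionRing D] [AddCommGroup V] [Module D V] {v : D → ℤ}
    (hv : IsDiscVal v) (r : ℤ) (L : ℤ → AddSubgroup V) : Prop where
  anti : StrictAnti L
  pos : 0 < r
  smul_mem : ∀ (y : D) (i : ℤ) (u : V), y ≠ 0 → u ∈ L i → y • u ∈ L (i + r * v y)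
  exhaust : ∀ u : V, ∃ i, u ∈ L i
  bdd : ∀ χ : V →ₗ[D] D, ∃ B : ℤ, ∀ u ∈ L 0, χ u ∈ hv.ball B
  relIndex_ne_zero : ∀ i, (L (i + 1)).relIndex (L i) ≠ 0

section

variable {D V : Type*} [DivisionRing D] [AddCommGroup V] [Module D V] {v : D → ℤ}
  {hv : IsDiscVal v}

theorem relIndex_ne_zero_of_generators {κ : Type*} [Field κ] [Finite κ] {ρ : hv.integers →+* κ}
    (hρ : hv.IsResidueMap ρ) (M N : AddSubgroup V) (s : Finset V)
    (hM : ∀ m ∈ M, ∃ c : V → D, (∀ u, c u ∈ hv.ball 0) ∧ m = ∑ u ∈ s, c u • u)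
    (hN : ∀ y ∈ hv.ball 1, ∀ u ∈ s, y • u ∈ N) : N.relIndex M ≠ 0 := by
  choose! c hc hcm using hM
  let G : (M ⧸ N.addSubgroupOf M) → (s → κ) := fun Q u => ρ ⟨c Q.out u, hc _ Q.out.2 _⟩
  have hG : Function.Injective G := by
    intro Q Q' hQ
    rw [← Q.out_eq, ← Q'.out_eq]
    refine QuotientAddGroup.eq.2 ?_
    rw [AddSubgroup.mem_addSubgroupOf]
    rw [AddSubgroup.coe_add, AddSubgroup.coe_neg, hcm _ Q.out.2, hcm _ Q'.out.2, neg_add_eq_sub,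
      ← Finset.sum_sub_distrib]
    refine sum_mem fun u hu => ?_
    rw [← sub_smul]
    exact hN _ (hρ.eq_iff.1 (congrFun hQ.symm ⟨u, hu⟩)) u hu
  have : Finite (M ⧸ N.addSubgroupOf M) := Finite.of_injective G hG
  exact AddSubgroup.index_ne_zero_of_finite

/-- If multiplication by a uniformizer shifts an integrally stable filtration by `c`, then
multiplication by `y` shifts it by `v y • c`. -/
theorem smul_mem_of_shift {G : Type*} [AddCommGroup G] (hv : IsDiscVal v) {π : D} (hπ : π ≠ 0)
    (vπ : v π = 1) (F : G → AddSubgroup V) (c : G)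
    (hF : ∀ t w, w ∈ F (t + c) ↔ ∃ u ∈ F t, w = π • u)
    (hinteg : ∀ t, ∀ u ∈ F t, ∀ y ∈ hv.ball 0, y • u ∈ F t) {y : D} {t : G} {u : V}
    (hu : u ∈ F t) : y • u ∈ F (t + v y • c) := by
  have hzpow : ∀ (n : ℤ) (u : V), u ∈ F t → π ^ n • u ∈ F (t + n • c) := by
    intro n
    induction n with
    | zero => intro u hu; simpa using hu
    | succ n ih =>
      intro u hu
      rw [add_smul, one_smul, ← add_assoc, hF]
      exact ⟨_, ih u hu, by rw [smul_smul, ← zpow_one_add₀ hπ, add_comm]⟩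
    | pred n ih =>
      intro u hu
      have h1 := ih u hu
      rw [← sub_add_cancel (-(n : ℤ)) 1, add_smul, one_smul, ← add_assoc, hF] at h1
      obtain ⟨w, hw, hw'⟩ := h1
      rw [add_comm, zpow_one_add₀ hπ, mul_smul] at hw'
      rwa [smul_right_injective V hπ hw']
  have h1 := hzpow (v y) _ (hinteg t u hu (π ^ (-v y) * y) ?_)
  · rwa [smul_smul, ← mul_assoc, ← zpow_add₀ hπ, add_neg_cancel, zpow_zero, one_mul] at h1
  · have := hv.mul_mem_ball (hv.mem_ball_self (π ^ (-v y))) (hv.mem_ball_self y)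
    rwa [hv.map_zpow hπ, vπ, mul_one, neg_add_cancel] at this

end

section LatticeFunction

open MulOpposite

variable {D V : Type*} [DivisionRing D] [AddCommGroup V] [Module Dᵐᵒᵖ V]

theorem IsLocalValuation.op {ν : D → EReal} {e q : ℕ} (h : IsLocalValuation D ν e q) :
    IsLocalValuation Dᵐᵒᵖ (fun y => ν y.unop) e q where
  e_pos := h.e_pos
  one_lt_q := h.one_lt_q
  eq_top_iff x := by rw [h.eq_top_iff, unop_eq_zero_iff]
  map_mul x y := by rw [unop_mul, h.map_mul, add_comm]
  min_le_add x y := h.min_le_add _ _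
  values x hx := h.values _ ((unop_ne_zero_iff x).2 hx)
  exists_uniformizer := by
    obtain ⟨π, hπ⟩ := h.exists_uniformizer
    exact ⟨MulOpposite.op π, hπ⟩
  complete x hx := by
    obtain ⟨l, hl⟩ := h.complete (fun n => (x n).unop) hx
    exact ⟨MulOpposite.op l, hl⟩
  residue := by
    obtain ⟨s, hs, hs0, hs1⟩ := h.residue
    refine ⟨s.map opEquiv.toEmbedding, by simpa using hs, ?_, ?_⟩
    · intro y hy
      obtain ⟨x, hx, rfl⟩ := Finset.mem_map.1 hy
      exact hs0 x hx
    · intro x hx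
      obtain ⟨y, ⟨hy, hxy⟩, huniq⟩ := hs1 x.unop hx
      refine ⟨MulOpposite.op y, ⟨Finset.mem_map.2 ⟨y, hy, rfl⟩, hxy⟩, ?_⟩
      rintro z ⟨hz, hxz⟩
      obtain ⟨w, hw, rfl⟩ := Finset.mem_map.1 hz
      exact congrArg MulOpposite.op (huniq w ⟨hw, hxz⟩)

theorem IsODLattice.exists_generators {ν : D → EReal} {e q : ℕ} (h : IsLocalValuation D ν e q)
    {M : AddSubgroup V} (hM : IsODLattice ν M) :
    ∃ s : Finset V, (s : Set V) ⊆ M ∧ ∀ m ∈ M, ∃ c : V → Dᵐᵒᵖ,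
      (∀ u, c u ∈ h.op.isDiscVal.ball 0) ∧ m = ∑ u ∈ s, c u • u := by
  classical
  obtain ⟨-, ⟨s, hs, hgen⟩, -⟩ := hM
  suffices key : ∀ m ∈ AddSubgroup.closure
      {w : V | ∃ u ∈ s, ∃ y : D, 0 ≤ ν y ∧ w = MulOpposite.op y • u}, ∃ c : V → Dᵐᵒᵖ,
      (∀ u, c u ∈ h.op.isDiscVal.ball 0) ∧ m = ∑ u ∈ s, c u • u from
    ⟨s, hs, fun m hm => key m (hgen m hm)⟩
  intro m hm
  induction hm using AddSubgroup.closure_induction with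
  | mem w hw =>
    obtain ⟨u, hu, y, hy, rfl⟩ := hw
    refine ⟨Pi.single u (MulOpposite.op y), fun u' => ?_, ?_⟩
    · by_cases huu : u' = u
      · subst huu
        rw [Pi.single_eq_same]
        exact h.op.nonneg_iff.1 hy
      · rw [Pi.single_eq_of_ne huu]; exact zero_mem _
    · rw [Finset.sum_eq_single u (fun u' _ huu => by rw [Pi.single_eq_of_ne huu, zero_smul])
        (fun h => absurd hu h), Pi.single_eq_same]
  | zero => exact ⟨0, fun _ => zero_mem _, by simp⟩
  | add x y _ _ hx hy =>
    obtain ⟨c, hc, rfl⟩ := hx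
    obtain ⟨c', hc', rfl⟩ := hy
    exact ⟨c + c', fun u => add_mem (hc u) (hc' u), by
      simp [add_smul, Finset.sum_add_distrib]⟩
  | neg x _ hx =>
    obtain ⟨c, hc, rfl⟩ := hx
    exact ⟨-c, fun u => neg_mem (hc u), by simp⟩

/-- Every lattice function is enumerated by a lattice chain. -/
theorem IsLatticeFunction.exists_chain [Nontrivial V] {ν : D → EReal} {d q : ℕ}
    (h : IsLocalValuation D ν d q) {Λ : ℝ → AddSubgroup V} (hΛ : IsLatticeFunction ν d Λ) :
    ∃ (L : ℤ → AddSubgroup V) (r : ℤ), IsDChain h.op.isDiscVal r L ∧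
      Set.range L = Set.range Λ := by
  obtain ⟨hlat, hanti, hleft, hshift⟩ := hΛ
  have hanti' : Antitone Λ := hanti
  obtain ⟨π, hπ0, vπ⟩ := h.op.exists_intVal_eq_one
  have hπν := (h.op.intVal_eq_iff hπ0).1 vπ
  have hd : (0 : ℝ) < (d : ℝ)⁻¹ := inv_pos.2 (by exact_mod_cast h.e_pos)
  have hv := h.op.isDiscVal
  have hπsmul : ∀ t w, w ∈ Λ (t + (d : ℝ)⁻¹) ↔ ∃ u ∈ Λ t, w = π • u := by
    intro t w
    exact hshift π.unop (by simpa using hπν) t w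
  have hinteg : ∀ t, ∀ u ∈ Λ t, ∀ y ∈ hv.ball 0, y • u ∈ Λ t := fun t u hu y hy =>
    (hlat t).1 u hu y.unop (h.op.nonneg_iff.2 hy)
  have hbdd : ∀ t (χ : V →ₗ[Dᵐᵒᵖ] Dᵐᵒᵖ), ∃ B : ℤ, ∀ u ∈ Λ t, χ u ∈ hv.ball B := by
    intro t χ
    obtain ⟨s, hs, hgen⟩ := (hlat t).exists_generators h
    obtain ⟨B, hB⟩ := (s.image fun u => intVal (fun y : Dᵐᵒᵖ => ν y.unop) d (χ u)).bddBelow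
    refine ⟨B, fun u hu => ?_⟩
    obtain ⟨c, hc, rfl⟩ := hgen u hu
    rw [map_sum]
    refine sum_mem fun w hw => ?_
    rw [map_smul, smul_eq_mul, ← zero_add B]
    exact hv.mul_mem_ball (hc w) (Or.inr (hB (Finset.mem_image_of_mem _ hw)))
  have hne : ∀ t, Λ (t + (d : ℝ)⁻¹) ≠ Λ t := by
    intro t heq
    obtain ⟨u, hu, hu0⟩ : ∃ u ∈ Λ t, u ≠ 0 := by
      by_contra! h0
      have h1 : Submodule.span Dᵐᵒᵖ (Λ t : Set V) = ⊥ := Submodule.span_eq_bot.2 h0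
      exact bot_ne_top (h1.symm.trans (hlat t).2.2)
    obtain ⟨χ, hχ⟩ := (LinearMap.toSpanSingleton Dᵐᵒᵖ V u).exists_leftInverse_of_injective
      (LinearMap.ker_toSpanSingleton _ hu0)
    have hχu : χ u = 1 := by simpa using LinearMap.congr_fun hχ 1
    obtain ⟨B, hB⟩ := hbdd t χ
    have hdiv : ∀ n : ℕ, ∃ w ∈ Λ t, u = π ^ n • w := by
      intro n
      induction n with
      | zero => exact ⟨u, hu, by simp⟩
      | succ n ih =>
        obtain ⟨w, hw, rfl⟩ := ih
        obtain ⟨w', hw', rfl⟩ := (hπsmul t w).1 (heq ▸ hw)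
        exact ⟨w', hw', by rw [pow_succ, mul_smul]⟩
    obtain ⟨w, hw, huw⟩ := hdiv (1 - B).toNat
    have h1 := hv.mul_mem_ball (hv.mem_ball_self (π ^ (1 - B).toNat)) (hB w hw)
    rw [← smul_eq_mul, ← map_smul, ← huw, hχu, hv.mem_ball_of_ne one_ne_zero, hv.map_one,
      hv.map_pow hπ0, vπ] at h1
    omega
  have hind : ∀ t, (Λ (t + (d : ℝ)⁻¹)).relIndex (Λ t) ≠ 0 := by
    intro t
    obtain ⟨s, hs, hgen⟩ := (hlat t).exists_generators h
    obtain ⟨κ, _, _, ρ, hρ, hρ0, -⟩ := h.op.exists_residueField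
    refine relIndex_ne_zero_of_generators (ρ := ρ) ⟨hρ, hρ0⟩ _ _ s hgen fun y hy u hu => ?_
    refine (hπsmul t _).2 ⟨(π⁻¹ * y) • u, hinteg t u (hs hu) _ ?_, ?_⟩
    · have := hv.mul_mem_ball (hv.mem_ball_self π⁻¹) hy
      rwa [hv.map_inv hπ0, vπ, neg_add_cancel] at this
    · rw [smul_smul, ← mul_assoc, mul_inv_cancel₀ hπ0, one_mul]
  obtain ⟨L, hL, hLr⟩ := exists_int_indexing Λ _ hd hanti' hleft hind hne
  have hLΛ : ∀ i, ∃ t, Λ t = L i := fun i => hLr.subset ⟨i, rfl⟩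
  have hΛL : ∀ t, ∃ i, L i = Λ t := fun t => hLr.superset ⟨t, rfl⟩
  let hπe : V ≃+ V := DistribMulAction.toAddEquiv₀ V π hπ0
  have hmap : ∀ t, (Λ t).map (hπe : V →+ V) = Λ (t + (d : ℝ)⁻¹) := by
    intro t
    ext w
    rw [hπsmul]
    exact ⟨fun ⟨u, hu, h⟩ => ⟨u, hu, h.symm⟩, fun ⟨u, hu, h⟩ => ⟨u, hu, h.symm⟩⟩
  obtain ⟨r, hr⟩ := exists_shift hL hL hπe
    (fun i => by
      obtain ⟨t, ht⟩ := hLΛ i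
      obtain ⟨j, hj⟩ := hΛL (t + (d : ℝ)⁻¹)
      exact ⟨j, by rw [hj, ← hmap, ht]⟩)
    (fun j => by
      obtain ⟨t, ht⟩ := hLΛ j
      obtain ⟨i, hi⟩ := hΛL (t - (d : ℝ)⁻¹)
      exact ⟨i, by rw [hi, hmap, sub_add_cancel, ht]⟩)
  have hLπ : ∀ i w, w ∈ L (i + r) ↔ ∃ u ∈ L i, w = π • u := by
    intro i w
    rw [← hr]
    exact ⟨fun ⟨u, hu, h⟩ => ⟨u, hu, h.symm⟩, fun ⟨u, hu, h⟩ => ⟨u, hu, h.symm⟩⟩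
  have hLr' : ∀ i t, Λ t = L i → L (i + r) = Λ (t + (d : ℝ)⁻¹) := fun i t ht => by
    rw [← hr, ← ht, hmap]
  have hr0 : 0 < r := by
    obtain ⟨t, ht⟩ := hLΛ 0
    have h1 : L (0 + r) < L 0 := by
      rw [hLr' _ _ ht, ← ht]
      exact lt_of_le_of_ne (hanti' (by linarith)) (hne t)
    have := hL.lt_iff_gt.1 h1
    omega
  refine ⟨L, r, ⟨hL, hr0, ?_, ?_, ?_, ?_⟩, hLr⟩
  · intro y i u _ hu
    have := smul_mem_of_shift (y := y) hv hπ0 vπ L r hLπ (fun i u hu y hy => by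
      obtain ⟨t, ht⟩ := hLΛ i
      rw [← ht] at hu ⊢
      exact hinteg t u hu y hy) hu
    rwa [smul_eq_mul, mul_comm] at this
  · suffices ∀ u, ∃ t, u ∈ Λ t by
      intro u
      obtain ⟨t, ht⟩ := this u
      obtain ⟨i, hi⟩ := hΛL t
      exact ⟨i, hi ▸ ht⟩
    intro u
    have hu : u ∈ Submodule.span Dᵐᵒᵖ (Λ 0 : Set V) := by rw [(hlat 0).2.2]; trivial
    induction hu using Submodule.span_induction with
    | mem u hu => exact ⟨0, hu⟩
    | zero => exact ⟨0, zero_mem _⟩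
    | add x y _ _ hx hy =>
      obtain ⟨a, ha⟩ := hx
      obtain ⟨b, hb⟩ := hy
      exact ⟨min a b, add_mem (hanti' (min_le_left _ _) ha) (hanti' (min_le_right _ _) hb)⟩
    | smul y x _ hx =>
      obtain ⟨a, ha⟩ := hx
      exact ⟨_, smul_mem_of_shift hv hπ0 vπ Λ _ hπsmul hinteg ha⟩
  · intro χ
    obtain ⟨t, ht⟩ := hLΛ 0
    rw [← ht]
    exact hbdd t χ
  · intro i h0
    obtain ⟨t, ht⟩ := hLΛ i
    refine hind t (ht ▸ hLr' i t ht ▸ ?_)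
    exact AddSubgroup.relIndex_eq_zero_of_le_left (hL.antitone (by omega)) h0

end LatticeFunction

namespace IsDChain

variable {D V : Type*} [DivisionRing D] [AddCommGroup V] [Module D V] {v : D → ℤ}
  {hv : IsDiscVal v} {r : ℤ} {L : ℤ → AddSubgroup V}

theorem smul_mem_iff (h : IsDChain hv r L) {y : D} (hy : y ≠ 0) {i : ℤ} {u : V} :
    y • u ∈ L i ↔ u ∈ L (i - r * v y) := by
  constructor
  · intro hu
    have := h.smul_mem y⁻¹ i _ (inv_ne_zero hy) hu
    rwa [smul_smul, inv_mul_cancel₀ hy, one_smul, hv.map_inv hy, mul_neg,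
      ← sub_eq_add_neg] at this
  · intro hu
    simpa using h.smul_mem y _ u hy hu

theorem smul_mem_of_mem_ball (h : IsDChain hv r L) {y : D} {j : ℤ} (hy : y ∈ hv.ball j) {i : ℤ}
    {u : V} (hu : u ∈ L i) : y • u ∈ L (i + r * j) := by
  by_cases hy0 : y = 0
  · rw [hy0, zero_smul]; exact zero_mem _
  · have h1 := (hv.mem_ball_of_ne hy0).1 hy
    exact h.anti.antitone (by have := h.pos; nlinarith) (h.smul_mem y i u hy0 hu)

theorem bounded (h : IsDChain hv r L) (hπ : ∃ π, π ≠ 0 ∧ v π = 1) (χ : V →ₗ[D] D) (i : ℤ) :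
    ∃ B : ℤ, ∀ u ∈ L i, χ u ∈ hv.ball B := by
  obtain ⟨π, hπ, vπ⟩ := hπ
  obtain ⟨B, hB⟩ := h.bdd χ
  refine ⟨B - |i|, fun u hu => ?_⟩
  have h1 := hB (π ^ |i| • u) ((h.smul_mem_iff (zpow_ne_zero _ hπ)).2 ?_)
  · have h2 := hv.mul_mem_ball (hv.mem_ball_self (π ^ (-|i|))) h1
    rwa [map_smul, smul_eq_mul, ← mul_assoc, ← zpow_add₀ hπ, neg_add_cancel, zpow_zero, one_mul,
      hv.map_zpow hπ, vπ, mul_one, neg_add_eq_sub] at h2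
  · rw [hv.map_zpow hπ, vπ, mul_one]
    refine h.anti.antitone ?_ hu
    have := h.pos
    have := neg_abs_le i
    have := abs_nonneg i
    nlinarith

theorem eq_zero_of_forall_mem (h : IsDChain hv r L) (hπ : ∃ π, π ≠ 0 ∧ v π = 1) {u : V}
    (hu : ∀ i, u ∈ L i) : u = 0 := by
  by_contra hu0
  obtain ⟨χ, hχ⟩ := (LinearMap.toSpanSingleton D V u).exists_leftInverse_of_injective
    (LinearMap.ker_toSpanSingleton _ hu0)
  have hχu : χ u = 1 := by simpa using LinearMap.congr_fun hχ 1
  obtain ⟨B, hB⟩ := h.bdd χ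
  obtain ⟨π, hπ, vπ⟩ := hπ
  have h1 := hB (π ^ (B - 1) • u) ((h.smul_mem_iff (zpow_ne_zero _ hπ)).2 (hu _))
  rw [map_smul, hχu, smul_eq_mul, mul_one, hv.mem_ball_of_ne (zpow_ne_zero _ hπ),
    hv.map_zpow hπ, vπ] at h1
  omega

theorem exists_mem_notMem (h : IsDChain hv r L) (hπ : ∃ π, π ≠ 0 ∧ v π = 1) {u : V}
    (hu : u ≠ 0) : ∃ i, u ∈ L i ∧ u ∉ L (i + 1) := by
  obtain ⟨i, hi⟩ := h.exhaust u
  obtain ⟨j, hj⟩ : ∃ j, u ∉ L j := by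
    by_contra! h0
    exact hu (h.eq_zero_of_forall_mem hπ h0)
  obtain ⟨s, hs, hmax⟩ := Int.exists_greatest_of_bdd (P := fun i => u ∈ L i)
    ⟨j, fun z hz => by
      by_contra! hjz
      exact hj (h.anti.antitone hjz.le hz)⟩ ⟨i, hi⟩
  exact ⟨s, hs, fun h1 => by have := hmax _ h1; omega⟩

/-- A functional on a submodule that is bounded by a lattice chain extends to the whole space
with the same bound. -/
theorem exists_functional [FiniteDimensional D V] (h : IsDChain hv r L)
    (hπ : ∃ π, π ≠ 0 ∧ v π = 1) {m : V} {s : ℤ} (hm : m ∉ L (s + 1)) :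
    ∃ φ : V →ₗ[D] D, φ m = 1 ∧ ∀ i, ∀ u ∈ L i, φ u ≠ 0 → i ≤ r * v (φ u) + s := by
  let P : Submodule D V → Prop := fun U => m ∈ U ∧ ∃ φ : V →ₗ[D] D, φ m = 1 ∧
    ∀ i, ∀ u ∈ L i, u ∈ U → φ u ≠ 0 → i ≤ r * v (φ u) + s
  have hm0 : m ≠ 0 := by rintro rfl; exact hm (zero_mem _)
  have hbase : P (Submodule.span D {m}) := by
    refine ⟨Submodule.mem_span_singleton_self m, ?_⟩
    obtain ⟨χ, hχ⟩ := (LinearMap.toSpanSingleton D V m).exists_leftInverse_of_injective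
      (LinearMap.ker_toSpanSingleton _ hm0)
    have hχm : χ m = 1 := by simpa using LinearMap.congr_fun hχ 1
    refine ⟨χ, hχm, fun i u hu huU hφ => ?_⟩
    obtain ⟨y, rfl⟩ := Submodule.mem_span_singleton.1 huU
    rw [map_smul, hχm, smul_eq_mul, mul_one] at hφ ⊢
    rw [h.smul_mem_iff hφ] at hu
    by_contra! h1
    exact hm (h.anti.antitone (by omega) hu)
  obtain ⟨U, hU⟩ := exists_maximal_of_wellFoundedGT P ⟨_, hbase⟩
  obtain ⟨⟨hmU, φ, hφm, hφ⟩, hmax⟩ := hU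
  by_cases hUtop : U = ⊤
  · exact ⟨φ, hφm, fun i u hu => hφ i u hu (hUtop ▸ Submodule.mem_top)⟩
  exfalso
  obtain ⟨w, -, hw⟩ := SetLike.exists_of_lt (lt_top_iff_ne_top.2 hUtop)
  obtain ⟨χ, hχw, hχU⟩ : ∃ χ : V →ₗ[D] D, χ w = 1 ∧ ∀ u ∈ U, χ u = 0 := by
    obtain ⟨χ, hχ, hχU⟩ := Submodule.exists_le_ker_of_notMem (K := D) hw
    refine ⟨χ.smulRight (χ w)⁻¹, by simp [hχ], fun u hu => ?_⟩
    have : χ u = 0 := hχU hu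
    simp [this]
  obtain ⟨π, hπ, vπ⟩ := hπ
  obtain ⟨B, hB⟩ := h.bdd χ
  obtain ⟨i₀, ⟨u₀, hu₀, hwu₀⟩, hi₀⟩ := Int.exists_greatest_of_bdd
    (P := fun i => ∃ u ∈ U, w + u ∈ L i)
    ⟨r * (1 + |B|), fun i => by
      rintro ⟨u, hu, hwu⟩
      by_contra! hi
      have h1 := hB (π ^ (-(1 + |B|)) • (w + u)) ((h.smul_mem_iff (zpow_ne_zero _ hπ)).2
        (h.anti.antitone (by rw [hv.map_zpow hπ, vπ]; linarith) hwu))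
      rw [map_smul, map_add, hχw, hχU u hu, smul_eq_mul, add_zero, mul_one,
        hv.mem_ball_of_ne (zpow_ne_zero _ hπ), hv.map_zpow hπ, vπ] at h1
      have := neg_abs_le B
      omega⟩
    (by obtain ⟨i, hi⟩ := h.exhaust w; exact ⟨i, 0, zero_mem _, by simpa using hi⟩)
  let φ' : V →ₗ[D] D := φ - χ.smulRight (φ (w + u₀))
  have hφ'U : ∀ u ∈ U, φ' u = φ u := fun u hu => by simp [φ', hχU u hu]
  have hφ'w : φ' (w + u₀) = 0 := by simp [φ', hχU u₀ hu₀, hχw]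
  have hP : P (U ⊔ Submodule.span D {w + u₀}) := by
    refine ⟨Submodule.mem_sup_left hmU, φ', by rw [hφ'U m hmU, hφm], fun i u hu huU hφu => ?_⟩
    obtain ⟨u₁, hu₁, x, hx, rfl⟩ := Submodule.mem_sup.1 huU
    obtain ⟨y, rfl⟩ := Submodule.mem_span_singleton.1 hx
    rw [map_add, map_smul, hφ'w, smul_zero, add_zero, hφ'U _ hu₁] at hφu ⊢
    refine hφ i u₁ ?_ hu₁ hφu
    by_cases hy : y = 0
    · simpa [hy] using hu
    suffices y • (w + u₀) ∈ L i by simpa using sub_mem hu this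
    rw [h.smul_mem_iff hy]
    refine h.anti.antitone ?_ hwu₀
    refine hi₀ _ ⟨y⁻¹ • u₁ + u₀, add_mem (U.smul_mem _ hu₁) hu₀, ?_⟩
    rw [← h.smul_mem_iff hy]
    rwa [add_left_comm, smul_add, smul_smul, mul_inv_cancel₀ hy, one_smul]
  have h2 := hmax hP le_sup_left
  refine hw ?_
  have h3 : w + u₀ ∈ U := h2 (Submodule.mem_sup_right (Submodule.mem_span_singleton_self _))
  simpa using sub_mem h3 hu₀

/-- The only subgroups stable under the hereditary order of a chain are its members. -/
theorem exists_eq_of_stable [FiniteDimensional D V] (h : IsDChain hv r L)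
    (hπ : ∃ π, π ≠ 0 ∧ v π = 1) {M : AddSubgroup V} {i₀ : ℤ} (hM : M ≤ L i₀) (hM0 : M ≠ ⊥)
    (hstab : ∀ a : Module.End D V, (∀ i, ∀ u ∈ L i, a u ∈ L i) → ∀ u ∈ M, a u ∈ M) :
    ∃ i, M = L i := by
  obtain ⟨u, hu, hu0⟩ := M.bot_or_exists_ne_zero.resolve_left hM0
  obtain ⟨j, -, hj⟩ := h.exists_mem_notMem hπ hu0
  obtain ⟨s, hs, hmax⟩ := Int.exists_greatest_of_bdd (P := fun i => M ≤ L i)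
    ⟨j, fun z hz => by
      by_contra! hjz
      exact hj (h.anti.antitone (by omega) (hz hu))⟩ ⟨i₀, hM⟩
  obtain ⟨m, hm, hms⟩ : ∃ m ∈ M, m ∉ L (s + 1) := by
    by_contra! h0
    have := hmax _ h0
    omega
  obtain ⟨φ, hφm, hφ⟩ := h.exists_functional hπ hms
  refine ⟨s, le_antisymm hs fun x hx => ?_⟩
  have := hstab (φ.smulRight x) (fun i u hu => ?_) m hm
  · simpa [hφm] using this
  · rw [LinearMap.smulRight_apply]
    by_cases h0 : φ u = 0
    · rw [h0, zero_smul]; exact zero_mem _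
    · rw [h.smul_mem_iff h0]
      exact h.anti.antitone (by have := hφ i u hu h0; omega) hx

theorem exists_map_le [FiniteDimensional D V] {r' : ℤ} {L' : ℤ → AddSubgroup V}
    (h : IsDChain hv r L) (h' : IsDChain hv r' L') (hπ : ∃ π, π ≠ 0 ∧ v π = 1)
    (f : V →ₗ[D] V) (i : ℤ) : ∃ j, ∀ u ∈ L i, f u ∈ L' j := by
  let b := Module.finBasis D V
  choose B hB using fun k => h.bounded hπ (b.coord k) i
  choose j hj using fun k => h'.exhaust (f (b k))
  obtain ⟨N, hN⟩ := (Finset.univ.image fun k => j k + r' * B k).bddBelow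
  refine ⟨N, fun u hu => ?_⟩
  rw [← b.sum_repr u, map_sum]
  refine sum_mem fun k _ => ?_
  rw [map_smul]
  exact h'.anti.antitone (hN (Finset.mem_image_of_mem _ (Finset.mem_univ k)))
    (h'.smul_mem_of_mem_ball (hB k u hu) (hj k))

theorem exists_map_eq [FiniteDimensional D V] {r' : ℤ} {L' : ℤ → AddSubgroup V}
    (h : IsDChain hv r L) (h' : IsDChain hv r' L') (hπ : ∃ π, π ≠ 0 ∧ v π = 1)
    (g : V ≃ₗ[D] V)
    (hg : ∀ a : Module.End D V, (∀ i, ∀ u ∈ L' i, a u ∈ L' i) →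
      ∀ i, ∀ u ∈ L i, g.symm (a (g u)) ∈ L i) (i : ℤ) :
    ∃ j, (L i).map (g.toAddEquiv : V →+ V) = L' j := by
  obtain ⟨j, hj⟩ := h.exists_map_le h' hπ (g : V →ₗ[D] V) i
  refine h'.exists_eq_of_stable hπ (i₀ := j) ?_ ?_ fun a ha => ?_
  · rintro _ ⟨u, hu, rfl⟩
    exact hj u hu
  · rw [Ne, AddSubgroup.map_eq_bot_iff_of_injective _ g.injective]
    have := h.anti (lt_add_one i)
    exact (bot_le.trans_lt this).ne'
  · rintro _ ⟨u, hu, rfl⟩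
    exact ⟨_, hg a ha i u hu, g.apply_symm_apply _⟩

theorem exists_shift_of_conj [FiniteDimensional D V] {r' : ℤ} {L' : ℤ → AddSubgroup V}
    (h : IsDChain hv r L) (h' : IsDChain hv r' L') (hπ : ∃ π, π ≠ 0 ∧ v π = 1)
    (g : V ≃ₗ[D] V)
    (hg : ∀ a : Module.End D V, (∀ i, ∀ u ∈ L i, a u ∈ L i) ↔
      ∀ i, ∀ u ∈ L' i, g (a (g.symm u)) ∈ L' i) :
    ∃ c, ∀ i, (L i).map (g.toAddEquiv : V →+ V) = L' (i + c) := by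
  refine exists_shift h.anti h'.anti g.toAddEquiv (h.exists_map_eq h' hπ g fun a ha => ?_)
    fun j => ?_
  · refine (hg ((g.symm : V →ₗ[D] V) ∘ₗ a ∘ₗ (g : V →ₗ[D] V))).2 fun i u hu => ?_
    simpa using ha i u hu
  · obtain ⟨i, hi⟩ := h'.exists_map_eq h hπ g.symm (fun a ha => (hg a).1 ha) j
    refine ⟨i, ?_⟩
    rw [← hi, AddSubgroup.map_map]
    convert AddSubgroup.map_id _
    ext u
    exact g.apply_symm_apply u

end IsDChain

/-- A decreasing ring filtration indexed by `ℤ` that contains a homogeneous unit of degree one. -/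
structure IsUnitFiltration {A : Type*} [Ring A] (C : ℤ → AddSubgroup A) : Prop where
  anti : Antitone C
  one_mem : 1 ∈ C 0
  mul_mem : ∀ {i j a b}, a ∈ C i → b ∈ C j → a * b ∈ C (i + j)
  exists_unit : ∃ p : Aˣ, ∀ N : ℤ, ((p ^ N : Aˣ) : A) ∈ C N

/-- A decreasing filtration of a module compatible with a ring filtration, where the elements of
degree one shift the filtration of the module by `H`. -/
structure IsShiftFiltration {A W : Type*} [Ring A] [AddCommGroup W] [Module A W]
    (C : ℤ → AddSubgroup A) (H : ℕ) (L : ℤ → AddSubgroup W) : Prop where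
  anti : Antitone L
  smul_mem : ∀ {i j a u}, a ∈ C i → u ∈ L j → a • u ∈ L (j + H * i)

section Lift

variable {A W W' : Type*} [Ring A] [AddCommGroup W] [Module A W] [AddCommGroup W'] [Module A W']
  {C : ℤ → AddSubgroup A} {H : ℕ} {L : ℤ → AddSubgroup W} {L' : ℤ → AddSubgroup W'}

theorem neg_ediv_le_iff {h : ℤ} (hh : 0 < h) {i t N : ℤ} :
    -((t - i) / h) ≤ N ↔ i ≤ t + h * N := by
  rw [neg_le, Int.le_ediv_iff_mul_le hh]
  constructor <;> intro h1 <;> linarith [mul_comm h N]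

/-- Coefficient families of degree at least `i` for vectors in degrees `0, …, H - 1`. -/
def coeffFiltration (C : ℤ → AddSubgroup A) {H : ℕ} (m : Fin H → ℕ) (i : ℤ) :
    AddSubgroup ((Σ t, Fin (m t)) → A) where
  carrier := {c | ∀ x, c x ∈ C (-(((x.1 : ℕ) - i) / H))}
  zero_mem' _ := zero_mem _
  add_mem' ha hb x := add_mem (ha x) (hb x)
  neg_mem' ha x := neg_mem (ha x)

theorem coeffFiltration_anti (hC : IsUnitFiltration C) (hH : 0 < H) (m : Fin H → ℕ) :
    Antitone (coeffFiltration C m) := by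
  intro i j hij c hc x
  refine hC.anti ?_ (hc x)
  have hH' : (0 : ℤ) < H := by exact_mod_cast hH
  rw [neg_ediv_le_iff hH']
  exact hij.trans ((neg_ediv_le_iff hH').1 le_rfl)

theorem sum_smul_mem (hH : 0 < H) (hL : IsShiftFiltration C H L)
    {m : Fin H → ℕ} {w : (Σ t, Fin (m t)) → W} (hw : ∀ x, w x ∈ L (x.1 : ℕ)) {i : ℤ}
    {c : (Σ t, Fin (m t)) → A} (hc : c ∈ coeffFiltration C m i) : ∑ x, c x • w x ∈ L i := by
  have hH' : (0 : ℤ) < H := by exact_mod_cast hH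
  exact sum_mem fun x _ => hL.anti ((neg_ediv_le_iff hH').1 le_rfl) (hL.smul_mem (hc x) (hw x))

theorem sum_smul_sub_mem (hH : 0 < H) (hL : IsShiftFiltration C H L)
    {m : Fin H → ℕ} {w : (Σ t, Fin (m t)) → W} (hw : ∀ x, w x ∈ L (x.1 : ℕ)) {N : ℤ} (t : Fin H)
    {c : (Σ t, Fin (m t)) → A} (hc : c ∈ coeffFiltration C m ((t : ℕ) + H * N)) :
    ∑ x, c x • w x - ∑ j, c ⟨t, j⟩ • w ⟨t, j⟩ ∈ L ((t : ℕ) + H * N + 1) := by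
  have hH' : (0 : ℤ) < H := by exact_mod_cast hH
  rw [Fintype.sum_sigma, ← Finset.add_sum_erase _ _ (Finset.mem_univ t), add_sub_cancel_left]
  refine sum_mem fun s hs => sum_mem fun j _ => ?_
  refine hL.anti ?_ (hL.smul_mem (hc ⟨s, j⟩) (hw ⟨s, j⟩))
  dsimp only
  have h1 := (neg_ediv_le_iff hH').1 (le_refl (-((((s : ℕ) : ℤ) - ((t : ℕ) + H * N)) / H)))
  refine Int.add_one_le_iff.2 (lt_of_le_of_ne h1 fun h2 => (Finset.mem_erase.1 hs).1 ?_)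
  have h3 := congrArg (· % (H : ℤ)) h2
  simp only [Int.add_mul_emod_self_left] at h3
  rw [Int.emod_eq_of_lt (by positivity) (by exact_mod_cast t.2),
    Int.emod_eq_of_lt (by positivity) (by exact_mod_cast s.2)] at h3
  exact Fin.ext (by exact_mod_cast h3.symm)

theorem exists_fin_eq (hH : 0 < H) (i : ℤ) : ∃ (t : Fin H) (N : ℤ), i = (t : ℕ) + H * N := by
  have hH' : (0 : ℤ) < H := by exact_mod_cast hH
  refine ⟨⟨(i % H).toNat, ?_⟩, i / H, ?_⟩
  · have := Int.emod_lt_of_pos i hH'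
    have := Int.emod_nonneg i hH'.ne'
    omega
  · rw [Int.toNat_of_nonneg (Int.emod_nonneg i hH'.ne'), Int.emod_add_mul_ediv]

theorem mem_coeffFiltration_add_one (hC : IsUnitFiltration C) (hH : 0 < H)
    (hL : IsShiftFiltration C H L)
    {m : Fin H → ℕ} {w : (Σ t, Fin (m t)) → W} (hw : ∀ x, w x ∈ L (x.1 : ℕ))
    (hind : ∀ (t : Fin H) (c : Fin (m t) → A), (∀ j, c j ∈ C 0) →
      ∑ j, c j • w ⟨t, j⟩ ∈ L ((t : ℕ) + 1) → ∀ j, c j ∈ C 1) {i : ℤ}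
    {c : (Σ t, Fin (m t)) → A} (hc : c ∈ coeffFiltration C m i)
    (hsum : ∑ x, c x • w x ∈ L (i + 1)) : c ∈ coeffFiltration C m (i + 1) := by
  have hH' : (0 : ℤ) < H := by exact_mod_cast hH
  obtain ⟨p, hp⟩ := hC.exists_unit
  obtain ⟨t, N, rfl⟩ := exists_fin_eq hH i
  have h1 : ∑ j, c ⟨t, j⟩ • w ⟨t, j⟩ ∈ L ((t : ℕ) + H * N + 1) := by
    simpa using sub_mem hsum (sum_smul_sub_mem hH hL hw t hc)
  have hct : ∀ j, c ⟨t, j⟩ ∈ C N := fun j => by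
    refine hC.anti ?_ (hc ⟨t, j⟩)
    dsimp only
    rw [sub_add_cancel_left, ← mul_neg, Int.mul_ediv_cancel_left _ hH'.ne', neg_neg]
  have h2 := hind t (fun j => ((p ^ (-N) : Aˣ) : A) * c ⟨t, j⟩)
    (fun j => by simpa using hC.mul_mem (hp (-N)) (hct j)) (by
      simp only [mul_smul, ← Finset.smul_sum]
      have := hL.smul_mem (hp (-N)) h1
      rwa [show (t : ℕ) + H * N + 1 + H * -N = ((t : ℕ) + 1 : ℤ) by ring] at this)
  intro x
  by_cases hx : x.1 = t
  · obtain ⟨s, j⟩ := x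
    obtain rfl : s = t := hx
    have h3 := hC.mul_mem (hp N) (h2 j)
    rw [← mul_assoc, ← Units.val_mul, ← zpow_add, add_neg_cancel, zpow_zero, Units.val_one,
      one_mul] at h3
    refine hC.anti ((neg_ediv_le_iff hH').2 ?_) h3
    dsimp only
    nlinarith
  · refine hC.anti ((neg_ediv_le_iff hH').2 ?_) (hc x)
    have h1 := (neg_ediv_le_iff hH').1 (le_refl (-((((x.1 : ℕ) : ℤ) - ((t : ℕ) + H * N)) / H)))
    refine Int.add_one_le_iff.2 (lt_of_le_of_ne h1 fun h2 => hx ?_)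
    have h3 := congrArg (· % (H : ℤ)) h2
    simp only [Int.add_mul_emod_self_left] at h3
    rw [Int.emod_eq_of_lt (by positivity) (by exact_mod_cast t.2),
      Int.emod_eq_of_lt (by positivity) (by exact_mod_cast x.1.2)] at h3
    exact Fin.ext (by exact_mod_cast h3.symm)

theorem exists_sub_sum_smul_mem (hC : IsUnitFiltration C) (hH : 0 < H)
    (hL : IsShiftFiltration C H L)
    {m : Fin H → ℕ} {w : (Σ t, Fin (m t)) → W}
    (hspan : ∀ t : Fin H, ∀ u ∈ L (t : ℕ), ∃ c : Fin (m t) → A, (∀ j, c j ∈ C 0) ∧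
      u - ∑ j, c j • w ⟨t, j⟩ ∈ L ((t : ℕ) + 1)) {i : ℤ} {u : W} (hu : u ∈ L i) :
    ∃ c ∈ coeffFiltration C m i, u - ∑ x, c x • w x ∈ L (i + 1) := by
  have hH' : (0 : ℤ) < H := by exact_mod_cast hH
  obtain ⟨p, hp⟩ := hC.exists_unit
  obtain ⟨t, N, rfl⟩ := exists_fin_eq hH i
  obtain ⟨c, hc, hcu⟩ := hspan t (((p ^ (-N) : Aˣ) : A) • u) (by
    have := hL.smul_mem (hp (-N)) hu
    rwa [show (t : ℕ) + H * N + H * -N = ((t : ℕ) : ℤ) by ring] at this)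
  let c' : (Σ t, Fin (m t)) → A := fun x =>
    if h : x.1 = t then ((p ^ N : Aˣ) : A) * c (Fin.cast (by rw [h]) x.2) else 0
  have hc't : ∀ j, c' ⟨t, j⟩ = ((p ^ N : Aˣ) : A) * c j := fun j => by simp [c']
  have hc'0 : ∀ x, x.1 ≠ t → c' x = 0 := fun x hx => dif_neg hx
  refine ⟨c', fun x => ?_, ?_⟩
  · by_cases hx : x.1 = t
    · obtain ⟨s, j⟩ := x
      obtain rfl : s = t := hx
      rw [hc't]
      refine hC.anti ((neg_ediv_le_iff hH').2 ?_) (hC.mul_mem (hp N) (hc j))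
      simp
    · rw [hc'0 x hx]; exact zero_mem _
  · have h1 : ∑ x, c' x • w x = ((p ^ N : Aˣ) : A) • ∑ j, c j • w ⟨t, j⟩ := by
      rw [Fintype.sum_sigma, Finset.sum_eq_single t (fun s _ hs => Finset.sum_eq_zero fun j _ => by
        rw [hc'0 _ hs, zero_smul]) (by simp), Finset.smul_sum]
      simp only [hc't, mul_smul]
    have h2 := hL.smul_mem (hp N) hcu
    rw [smul_sub, smul_smul, ← Units.val_mul, ← zpow_add, add_neg_cancel, zpow_zero,
      Units.val_one, one_smul, ← h1] at h2
    exact hL.anti (by linarith) h2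

theorem exists_filtered_lift (hC : IsUnitFiltration C) (hH : 0 < H)
    (hL : IsShiftFiltration C H L) (hL' : IsShiftFiltration C H L')
    (hexh : ∀ u, ∃ i, u ∈ L i) (hsep : ∀ u, (∀ i, u ∈ L' i) → u = 0)
    (hdense : ∀ U : AddSubgroup W, (∀ i, ∀ a ∈ C i, ∀ u ∈ U, a • u ∈ U) →
      (∀ u i, ∃ u' ∈ U, u - u' ∈ L i) → U = ⊤)
    {m : Fin H → ℕ} {w : (Σ t, Fin (m t)) → W} {w' : (Σ t, Fin (m t)) → W'}
    (hw : ∀ x, w x ∈ L (x.1 : ℕ)) (hw' : ∀ x, w' x ∈ L' (x.1 : ℕ))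
    (hind : ∀ (t : Fin H) (c : Fin (m t) → A), (∀ j, c j ∈ C 0) →
      ∑ j, c j • w ⟨t, j⟩ ∈ L ((t : ℕ) + 1) → ∀ j, c j ∈ C 1)
    (hspan : ∀ t : Fin H, ∀ u ∈ L (t : ℕ), ∃ c : Fin (m t) → A, (∀ j, c j ∈ C 0) ∧
      u - ∑ j, c j • w ⟨t, j⟩ ∈ L ((t : ℕ) + 1)) :
    ∃ Ψ : W →+ W', (∀ i, ∀ a ∈ C i, ∀ u, Ψ (a • u) = a • Ψ u) ∧
      (∀ i, ∀ u ∈ L i, Ψ u ∈ L' i) ∧ ∀ x, Ψ (w x) = w' x := by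
  have hH' : (0 : ℤ) < H := by exact_mod_cast hH
  let J := Σ t, Fin (m t)
  have hF := coeffFiltration_anti hC hH m
  let F : AddSubgroup (J → A) :=
    { carrier := {c | ∃ i, c ∈ coeffFiltration C m i}
      zero_mem' := ⟨0, zero_mem _⟩
      add_mem' := fun ⟨i, hi⟩ ⟨j, hj⟩ =>
        ⟨min i j, add_mem (hF (min_le_left _ _) hi) (hF (min_le_right _ _) hj)⟩
      neg_mem' := fun ⟨i, hi⟩ => ⟨i, neg_mem hi⟩ }
  let Φ : F →+ W := AddMonoidHom.mk' (fun c => ∑ x, (c : J → A) x • w x) fun a b => by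
    simp [add_smul, Finset.sum_add_distrib]
  let Φ' : F →+ W' := AddMonoidHom.mk' (fun c => ∑ x, (c : J → A) x • w' x) fun a b => by
    simp [add_smul, Finset.sum_add_distrib]
  have hsmulF : ∀ i, ∀ a ∈ C i, ∀ c ∈ F, a • c ∈ F := by
    rintro i a ha c ⟨j, hj⟩
    refine ⟨j + H * i, fun x => ?_⟩
    refine hC.anti ((neg_ediv_le_iff hH').2 ?_) (hC.mul_mem ha (hj x))
    have := (neg_ediv_le_iff hH').1 (le_refl (-((((x.1 : ℕ) : ℤ) - j) / H)))
    linarith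
  have hstrict : ∀ (c : J → A) (i : ℤ) (n : ℕ), c ∈ coeffFiltration C m i →
      ∑ x, c x • w x ∈ L (i + n) → c ∈ coeffFiltration C m (i + n) := by
    intro c i n hc hsum
    induction n with
    | zero => simpa using hc
    | succ n ih =>
      have h1 := mem_coeffFiltration_add_one hC hH hL hw hind
        (ih (hL.anti (by push_cast; linarith) hsum))
        (by rwa [Nat.cast_succ, ← add_assoc] at hsum)
      rwa [Nat.cast_succ, ← add_assoc]
  have hstrict' : ∀ c ∈ F, ∀ j, ∑ x, c x • w x ∈ L j → c ∈ coeffFiltration C m j := by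
    rintro c ⟨i, hi⟩ j hj
    by_cases hij : j ≤ i
    · exact hF hij hi
    · have := hstrict c i (j - i).toNat hi
      rw [show i + (j - i).toNat = j by omega] at this
      exact this hj
  have hsurj : Function.Surjective Φ := by
    refine AddMonoidHom.range_eq_top.1 (hdense _ ?_ fun u j => ?_)
    · rintro i a ha _ ⟨c, rfl⟩
      exact ⟨⟨_, hsmulF i a ha c c.2⟩, by simp [Φ, Finset.smul_sum, mul_smul]⟩
    · obtain ⟨i, hi⟩ := hexh u
      suffices ∀ n : ℕ, ∃ u' ∈ Φ.range, u - u' ∈ L (i + n) by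
        obtain ⟨u', hu', h⟩ := this (j - i).toNat
        exact ⟨u', hu', hL.anti (by omega) h⟩
      intro n
      induction n with
      | zero => exact ⟨0, zero_mem _, by simpa using hi⟩
      | succ n ih =>
        obtain ⟨u', hu', h⟩ := ih
        obtain ⟨c, hc, hcu⟩ := exists_sub_sum_smul_mem hC hH hL hspan h
        refine ⟨u' + Φ ⟨c, _, hc⟩, add_mem hu' ⟨_, rfl⟩, ?_⟩
        rw [← sub_sub, Nat.cast_succ, ← add_assoc]
        exact hcu
  have hker : Φ.ker ≤ Φ'.ker := by
    intro c hc
    refine hsep _ fun i => sum_smul_mem hH hL' hw' (hstrict' c c.2 i ?_)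
    have : ∑ x, (c : J → A) x • w x = 0 := hc
    rw [this]
    exact zero_mem _
  let Ψ : W →+ W' := Φ.liftOfSurjective hsurj ⟨Φ', hker⟩
  have hΨ : ∀ c, Ψ (Φ c) = Φ' c := fun c => Φ.liftOfRightInverse_comp_apply _ _ ⟨Φ', hker⟩ c
  refine ⟨Ψ, ?_, ?_, ?_⟩
  · intro i a ha u
    obtain ⟨c, rfl⟩ := hsurj u
    have h1 : a • Φ c = Φ ⟨_, hsmulF i a ha c c.2⟩ := by simp [Φ, Finset.smul_sum, mul_smul]
    rw [h1, hΨ, hΨ]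
    simp [Φ', Finset.smul_sum, mul_smul]
  · intro i u hu
    obtain ⟨c, rfl⟩ := hsurj u
    rw [hΨ]
    exact sum_smul_mem hH hL' hw' (hstrict' c c.2 i hu)
  · classical
    intro x
    have hx : Pi.single x 1 ∈ F := by
      refine ⟨(x.1 : ℕ), fun y => ?_⟩
      by_cases hy : y = x
      · subst hy
        simpa using hC.one_mem
      · rw [Pi.single_eq_of_ne hy]; exact zero_mem _
    have h1 : Φ ⟨_, hx⟩ = w x := by
      simp only [Φ, AddMonoidHom.mk'_apply, Pi.single_apply, ite_smul, one_smul, zero_smul]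
      exact (Finset.sum_ite_eq' _ _ _).trans (if_pos (Finset.mem_univ _))
    have h2 : Φ' ⟨_, hx⟩ = w' x := by
      simp only [Φ', AddMonoidHom.mk'_apply, Pi.single_apply, ite_smul, one_smul, zero_smul]
      exact (Finset.sum_ite_eq' _ _ _).trans (if_pos (Finset.mem_univ _))
    rw [← h1, hΨ, h2]

end Lift

/-- The degree zero part of a ring filtration. -/
def IsUnitFiltration.zeroRing {A : Type*} [Ring A] {C : ℤ → AddSubgroup A}
    (hC : IsUnitFiltration C) : Subring A :=
  { C 0 with
    one_mem' := hC.one_mem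
    mul_mem' := fun ha hb => by simpa using hC.mul_mem ha hb }

/-- `μ` presents the `R`-module `M` as the quotient of `N` by `N₁`, where `R` is the residue ring
of a ring filtration. -/
structure IsGraded {A V R M : Type*} [Ring A] [AddCommGroup V] [Module A V]
    [Ring R] [AddCommGroup M] [Module R M] {A₀ : Subring A} (q : A₀ →+* R) (N N₁ : AddSubgroup V)
    (μ : N →+ M) : Prop where
  surj : Function.Surjective μ
  eq_zero_iff : ∀ x, μ x = 0 ↔ (x : V) ∈ N₁
  smul_mem : ∀ c ∈ A₀, ∀ u ∈ N, c • u ∈ N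
  map_smul : ∀ (c : A₀) (x : N), μ ⟨(c : A) • (x : V), smul_mem c c.2 x x.2⟩ = q c • μ x

section

variable {A V R M M' : Type*} [Ring A] [AddCommGroup V] [Module A V]
    [Ring R] [AddCommGroup M] [Module R M] [AddCommGroup M'] [Module R M'] {A₀ : Subring A}
    {q : A₀ →+* R} {N N₁ N' N₁' : AddSubgroup V} {μ : N →+ M} {μ' : N' →+ M'}

theorem IsGraded.sum_mem (hμ : IsGraded q N N₁ μ) {m : ℕ} (c : Fin m → A₀) (w : Fin m → V)
    (hw : ∀ j, w j ∈ N) : ∑ j, (c j : A) • w j ∈ N :=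
  _root_.sum_mem fun j _ => hμ.smul_mem _ (c j).2 _ (hw j)

theorem IsGraded.map_sum (hμ : IsGraded q N N₁ μ) {m : ℕ} (c : Fin m → A₀) (w : Fin m → V)
    (hw : ∀ j, w j ∈ N) :
    μ ⟨∑ j, (c j : A) • w j, hμ.sum_mem c w hw⟩ = ∑ j, q (c j) • μ ⟨w j, hw j⟩ := by
  rw [← Finset.sum_congr rfl fun j _ => hμ.map_smul (c j) ⟨w j, hw j⟩, ← _root_.map_sum]
  congr 1
  ext
  simp

/-- A basis of a power of a graded piece, together with a linear injection into another graded
piece, lifts to vectors. -/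
theorem IsGraded.exists_lift [Finite R] [Nontrivial R] [Finite M] (hq : Function.Surjective q)
    (hμ : IsGraded q N N₁ μ) (hμ' : IsGraded q N' N₁' μ') (φ : M →ₗ[R] M')
    (hφ : Function.Injective φ) (n : ℕ) (k₀ : Fin n) [Module.Free R (Fin n → M)] :
    ∃ (m : ℕ) (w w' : Fin m → Fin n → V), (∀ j k, w j k ∈ N) ∧ (∀ j k, w' j k ∈ N') ∧
      (∀ c : Fin m → A, (∀ j, c j ∈ A₀) → (∀ k, ∑ j, c j • w j k ∈ N₁) →
        ∀ j, ∃ h : c j ∈ A₀, q ⟨c j, h⟩ = 0) ∧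
      (∀ u : Fin n → V, (∀ k, u k ∈ N) → ∃ c : Fin m → A, (∀ j, c j ∈ A₀) ∧
        ∀ k, u k - ∑ j, c j • w j k ∈ N₁) ∧
      ∀ c : Fin m → A, (∀ j, c j ∈ A₀) → ∀ u ∈ N, u - ∑ j, c j • w j k₀ ∈ N₁ →
        ∑ j, c j • w' j k₀ ∈ N₁' → u ∈ N₁ := by
  have : Module.Finite R (Fin n → M) := Module.Finite.of_finite
  let b := Module.Free.chooseBasis R (Fin n → M)
  let b' := b.reindex (Fintype.equivFin _)
  choose w hw using fun j k => hμ.surj (b' j k)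
  choose w' hw' using fun j k => hμ'.surj (φ (b' j k))
  refine ⟨_, fun j k => w j k, fun j k => w' j k, fun j k => (w j k).2, fun j k => (w' j k).2,
    ?_, ?_, ?_⟩
  · intro c hc hsum
    have h1 : ∑ j, q ⟨c j, hc j⟩ • b' j = 0 := by
      ext k
      have h2 := (hμ.eq_zero_iff ⟨_, hμ.sum_mem (fun j => ⟨c j, hc j⟩) (fun j => (w j k : V))
        fun j => (w j k).2⟩).2 (hsum k)
      rw [hμ.map_sum _ _ fun j => (w j k).2] at h2
      simpa [hw] using h2
    intro j
    exact ⟨hc j, Fintype.linearIndependent_iff.1 b'.linearIndependent _ h1 j⟩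
  · intro u hu
    choose c hc using fun j => hq (b'.repr (fun k => μ ⟨u k, hu k⟩) j)
    refine ⟨fun j => c j, fun j => (c j).2, fun k => ?_⟩
    have hmem := hμ.sum_mem c (fun j => (w j k : V)) fun j => (w j k).2
    have h1 := hμ.eq_zero_iff (⟨u k, hu k⟩ - ⟨_, hmem⟩)
    refine h1.1 ?_
    rw [map_sub, hμ.map_sum _ _ fun j => (w j k).2, sub_eq_zero]
    have h2 := congrFun (b'.sum_repr (fun k => μ ⟨u k, hu k⟩)) k
    rw [← h2]
    simp [hw, hc]
  · intro c hc u hu hsub hsum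
    have hmem := hμ.sum_mem (fun j => ⟨c j, hc j⟩) (fun j => (w j k₀ : V)) fun j => (w j k₀).2
    have h1 := (hμ.eq_zero_iff (⟨u, hu⟩ - ⟨_, hmem⟩)).2 hsub
    rw [map_sub, hμ.map_sum _ _ fun j => (w j k₀).2, sub_eq_zero] at h1
    have h2 := (hμ'.eq_zero_iff ⟨_, hμ'.sum_mem (fun j => ⟨c j, hc j⟩) (fun j => (w' j k₀ : V))
        fun j => (w' j k₀).2⟩).2 hsum
    rw [hμ'.map_sum _ _ fun j => (w' j k₀).2] at h2
    refine (hμ.eq_zero_iff ⟨u, hu⟩).1 (hφ ?_)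
    rw [h1, map_zero, ← h2]
    simp [hw, hw']

end

/-- Two lattice chains whose graded pieces are isomorphic over the residue ring of a filtration are
isomorphic. -/
theorem IsDChain.exists_equiv {A D V R : Type*} [DivisionRing D] [AddCommGroup V] [Module D V]
    [FiniteDimensional D V] [Ring A] [Module A V] [Ring R] [Finite R] [Nontrivial R] {v : D → ℤ}
    {hv : IsDiscVal v} (hπ : ∃ π, π ≠ 0 ∧ v π = 1) {r r' : ℤ} {L L' : ℤ → AddSubgroup V}
    (h : IsDChain hv r L) (h' : IsDChain hv r' L')
    {C : ℤ → AddSubgroup A} (hC : IsUnitFiltration C) {H : ℕ} (hH : 0 < H)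
    (hL : IsShiftFiltration C H L) (hL' : IsShiftFiltration C H L')
    (hδ : ∀ y : D, ∃ i, ∃ a ∈ C i, ∀ u : V, a • u = y • u)
    {q : hC.zeroRing →+* R} (hq : Function.Surjective q) (hq0 : ∀ c, q c = 0 → (c : A) ∈ C 1)
    (M M' : Fin H → Type*) [∀ t, AddCommGroup (M t)] [∀ t, Module R (M t)] [∀ t, Finite (M t)]
    [∀ t, AddCommGroup (M' t)] [∀ t, Module R (M' t)]
    (μ : ∀ t : Fin H, L (t : ℕ) →+ M t)
    (hμ : ∀ t : Fin H, IsGraded q (L (t : ℕ)) (L ((t : ℕ) + 1)) (μ t))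
    (μ' : ∀ t : Fin H, L' (t : ℕ) →+ M' t)
    (hμ' : ∀ t : Fin H, IsGraded q (L' (t : ℕ)) (L' ((t : ℕ) + 1)) (μ' t))
    (φ : ∀ t, M t →ₗ[R] M' t) (hφ : ∀ t, Function.Injective (φ t))
    (n : ℕ) (hn : 0 < n) (hfree : ∀ t, Module.Free R (Fin n → M t)) :
    ∃ ψ : V ≃ₗ[D] V, (∀ i u, ψ u ∈ L' i ↔ u ∈ L i) ∧
      ∀ i, ∀ a ∈ C i, ∀ u, ψ (a • u) = a • ψ u := by
  let k₀ : Fin n := ⟨0, hn⟩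
  choose m w w' hw hw' hind hspan hnd using fun t : Fin H =>
    (hμ t).exists_lift hq (hμ' t) (φ t) (hφ t) n k₀
  let P (K : ℤ → AddSubgroup V) (i : ℤ) : AddSubgroup (Fin n → V) :=
    AddSubgroup.pi Set.univ fun _ => K i
  have hP : ∀ K i u, u ∈ P K i ↔ ∀ k, u k ∈ K i := fun K i u => by simp [P, AddSubgroup.mem_pi]
  have hPf : ∀ K, IsShiftFiltration C H K → IsShiftFiltration C H (P K) := fun K hK =>
    { anti := fun i j hij u hu => (hP _ _ _).2 fun k => hK.anti hij ((hP _ _ _).1 hu k)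
      smul_mem := fun ha hu => (hP _ _ _).2 fun k => hK.smul_mem ha ((hP _ _ _).1 hu k) }
  have hexh : ∀ u : Fin n → V, ∃ i, u ∈ P L i := by
    intro u
    choose i hi using fun k => h.exhaust (u k)
    obtain ⟨N, hN⟩ := (Finset.univ.image i).bddBelow
    exact ⟨N, (hP _ _ _).2 fun k =>
      h.anti.antitone (hN (Finset.mem_image_of_mem _ (Finset.mem_univ k))) (hi k)⟩
  have hdense : ∀ U : AddSubgroup (Fin n → V), (∀ i, ∀ a ∈ C i, ∀ u ∈ U, a • u ∈ U) →
      (∀ u i, ∃ u' ∈ U, u - u' ∈ P L i) → U = ⊤ := by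
    intro U hU hdense
    let U' : Submodule D (Fin n → V) :=
      { U with
        smul_mem' := fun y u hu => by
          obtain ⟨i, a, ha, hau⟩ := hδ y
          have : y • u = a • u := funext fun k => (hau (u k)).symm
          rw [this]
          exact hU i a ha u hu }
    suffices U' = ⊤ from SetLike.ext fun u => by
      have : u ∈ U' := this ▸ Submodule.mem_top
      exact ⟨fun _ => AddSubgroup.mem_top u, fun _ => this⟩
    by_contra hne
    obtain ⟨w₀, -, hw₀⟩ := SetLike.exists_of_lt (lt_top_iff_ne_top.2 hne)
    obtain ⟨χ, hχ, hχU⟩ := Submodule.exists_le_ker_of_notMem (K := D) hw₀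
    choose B hB using fun k => h.bdd (χ ∘ₗ LinearMap.single D (fun _ : Fin n => V) k)
    obtain ⟨N, hN⟩ := (Finset.univ.image B).bddBelow
    have hχL : ∀ u ∈ P L 0, χ u ∈ hv.ball N := by
      intro u hu
      have h1 : χ u = ∑ k, χ (Pi.single k (u k)) := by
        rw [← map_sum, Finset.univ_sum_single]
      rw [h1]
      exact sum_mem fun k _ => hv.ball_anti (hN (Finset.mem_image_of_mem _ (Finset.mem_univ k)))
        (hB k _ ((hP _ _ _).1 hu k))
    refine hχ (hv.eq_zero_of_forall_mem_ball fun j => ?_)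
    obtain ⟨π, hπ, vπ⟩ := hπ
    obtain ⟨u', hu', hsub⟩ := hdense w₀ (r * ((j : ℤ) - N))
    have h1 : χ (w₀ - u') = χ w₀ := by
      have h2 : χ u' = 0 := hχU hu'
      rw [map_sub, h2, sub_zero]
    have h3 := hχL (π ^ (N - (j : ℤ)) • (w₀ - u')) ((hP _ _ _).2 fun k => by
      refine (h.smul_mem_iff (zpow_ne_zero _ hπ)).2 ?_
      rw [hv.map_zpow hπ, vπ]
      exact h.anti.antitone (by linarith) ((hP _ _ _).1 hsub k))
    rw [map_smul, h1, smul_eq_mul] at h3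
    have h4 := hv.mul_mem_ball (hv.mem_ball_self (π ^ ((j : ℤ) - N))) h3
    rwa [← mul_assoc, ← zpow_add₀ hπ, sub_add_sub_cancel, sub_self, zpow_zero, one_mul,
      hv.map_zpow hπ, vπ, mul_one, sub_add_cancel] at h4
  let w₁ : (Σ t, Fin (m t)) → Fin n → V := fun x => w x.1 x.2
  let w₁' : (Σ t, Fin (m t)) → Fin n → V := fun x => w' x.1 x.2
  obtain ⟨Ψ, hΨA, hΨL, hΨw⟩ := exists_filtered_lift hC hH (hPf L hL) (hPf L' hL') hexh
    (fun u hu => funext fun k => h'.eq_zero_of_forall_mem hπ fun i => (hP _ _ _).1 (hu i) k)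
    hdense (w := w₁) (w' := w₁')
    (fun x => (hP _ _ _).2 (hw x.1 x.2)) (fun x => (hP _ _ _).2 (hw' x.1 x.2))
    (fun t c hc hsum j => by
      obtain ⟨hj, hqj⟩ := hind t c hc (fun k => by simpa [w₁] using (hP _ _ _).1 hsum k) j
      exact hq0 _ hqj)
    (fun t u hu => by
      obtain ⟨c, hc, hcu⟩ := hspan t u ((hP _ _ _).1 hu)
      exact ⟨c, hc, (hP _ _ _).2 fun k => by simpa [w₁] using hcu k⟩)
  let ψ₀ : V → V := fun u => Ψ (Pi.single k₀ u) k₀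
  have hψA : ∀ i, ∀ a ∈ C i, ∀ u, ψ₀ (a • u) = a • ψ₀ u := fun i a ha u => by
    simp only [ψ₀]
    rw [← Pi.smul_apply, ← hΨA i a ha, Pi.single_smul]
  let ψ : V →ₗ[D] V :=
    { toFun := ψ₀
      map_add' := fun x y => by simp only [ψ₀, Pi.single_add, map_add, Pi.add_apply]
      map_smul' := fun y u => by
        obtain ⟨i, a, ha, hau⟩ := hδ y
        rw [← hau, hψA i a ha, hau, RingHom.id_apply] }
  have hsingle : ∀ i u, u ∈ L i → Pi.single k₀ u ∈ P L i := fun i u hu =>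
    (hP _ _ _).2 fun k => by
      by_cases hk : k = k₀
      · subst hk; simpa using hu
      · rw [Pi.single_eq_of_ne hk]; exact zero_mem _
  have hψL : ∀ i, ∀ u ∈ L i, ψ u ∈ L' i := fun i u hu =>
    (hP _ _ _).1 (hΨL i _ (hsingle i u hu)) k₀
  have hstep : ∀ (t : Fin H), ∀ u ∈ L (t : ℕ), ψ u ∈ L' ((t : ℕ) + 1) →
      u ∈ L ((t : ℕ) + 1) := by
    intro t u hu hψu
    obtain ⟨c, hc, hcu⟩ := hspan t (Pi.single k₀ u) ((hP _ _ _).1 (hsingle _ u hu))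
    refine hnd t c hc u hu (by simpa using hcu k₀) ?_
    have h1 := (hP _ _ _).1 (hΨL _ (Pi.single k₀ u - ∑ j, c j • w t j)
      ((hP _ _ _).2 fun k => by simpa using hcu k)) k₀
    have h2 : Ψ (∑ j, c j • w t j) = ∑ j, c j • w' t j := by
      rw [map_sum]
      exact Finset.sum_congr rfl fun j _ => by rw [hΨA 0 _ (hc j), hΨw ⟨t, j⟩]
    rw [map_sub, h2] at h1
    have h3 : ψ u = Ψ (Pi.single k₀ u) k₀ := rfl
    rw [h3] at hψu
    simpa using sub_mem hψu h1
  have hstep' : ∀ i, ∀ u ∈ L i, ψ u ∈ L' (i + 1) → u ∈ L (i + 1) := by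
    intro i u hu hψu
    obtain ⟨p, hp⟩ := hC.exists_unit
    obtain ⟨t, N, rfl⟩ := exists_fin_eq hH i
    have h1 := hL.smul_mem (hp (-N)) hu
    have h2 := hL'.smul_mem (hp (-N)) hψu
    have h3 : ψ (((p ^ (-N) : Aˣ) : A) • u) = ((p ^ (-N) : Aˣ) : A) • ψ u := hψA _ _ (hp _) u
    rw [← h3] at h2
    have h4 := hL.smul_mem (hp N) (hstep t _ (hL.anti (by linarith) h1)
      (hL'.anti (by linarith) h2))
    rw [smul_smul, ← Units.val_mul, ← zpow_add, add_neg_cancel, zpow_zero, Units.val_one,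
      one_smul] at h4
    exact hL.anti (by linarith) h4
  have hiff : ∀ i u, ψ u ∈ L' i ↔ u ∈ L i := by
    refine fun i u => ⟨fun hu => ?_, hψL i u⟩
    by_cases hu0 : u = 0
    · rw [hu0]; exact zero_mem _
    obtain ⟨s, hs, hs1⟩ := h.exists_mem_notMem hπ hu0
    by_cases his : i ≤ s
    · exact h.anti.antitone his hs
    · exact absurd (hstep' s u hs (h'.anti.antitone (by omega) hu)) hs1
  have hinj : Function.Injective ψ := by
    refine (injective_iff_map_eq_zero ψ).2 fun u hu => h.eq_zero_of_forall_mem hπ fun i => ?_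
    rw [← hiff, hu]
    exact zero_mem _
  exact ⟨LinearEquiv.ofInjectiveEndo ψ hinj, hiff, hψA⟩

section

variable {E D A : Type*} [Field E] [DivisionRing D] [Ring A]

/-- The filtration on the subring generated by commuting images of `E` and `D` for which
`ρ x * δ y` has degree `a * w x + b * v y`. -/
def prodFiltration (ρ : E →+* A) (δ : D →+* A) (w : E → ℤ) (v : D → ℤ) (a b : ℤ) (j : ℤ) :
    AddSubgroup A :=
  AddSubgroup.closure {z | ∃ x y, x ≠ 0 ∧ y ≠ 0 ∧ j ≤ a * w x + b * v y ∧ z = ρ x * δ y}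

variable {ρ : E →+* A} {δ : D →+* A} {w : E → ℤ} {v : D → ℤ} {a b : ℤ}

theorem mul_mem_prodFiltration {x : E} {y : D} {j : ℤ}
    (h : x ≠ 0 → y ≠ 0 → j ≤ a * w x + b * v y) : ρ x * δ y ∈ prodFiltration ρ δ w v a b j := by
  by_cases hx : x = 0
  · rw [hx, map_zero, zero_mul]; exact zero_mem _
  by_cases hy : y = 0
  · rw [hy, map_zero, mul_zero]; exact zero_mem _
  exact AddSubgroup.subset_closure ⟨x, y, hx, hy, h hx hy, rfl⟩

theorem map_left_mem_prodFiltration (hv : IsDiscVal v) {x : E} {j : ℤ}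
    (h : x ≠ 0 → j ≤ a * w x) : ρ x ∈ prodFiltration ρ δ w v a b j := by
  have := mul_mem_prodFiltration (ρ := ρ) (δ := δ) (w := w) (v := v) (a := a) (b := b) (x := x)
    (y := 1) (j := j) fun hx _ => by rw [hv.map_one]; linarith [h hx]
  rwa [map_one, mul_one] at this

theorem map_right_mem_prodFiltration (hw : IsDiscVal w) {y : D} {j : ℤ}
    (h : y ≠ 0 → j ≤ b * v y) : δ y ∈ prodFiltration ρ δ w v a b j := by
  have := mul_mem_prodFiltration (ρ := ρ) (δ := δ) (w := w) (v := v) (a := a) (b := b) (x := 1)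
    (y := y) (j := j) fun _ hy => by rw [hw.map_one]; linarith [h hy]
  rwa [map_one, one_mul] at this

theorem isUnitFiltration_prodFiltration (hw : IsDiscVal w) (hv : IsDiscVal v)
    (hcomm : ∀ x y, Commute (δ y) (ρ x)) (hπE : ∃ π, π ≠ 0 ∧ w π = 1)
    (hπD : ∃ π, π ≠ 0 ∧ v π = 1) (hab : IsCoprime a b) :
    IsUnitFiltration (prodFiltration ρ δ w v a b) where
  anti i j hij := AddSubgroup.closure_mono fun z ⟨x, y, hx, hy, h, hz⟩ =>
    ⟨x, y, hx, hy, hij.trans h, hz⟩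
  one_mem := by
    rw [← map_one ρ]
    exact map_left_mem_prodFiltration hv fun _ => by rw [hw.map_one, mul_zero]
  mul_mem {i j z z'} hz hz' := by
    induction hz using AddSubgroup.closure_induction with
    | mem z hz =>
      obtain ⟨x, y, hx, hy, h, rfl⟩ := hz
      induction hz' using AddSubgroup.closure_induction with
      | mem z' hz' =>
        obtain ⟨x', y', hx', hy', h', rfl⟩ := hz'
        rw [(hcomm x' y).mul_mul_mul_comm, ← map_mul, ← map_mul]
        refine mul_mem_prodFiltration fun _ _ => ?_
        rw [hw.map_mul _ _ hx hx', hv.map_mul _ _ hy hy']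
        linarith
      | zero => rw [mul_zero]; exact zero_mem _
      | add _ _ _ _ h1 h2 => rw [mul_add]; exact add_mem h1 h2
      | neg _ _ h1 => rw [mul_neg]; exact neg_mem h1
    | zero => rw [zero_mul]; exact zero_mem _
    | add _ _ _ _ h1 h2 => rw [add_mul]; exact add_mem h1 h2
    | neg _ _ h1 => rw [neg_mul]; exact neg_mem h1
  exists_unit := by
    obtain ⟨π, hπ, wπ⟩ := hπE
    obtain ⟨ϖ, hϖ, vϖ⟩ := hπD
    obtain ⟨s, t, hst⟩ := hab
    let x : Eˣ := Units.mk0 π hπ ^ s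
    let y : Dˣ := Units.mk0 ϖ hϖ ^ t
    have hxy : Commute (Units.map (ρ : E →* A) x) (Units.map (δ : D →* A) y) :=
      Units.ext (hcomm x y).symm
    refine ⟨Units.map (ρ : E →* A) x * Units.map (δ : D →* A) y, fun N => ?_⟩
    rw [hxy.mul_zpow, ← map_zpow, ← map_zpow, ← zpow_mul, ← zpow_mul]
    refine mul_mem_prodFiltration fun _ _ => le_of_eq ?_
    rw [Units.val_zpow_eq_zpow_val, Units.val_zpow_eq_zpow_val, Units.val_mk0, Units.val_mk0,
      hw.map_zpow hπ, hv.map_zpow hϖ, wπ, vϖ]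
    linear_combination (-N) * hst

theorem isShiftFiltration_prodFiltration {V : Type*} [AddCommGroup V] [Module A V] {H : ℕ}
    {L : ℤ → AddSubgroup V} (hL : Antitone L)
    (hρ : ∀ x ≠ 0, ∀ i, ∀ u ∈ L i, ρ x • u ∈ L (i + H * (a * w x)))
    (hδ : ∀ y ≠ 0, ∀ i, ∀ u ∈ L i, δ y • u ∈ L (i + H * (b * v y))) :
    IsShiftFiltration (prodFiltration ρ δ w v a b) H L where
  anti := hL
  smul_mem {i j z u} hz hu := by
    induction hz using AddSubgroup.closure_induction with
    | mem z hz =>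
      obtain ⟨x, y, hx, hy, h, rfl⟩ := hz
      rw [mul_smul]
      refine hL ?_ (hρ x hx _ _ (hδ y hy j u hu))
      nlinarith [Nat.cast_nonneg (α := ℤ) H]
    | zero => rw [zero_smul]; exact zero_mem _
    | add _ _ _ _ h1 h2 => rw [add_smul]; exact add_mem h1 h2
    | neg _ _ h1 => rw [neg_smul]; exact neg_mem h1

/-- A ring homomorphism from the integers of a discretely valued skew field to the degree zero part
of a filtration induces a homomorphism on residue rings. -/
theorem IsDiscVal.IsResidueMap.exists_lift {hv : IsDiscVal v} {κ R : Type*} [Field κ] [Ring R]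
    {r : hv.integers →+* κ} (hr : hv.IsResidueMap r) {C : ℤ → AddSubgroup A}
    (hC : IsUnitFiltration C) {q : hC.zeroRing →+* R} (hq0 : ∀ c, q c = 0 ↔ (c : A) ∈ C 1)
    (δ : D →+* A) (h0 : ∀ y ∈ hv.ball 0, δ y ∈ C 0) (h1 : ∀ y ∈ hv.ball 1, δ y ∈ C 1) :
    ∃ β : κ →+* R, ∀ y : hv.integers, β (r y) = q ⟨δ y, h0 y y.2⟩ := by
  let f : hv.integers →+* hC.zeroRing :=
    (δ.comp hv.integers.subtype).codRestrict hC.zeroRing fun y => h0 y y.2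
  have hker : RingHom.ker r ≤ RingHom.ker (q.comp f) := fun y hy => by
    rw [RingHom.mem_ker, hr.eq_zero_iff] at hy
    exact (hq0 _).2 (h1 y hy)
  exact ⟨RingHom.liftOfSurjective r hr.surj ⟨q.comp f, hker⟩, fun y =>
    RingHom.liftOfRightInverse_comp_apply r _ _ ⟨q.comp f, hker⟩ y⟩

end

/-- The degree zero residue ring of the filtered ring generated by `E` and `D` is a finite simple
ring. -/
theorem isSimpleRing_residueRing {k E D A R κ₀ κE κD : Type*} [Field k] [Field E] [DivisionRing D]
    [Algebra k E] [Algebra k D] [Ring A] [Ring R] [Nontrivial R] [Field κ₀] [Field κE] [Field κD]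
    [Finite κ₀] [Finite κE] [Finite κD] [Algebra κ₀ κE] [Algebra κ₀ κD]
    {vk : k → ℤ} {w : E → ℤ} {v : D → ℤ}
    {hk : IsDiscVal vk} {hw : IsDiscVal w} {hv : IsDiscVal v}
    {rk : hk.integers →+* κ₀} {rE : hw.integers →+* κE} {rD : hv.integers →+* κD}
    (hrk : hk.IsResidueMap rk) (hrE : hw.IsResidueMap rE) (hrD : hv.IsResidueMap rD)
    (hkE : ∀ (c : hk.integers) (x : hw.integers), (x : E) = algebraMap k E c →
      rE x = algebraMap κ₀ κE (rk c))
    (hkD : ∀ (c : hk.integers) (y : hv.integers), (y : D) = algebraMap k D c →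
      rD y = algebraMap κ₀ κD (rk c))
    {ρ : E →+* A} {δ : D →+* A} (hcomm : ∀ x y, Commute (δ y) (ρ x))
    (hρδ : ∀ c, ρ (algebraMap k E c) = δ (algebraMap k D c)) {d e f : ℕ} (hd : 0 < d) (he : 0 < e)
    (hE : ∀ c : k, c ≠ 0 → w (algebraMap k E c) = e * vk c)
    (hD : ∀ c : k, c ≠ 0 → v (algebraMap k D c) = d * vk c)
    {π : E} (hπ : π ≠ 0) (wπ : w π = 1) {ϖ : D} (hϖ : ϖ ≠ 0) (vϖ : v ϖ = 1)
    (hϖd : ∃ c : k, algebraMap k D c = ϖ ^ d) (hfD : Module.finrank κ₀ κD = d)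
    (hfE : Module.finrank κ₀ κE = f) {σ : κD ≃ₐ[κ₀] κD} (hσ : orderOf σ = d)
    (hconj : ∀ y, rD (hv.conj hϖ y) = σ (rD y)) (hcop : Nat.Coprime (d / Nat.gcd d e) f)
    (hC : IsUnitFiltration
      (prodFiltration ρ δ w v ((d / Nat.gcd d e : ℕ) : ℤ) ((e / Nat.gcd d e : ℕ) : ℤ)))
    {q : hC.zeroRing →+* R} (hq : Function.Surjective q)
    (hq0 : ∀ c, q c = 0 ↔
      (c : A) ∈ prodFiltration ρ δ w v ((d / Nat.gcd d e : ℕ) : ℤ) ((e / Nat.gcd d e : ℕ) : ℤ) 1) :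
    Finite R ∧ IsSimpleRing R := by
  set g := Nat.gcd d e with hg
  set a := d / g with ha
  set b := e / g with hb
  have hg0 : 0 < g := Nat.gcd_pos_of_pos_left _ hd
  have hag : a * g = d := Nat.div_mul_cancel (Nat.gcd_dvd_left d e)
  have hbg : b * g = e := Nat.div_mul_cancel (Nat.gcd_dvd_right d e)
  have hab : Nat.Coprime a b := Nat.coprime_div_gcd_div_gcd hg0
  have ha0 : 0 < a := Nat.pos_of_mul_pos_right (hag ▸ hd)
  have hb0 : 0 < b := Nat.pos_of_mul_pos_right (hbg ▸ he)
  set C := prodFiltration ρ δ w v (a : ℤ) (b : ℤ)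
  have hρC : ∀ j : ℤ, 0 ≤ j → ∀ x ∈ hw.ball j, ρ x ∈ C j := fun j hj x hx =>
    map_left_mem_prodFiltration hv fun hx0 => by
      have := (hw.mem_ball_of_ne hx0).1 hx
      have : (1 : ℤ) ≤ a := by exact_mod_cast ha0
      nlinarith
  have hδC : ∀ j : ℤ, 0 ≤ j → ∀ y ∈ hv.ball j, δ y ∈ C j := fun j hj y hy =>
    map_right_mem_prodFiltration hw fun hy0 => by
      have := (hv.mem_ball_of_ne hy0).1 hy
      have : (1 : ℤ) ≤ b := by exact_mod_cast hb0
      nlinarith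
  obtain ⟨α₀, hα₀⟩ := hrE.exists_lift hC hq0 ρ (hρC 0 le_rfl) (hρC 1 zero_le_one)
  obtain ⟨β₀, hβ₀⟩ := hrD.exists_lift hC hq0 δ (hδC 0 le_rfl) (hδC 1 zero_le_one)
  have hρcomm : ∀ x : E, ∀ j, ∀ z ∈ C j, Commute (ρ x) z := by
    intro x j z hz
    induction hz using AddSubgroup.closure_induction with
    | mem z hz =>
      obtain ⟨x', y, -, -, -, rfl⟩ := hz
      exact ((Commute.all x x').map ρ).mul_right (hcomm x y).symm
    | zero => exact Commute.zero_right _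
    | add _ _ _ _ h1 h2 => exact h1.add_right h2
    | neg _ _ h1 => exact h1.neg_right
  have hα₀comm : ∀ x z, Commute (α₀ x) z := by
    intro x z
    obtain ⟨x, rfl⟩ := hrE.surj x
    obtain ⟨z, rfl⟩ := hq z
    rw [hα₀]
    refine Commute.map (Subtype.ext ?_) q
    exact hρcomm x 0 z z.2
  let algR : Algebra κ₀ R := (α₀.comp (algebraMap κ₀ κE)).toAlgebra' fun c z => hα₀comm _ z
  let α : κE →ₐ[κ₀] R := { α₀ with commutes' := fun c => rfl }
  have hβ₀c : ∀ c, β₀ (algebraMap κ₀ κD c) = α₀ (algebraMap κ₀ κE c) := by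
    intro c
    obtain ⟨c, rfl⟩ := hrk.surj c
    have hcE : algebraMap k E c ∈ hw.integers := by
      rcases c.2 with h | h
      · left; rw [h, map_zero]
      · by_cases h0 : (c : k) = 0
        · left; rw [h0, map_zero]
        · right; rw [hE _ h0]; positivity
    have hcD : algebraMap k D c ∈ hv.integers := by
      rcases c.2 with h | h
      · left; rw [h, map_zero]
      · by_cases h0 : (c : k) = 0
        · left; rw [h0, map_zero]
        · right; rw [hD _ h0]; positivity
    rw [← hkE c ⟨_, hcE⟩ rfl, ← hkD c ⟨_, hcD⟩ rfl, hα₀, hβ₀]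
    congr 1
    exact Subtype.ext (hρδ c).symm
  let β : κD →ₐ[κ₀] R := { β₀ with commutes' := hβ₀c }
  have hα : ∀ x : hw.integers, α (rE x) = q ⟨ρ x, hρC 0 le_rfl x x.2⟩ := hα₀
  have hβ : ∀ y : hv.integers, β (rD y) = q ⟨δ y, hδC 0 le_rfl y y.2⟩ := hβ₀
  let x₀ : Eˣ := Units.mk0 π hπ ^ (-b : ℤ)
  let y₀ : Dˣ := Units.mk0 ϖ hϖ ^ a
  have hxy : ∀ i : ℤ, ρ ((x₀ ^ i : Eˣ) : E) * δ ((y₀ ^ i : Dˣ) : D) ∈ C 0 := fun i =>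
    mul_mem_prodFiltration fun _ _ => by
      simp only [x₀, y₀, Units.val_zpow_eq_zpow_val, Units.val_pow_eq_pow_val, Units.val_mk0,
        hw.map_zpow hπ, hw.map_zpow (zpow_ne_zero _ hπ), hv.map_pow hϖ,
        hv.map_zpow (pow_ne_zero _ hϖ), wπ, vϖ]
      exact le_of_eq (by ring)
  let ζ : ℤ → hC.zeroRing := fun i => ⟨_, hxy i⟩
  have hζ : ∀ i j, ζ i * ζ j = ζ (i + j) := fun i j => by
    refine Subtype.ext ?_
    change ρ _ * δ _ * (ρ _ * δ _) = ρ _ * δ _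
    rw [(hcomm _ _).mul_mul_mul_comm, ← map_mul, ← map_mul, ← Units.val_mul, ← Units.val_mul,
      ← zpow_add, ← zpow_add]
  have hζ0 : ζ 0 = 1 := Subtype.ext (by simp [ζ])
  let z : Rˣ := ⟨q (ζ 1), q (ζ (-1)), by rw [← map_mul, hζ]; simp [hζ0],
    by rw [← map_mul, hζ]; simp [hζ0]⟩
  have hz : ∀ i : ℤ, ((z ^ i : Rˣ) : R) = q (ζ i) := by
    intro i
    induction i with
    | zero => simp [hζ0]
    | succ n ih => rw [zpow_add_one, Units.val_mul, ih, ← hζ, map_mul]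
    | pred n ih => rw [zpow_sub_one, Units.val_mul, ih, sub_eq_add_neg, ← hζ, map_mul]; rfl
  have hconj' : ∀ (n : ℕ) (y : hv.integers), ∃ y' : hv.integers,
      (y' : D) = ϖ ^ n * y * (ϖ ^ n)⁻¹ ∧ rD y' = (σ ^ n) (rD y) := by
    intro n y
    induction n with
    | zero => exact ⟨y, by simp, by simp⟩
    | succ n ih =>
      obtain ⟨y', h1, h2⟩ := ih
      refine ⟨hv.conj hϖ y', ?_, ?_⟩
      · rw [hv.coe_conj, h1, pow_succ', mul_inv_rev]
        simp only [mul_assoc]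
      · rw [hconj, h2, pow_succ']; rfl
  have hord : orderOf (σ ^ a) = g := by
    rw [orderOf_pow' σ ha0.ne', hσ, Nat.gcd_eq_right ⟨g, hag.symm⟩]
    exact Nat.div_eq_of_eq_mul_right ha0 hag.symm
  obtain ⟨c, hc⟩ := hϖd
  have hc0 : c ≠ 0 := by
    rintro rfl
    rw [map_zero] at hc
    exact pow_ne_zero _ hϖ hc.symm
  have hvc : vk c = 1 := by
    have h1 := hD c hc0
    rw [hc, hv.map_pow hϖ, vϖ, mul_one] at h1
    have : (d : ℤ) ≠ 0 := by exact_mod_cast hd.ne'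
    exact (mul_left_cancel₀ this (by rw [mul_one]; exact h1)).symm
  have hε : π ^ (-e : ℤ) * algebraMap k E c ∈ hw.integers := by
    right
    rw [hw.map_mul _ _ (zpow_ne_zero _ hπ) ((map_ne_zero _).2 hc0), hw.map_zpow hπ, wπ, hE c hc0,
      hvc]
    linarith
  refine isSimpleRing_of_generators α β (fun x y => (hα₀comm x _).symm) z
    (fun x => (hα₀comm x _).symm) (σ ^ a) (fun y => ?_) (rE ⟨_, hε⟩) ?_ ?_ ?_
  · obtain ⟨y, rfl⟩ := hrD.surj y
    obtain ⟨y', h1, h2⟩ := hconj' a y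
    rw [← h2, hβ, hβ]
    change q (ζ 1) * _ = _ * q (ζ 1)
    rw [← map_mul, ← map_mul]
    congr 1
    refine Subtype.ext ?_
    change ρ _ * δ _ * δ _ = δ _ * (ρ _ * δ _)
    rw [← mul_assoc, (hcomm _ _).eq, mul_assoc, mul_assoc, ← map_mul, ← map_mul, h1]
    congr 2
    simp [y₀, hϖ]
  · rw [hord, hα]
    have h1 : (z : R) ^ g = ((z ^ (g : ℤ) : Rˣ) : R) := by simp
    rw [h1, hz]
    congr 1
    refine Subtype.ext ?_
    change ρ _ * δ _ = ρ _
    have h2 : ((y₀ ^ (g : ℤ) : Dˣ) : D) = algebraMap k D c := by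
      rw [hc, ← hag]
      simp [y₀, pow_mul]
    rw [h2, ← hρδ, ← map_mul]
    congr 2
    rw [← hbg]
    simp only [x₀, ← zpow_mul, Units.val_zpow_eq_zpow_val, Units.val_mk0]
    push_cast
    congr 1
    ring
  · refine eq_top_iff.2 fun s _ => ?_
    obtain ⟨⟨s, hs⟩, rfl⟩ := hq s
    suffices ∀ s ∈ C 0, ∃ h : s ∈ C 0, q ⟨s, h⟩ ∈ AddSubgroup.closure
        {w : R | ∃ x y, ∃ i : ℤ, w = α x * β y * (z ^ i : Rˣ)} from (this s hs).2
    intro s hs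
    induction hs using AddSubgroup.closure_induction with
    | mem s hs =>
      obtain ⟨x, y, hx, hy, h, rfl⟩ := hs
      refine ⟨mul_mem_prodFiltration fun _ _ => h, ?_⟩
      rcases h.lt_or_eq with h | h
      · rw [(hq0 _).2 (mul_mem_prodFiltration fun _ _ => h)]
        exact zero_mem _
      · obtain ⟨i, hi⟩ : (a : ℤ) ∣ v y := by
          have h1 : (a : ℤ) ∣ b * v y := ⟨-w x, by linarith⟩
          exact (Nat.isCoprime_iff_coprime.2 hab).dvd_of_dvd_mul_left h1
        have hwx : w x = -b * i := by
          have : (a : ℤ) ≠ 0 := by exact_mod_cast ha0.ne'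
          refine mul_left_cancel₀ this ?_
          rw [hi] at h
          linear_combination -h
        have hx' : x * ((x₀ ^ (-i) : Eˣ) : E) ∈ hw.integers := by
          right
          simp only [x₀, Units.val_zpow_eq_zpow_val, Units.val_mk0]
          rw [hw.map_mul _ _ hx (zpow_ne_zero _ (zpow_ne_zero _ hπ)),
            hw.map_zpow (zpow_ne_zero _ hπ), hw.map_zpow hπ, wπ, hwx]
          exact le_of_eq (by ring)
        have hy' : y * ((y₀ ^ (-i) : Dˣ) : D) ∈ hv.integers := by
          right
          simp only [y₀, Units.val_zpow_eq_zpow_val, Units.val_mk0, Units.val_pow_eq_pow_val]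
          rw [hv.map_mul _ _ hy (zpow_ne_zero _ (pow_ne_zero _ hϖ)),
            hv.map_zpow (pow_ne_zero _ hϖ), hv.map_pow hϖ, vϖ, hi]
          exact le_of_eq (by ring)
        refine AddSubgroup.subset_closure ⟨rE ⟨_, hx'⟩, rD ⟨_, hy'⟩, i, ?_⟩
        rw [hα, hβ, hz, ← map_mul, ← map_mul]
        congr 1
        refine Subtype.ext ?_
        change ρ _ * δ _ = ρ _ * δ _ * (ρ _ * δ _)
        rw [(hcomm _ _).mul_mul_mul_comm, ← map_mul, ← map_mul]
        simp only [mul_assoc, ← Units.val_mul, ← zpow_add, neg_add_cancel, zpow_zero,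
          Units.val_one, mul_one]
    | zero => exact ⟨zero_mem _, by
        have : (⟨0, zero_mem _⟩ : hC.zeroRing) = 0 := rfl
        rw [this, map_zero]; exact zero_mem _⟩
    | add s t _ _ h1 h2 =>
      obtain ⟨h1, h1'⟩ := h1
      obtain ⟨h2, h2'⟩ := h2
      exact ⟨add_mem h1 h2, by
        have : (⟨s + t, add_mem h1 h2⟩ : hC.zeroRing) = ⟨s, h1⟩ + ⟨t, h2⟩ := rfl
        rw [this, map_add]; exact add_mem h1' h2'⟩
    | neg s _ h1 =>
      obtain ⟨h1, h1'⟩ := h1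
      exact ⟨neg_mem h1, by
        have : (⟨-s, neg_mem h1⟩ : hC.zeroRing) = -⟨s, h1⟩ := rfl
        rw [this, map_neg]; exact neg_mem h1'⟩
  · rw [hord, hfD, hfE]
    exact hcop

theorem exists_isGraded.{u} {A R : Type*} {V : Type u} [Ring A] [AddCommGroup V] [Module A V]
    [Ring R] {A₀ : Subring A} {q : A₀ →+* R} (hq : Function.Surjective q) {N N₁ : AddSubgroup V}
    (hN : ∀ c ∈ A₀, ∀ u ∈ N, c • u ∈ N) (hN₁ : ∀ c ∈ A₀, ∀ u ∈ N₁, c • u ∈ N₁)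
    (hq0 : ∀ c, q c = 0 → ∀ u ∈ N, (c : A) • u ∈ N₁) :
    ∃ (M : Type u) (_ : AddCommGroup M) (_ : Module R M) (μ : N →+ M),
      IsGraded q N N₁ μ ∧ Nat.card M = N₁.relIndex N := by
  let P : Submodule A₀ V := { N with smul_mem' := fun c u hu => hN c c.2 u hu }
  let P₁ : Submodule A₀ V := { N₁ with smul_mem' := fun c u hu => hN₁ c c.2 u hu }
  let Q : Submodule A₀ P := P₁.comap P.subtype
  have hker : RingHom.ker q ≤ RingHom.ker (Module.toAddMonoidEnd A₀ (P ⧸ Q)) := fun c hc => by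
    refine AddMonoidHom.ext fun m => ?_
    obtain ⟨m, rfl⟩ := Q.mkQ_surjective m
    exact (Submodule.Quotient.mk_eq_zero Q).2 (hq0 c hc m m.2)
  let F : R →+* AddMonoid.End (P ⧸ Q) := RingHom.liftOfSurjective q hq ⟨_, hker⟩
  have hF : ∀ c, F (q c) = Module.toAddMonoidEnd A₀ (P ⧸ Q) c :=
    RingHom.liftOfRightInverse_comp_apply q _ _ ⟨_, hker⟩
  let _ : Module R (P ⧸ Q) := Module.compHom _ F
  refine ⟨P ⧸ Q, inferInstance, inferInstance, AddMonoidHom.mk' (fun x => Q.mkQ ⟨x, x.2⟩)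
    fun x y => map_add Q.mkQ ⟨x, x.2⟩ ⟨y, y.2⟩, ⟨fun m => ?_, fun x => ?_, hN, fun c x => ?_⟩, ?_⟩
  · obtain ⟨m, rfl⟩ := Q.mkQ_surjective m
    exact ⟨⟨m, m.2⟩, rfl⟩
  · exact Submodule.Quotient.mk_eq_zero Q
  · change _ = F (q c) (Q.mkQ ⟨x, x.2⟩)
    rw [hF]
    rfl
  · rfl

/-- The residue ring in degree zero of a ring filtration. -/
theorem IsUnitFiltration.exists_residueRing.{u} {A : Type u} [Ring A] {C : ℤ → AddSubgroup A}
    (hC : IsUnitFiltration C) :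
    ∃ (R : Type u) (_ : Ring R) (q : hC.zeroRing →+* R), Function.Surjective q ∧
      ∀ c, q c = 0 ↔ (c : A) ∈ C 1 := by
  let I : Ideal hC.zeroRing :=
    { (C 1).comap hC.zeroRing.subtype.toAddMonoidHom with
      smul_mem' := fun c x hx => by simpa using hC.mul_mem (i := 0) (j := 1) c.2 hx }
  have : I.IsTwoSided := ⟨fun {x} y hx => by
    have := hC.mul_mem (i := 1) (j := 0) hx y.2
    rwa [add_zero] at this⟩
  exact ⟨hC.zeroRing ⧸ I, inferInstance, Ideal.Quotient.mk I, Ideal.Quotient.mk_surjective,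
    fun c => Ideal.Quotient.eq_zero_iff_mem⟩

namespace IsDChain

variable {D V : Type*} [DivisionRing D] [AddCommGroup V] [Module D V] {v : D → ℤ}
  {hv : IsDiscVal v} {r : ℤ} {L : ℤ → AddSubgroup V}

theorem shift (h : IsDChain hv r L) (hπ : ∃ π, π ≠ 0 ∧ v π = 1) (c : ℤ) :
    IsDChain hv r fun i => L (i + c) where
  anti i j hij := h.anti (by linarith)
  pos := h.pos
  smul_mem y i u hy hu := by
    rw [add_right_comm]
    exact h.smul_mem y _ u hy hu
  exhaust u := by
    obtain ⟨i, hi⟩ := h.exhaust u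
    exact ⟨i - c, by rwa [sub_add_cancel]⟩
  bdd χ := h.bounded hπ χ _
  relIndex_ne_zero i := by
    rw [add_right_comm]
    exact h.relIndex_ne_zero _

theorem period_eq (h : IsDChain hv r L) (hπ : ∃ π, π ≠ 0 ∧ v π = 1) {r' : ℤ}
    {L' : ℤ → AddSubgroup V} (h' : IsDChain hv r' L') (g : V ≃ₗ[D] V)
    (hg : ∀ i u, g u ∈ L' i ↔ u ∈ L i) : r = r' := by
  obtain ⟨π, hπ, vπ⟩ := hπ
  have : L (0 - r) = L (0 - r') := by
    ext u
    rw [← mul_one r, ← mul_one r', ← vπ, ← h.smul_mem_iff hπ, ← hg, map_smul, h'.smul_mem_iff hπ,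
      hg]
  have := h.anti.injective this
  linarith

/-- A field whose units permute a lattice chain shifts it according to its valuation. -/
theorem exists_scale {k E κ : Type*} [Field k] [Field E] [Algebra k E] [Algebra k D]
    [Field κ] [Finite κ] {w : E → ℤ} {hw : IsDiscVal w} {rE : hw.integers →+* κ}
    (h : IsDChain hv r L) (hrE : hw.IsResidueMap rE) (hc : hw.Complete)
    (ρ : E →+* Module.End D V) {d e : ℕ} (hd : 0 < d) (he : 0 < e) {π : E} (hπ : π ≠ 0)
    (wπ : w π = 1) (hk : ∃ c : k, c ≠ 0 ∧ w (algebraMap k E c) = e ∧ v (algebraMap k D c) = d)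
    (hρ : ∀ (c : k) (u : V), ρ (algebraMap k E c) u = algebraMap k D c • u)
    (hn : ∀ x : E, x ≠ 0 → ∃ n : ℤ, ∀ i u, ρ x u ∈ L (i + n) ↔ u ∈ L i) :
    ∃ H : ℕ, 0 < H ∧ r = H * (e / Nat.gcd d e : ℕ) ∧
      ∀ x ≠ 0, ∀ i, ∀ u ∈ L i, ρ x u ∈ L (i + H * ((d / Nat.gcd d e : ℕ) * w x)) := by
  choose! n hn using hn
  have huniq : ∀ x m, x ≠ 0 → (∀ i u, ρ x u ∈ L (i + m) ↔ u ∈ L i) → n x = m := by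
    intro x m hx hm
    have hinj : Function.Surjective (ρ x) := fun u => ⟨ρ x⁻¹ u, by
      rw [← Module.End.mul_apply, ← map_mul, mul_inv_cancel₀ hx, map_one, Module.End.one_apply]⟩
    have : L (0 + n x) = L (0 + m) := by
      ext u
      obtain ⟨u, rfl⟩ := hinj u
      rw [hn x hx, hm]
    linarith [h.anti.injective this]
  have hmul : ∀ x y, x ≠ 0 → y ≠ 0 → n (x * y) = n x + n y := fun x y hx hy => by
    refine huniq _ _ (mul_ne_zero hx hy) fun i u => ?_
    rw [map_mul, Module.End.mul_apply, add_comm (n x), ← add_assoc, hn x hx, hn y hy]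
  have hn1 : n 1 = 0 := huniq _ _ one_ne_zero fun i u => by
    rw [map_one, Module.End.one_apply, add_zero]
  have hpow : ∀ m : ℤ, n (π ^ m) = m * n π := by
    intro m
    induction m with
    | zero => simpa using hn1
    | succ m ih => rw [zpow_add_one₀ hπ, hmul _ _ (zpow_ne_zero _ hπ) hπ, ih]; ring
    | pred m ih =>
      have h1 := hmul (π ^ (-(m : ℤ) - 1)) π (zpow_ne_zero _ hπ) hπ
      rw [← zpow_add_one₀ hπ, sub_add_cancel, ih] at h1
      linarith
  have hval : ∀ x, x ≠ 0 → n x = n π * w x := by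
    intro x hx
    have hx' : x = π ^ w x * (π ^ (-w x) * x) := by
      rw [← mul_assoc, ← zpow_add₀ hπ, add_neg_cancel, zpow_zero, one_mul]
    have hne := mul_ne_zero (zpow_ne_zero (-w x) hπ) hx
    conv_lhs => rw [hx']
    rw [hmul _ _ (zpow_ne_zero _ hπ) hne, hpow,
      IsDiscVal.character_unit_eq_zero hrE hc n hmul hne ?_]
    · ring
    · rw [hw.map_mul _ _ (zpow_ne_zero _ hπ) hx, hw.map_zpow hπ, wπ]; ring
  have hkey : n π * e = r * d := by
    obtain ⟨c, hc0, hwc, hvc⟩ := hk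
    rw [← hwc, ← hval _ ((map_ne_zero _).2 hc0), ← hvc]
    refine huniq _ _ ((map_ne_zero _).2 hc0) fun i u => ?_
    rw [hρ, h.smul_mem_iff ((map_ne_zero _).2 hc0), add_sub_cancel_right]
  set g := Nat.gcd d e with hg
  set a := d / g with ha
  set b := e / g with hb
  have hg0 : 0 < g := Nat.gcd_pos_of_pos_left _ hd
  have hag : a * g = d := Nat.div_mul_cancel (Nat.gcd_dvd_left d e)
  have hbg : b * g = e := Nat.div_mul_cancel (Nat.gcd_dvd_right d e)
  have hab : Nat.Coprime a b := Nat.coprime_div_gcd_div_gcd hg0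
  have hb0 : 0 < b := Nat.pos_of_mul_pos_right (hbg ▸ he)
  have hkey' : n π * b = r * a := by
    have : (g : ℤ) ≠ 0 := by exact_mod_cast hg0.ne'
    refine mul_right_cancel₀ this ?_
    rw [mul_assoc, mul_assoc]
    exact_mod_cast hbg.symm ▸ hag.symm ▸ hkey
  obtain ⟨m, hm⟩ : (b : ℤ) ∣ r :=
    (Nat.isCoprime_iff_coprime.2 hab).symm.dvd_of_dvd_mul_right ⟨n π, by linarith⟩
  have hb0' : (0 : ℤ) < b := by exact_mod_cast hb0
  have hm0 : 0 < m := by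
    have := h.pos
    rw [hm] at this
    exact pos_of_mul_pos_right this hb0'.le
  have hnπ : n π = m * a := by
    refine mul_right_cancel₀ hb0'.ne' ?_
    rw [hkey', hm]; ring
  lift m to ℕ using hm0.le
  refine ⟨m, by exact_mod_cast hm0, by rw [hm]; ring, fun x hx i u hu => ?_⟩
  rw [← mul_assoc, ← hnπ, ← hval x hx]
  exact (hn x hx i u).2 hu

end IsDChain

/-- Two lattice chains with the same successive indices, shifted by a field `E`, are related by an
automorphism commuting with `E`. -/
theorem IsDChain.exists_commuting_equiv {k E D V κ₀ κE κD : Type*} [Field k] [Field E]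
    [DivisionRing D] [Algebra k E] [Algebra k D] [AddCommGroup V] [Module D V]
    [FiniteDimensional D V] [Field κ₀] [Field κE] [Field κD]
    [Finite κ₀] [Finite κE] [Finite κD] [Algebra κ₀ κE] [Algebra κ₀ κD]
    {vk : k → ℤ} {w : E → ℤ} {v : D → ℤ}
    {hk : IsDiscVal vk} {hw : IsDiscVal w} {hv : IsDiscVal v}
    {rk : hk.integers →+* κ₀} {rE : hw.integers →+* κE} {rD : hv.integers →+* κD}
    (hrk : hk.IsResidueMap rk) (hrE : hw.IsResidueMap rE) (hrD : hv.IsResidueMap rD)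
    (hkE : ∀ (c : hk.integers) (x : hw.integers), (x : E) = algebraMap k E c →
      rE x = algebraMap κ₀ κE (rk c))
    (hkD : ∀ (c : hk.integers) (y : hv.integers), (y : D) = algebraMap k D c →
      rD y = algebraMap κ₀ κD (rk c))
    (hcE : hw.Complete) (hcD : hv.Complete) {d e f : ℕ} (hd : 0 < d) (he : 0 < e)
    (hE : ∀ c : k, c ≠ 0 → w (algebraMap k E c) = e * vk c)
    (hD : ∀ c : k, c ≠ 0 → v (algebraMap k D c) = d * vk c)
    (hπk : ∃ π, π ≠ 0 ∧ vk π = 1) (hπE : ∃ π, π ≠ 0 ∧ w π = 1) (hπD : ∃ π, π ≠ 0 ∧ v π = 1)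
    (hcentral : ∀ z : D, (∀ w, z * w = w * z) → ∃ c : k, algebraMap k D c = z)
    (hdim : Module.finrank k D = d * d)
    (hfE : Module.finrank κ₀ κE = f) (hcop : Nat.Coprime (d / Nat.gcd d e) f)
    (ρ : E →+* Module.End D V)
    (hρ : ∀ (c : k) (u : V), ρ (algebraMap k E c) u = algebraMap k D c • u)
    {r : ℤ} {L L' : ℤ → AddSubgroup V} (h : IsDChain hv r L) (h' : IsDChain hv r L')
    (hn : ∀ x : E, x ≠ 0 → ∃ n : ℤ, ∀ i u, ρ x u ∈ L (i + n) ↔ u ∈ L i)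
    (hn' : ∀ x : E, x ≠ 0 → ∃ n : ℤ, ∀ i u, ρ x u ∈ L' (i + n) ↔ u ∈ L' i)
    (hind : ∀ i, (L (i + 1)).relIndex (L i) = (L' (i + 1)).relIndex (L' i)) :
    ∃ ψ : V ≃ₗ[D] V, (∀ i u, ψ u ∈ L' i ↔ u ∈ L i) ∧ ∀ x u, ψ (ρ x u) = ρ x (ψ u) := by
  obtain ⟨ϖ, hϖ, vϖ, hϖd, hfD, σ, hσ, hconj⟩ := IsDiscVal.exists_central_uniformizer hd hD hrD hkD
    hrk hcD hπD hcentral hdim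
  obtain ⟨π, hπ, wπ⟩ := id hπE
  have hc : ∃ c : k, c ≠ 0 ∧ w (algebraMap k E c) = e ∧ v (algebraMap k D c) = d := by
    obtain ⟨c, hc, vc⟩ := hπk
    exact ⟨c, hc, by rw [hE c hc, vc, mul_one], by rw [hD c hc, vc, mul_one]⟩
  obtain ⟨H, hH, hr, hLρ⟩ := h.exists_scale hrE hcE ρ hd he hπ wπ hc hρ hn
  obtain ⟨H', -, hr', hLρ'⟩ := h'.exists_scale hrE hcE ρ hd he hπ wπ hc hρ hn'
  have hb0 : 0 < e / Nat.gcd d e :=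
    Nat.div_pos (Nat.gcd_le_right _ he) (Nat.gcd_pos_of_pos_left _ hd)
  obtain rfl : H = H' := by
    have h1 := hr.symm.trans hr'
    have h2 : ((e / Nat.gcd d e : ℕ) : ℤ) ≠ 0 := by exact_mod_cast hb0.ne'
    exact_mod_cast mul_right_cancel₀ h2 h1
  let ρA : E →+* AddMonoid.End V := (Module.toAddMonoidEnd (Module.End D V) V).comp ρ
  let δ : D →+* AddMonoid.End V := Module.toAddMonoidEnd D V
  have hcomm : ∀ x y, Commute (δ y) (ρA x) := fun x y =>
    AddMonoidHom.ext fun u => (map_smul (ρ x) y u).symm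
  have hab : IsCoprime ((d / Nat.gcd d e : ℕ) : ℤ) ((e / Nat.gcd d e : ℕ) : ℤ) :=
    Nat.isCoprime_iff_coprime.2 (Nat.coprime_div_gcd_div_gcd (Nat.gcd_pos_of_pos_left _ hd))
  have hC := isUnitFiltration_prodFiltration (ρ := ρA) hw hv hcomm hπE hπD hab
  have hLδ : ∀ {K : ℤ → AddSubgroup V}, IsDChain hv r K → ∀ y ≠ 0, ∀ i, ∀ u ∈ K i,
      δ y • u ∈ K (i + H * ((e / Nat.gcd d e : ℕ) * v y)) := fun hK y hy i u hu => by
    rw [← mul_assoc, ← hr]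
    exact hK.smul_mem y i u hy hu
  have hL := isShiftFiltration_prodFiltration (ρ := ρA) h.anti.antitone hLρ (hLδ h)
  have hL' := isShiftFiltration_prodFiltration (ρ := ρA) h'.anti.antitone hLρ' (hLδ h')
  obtain ⟨R, _, q, hq, hq0⟩ := hC.exists_residueRing
  have hH' : (0 : ℤ) < H := by exact_mod_cast hH
  have : Nontrivial R := by
    refine nontrivial_of_ne 1 0 fun h1 => ?_
    rw [← map_one q, hq0] at h1
    refine (h.anti (show (0 : ℤ) < 0 + H * 1 by linarith)).not_ge fun u hu => ?_
    simpa using hL.smul_mem h1 hu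
  obtain ⟨_, _⟩ := isSimpleRing_residueRing hrk hrE hrD hkE hkD hcomm
    (fun c => AddMonoidHom.ext (hρ c)) hd he hE hD hπ wπ hϖ vϖ hϖd hfD hfE hσ hconj hcop hC hq hq0
  have hgr : ∀ {K : ℤ → AddSubgroup V}, IsShiftFiltration _ H K → ∀ t : Fin H, _ :=
    fun {K} hK t => exists_isGraded (V := V) hq (N := K (t : ℕ)) (N₁ := K ((t : ℕ) + 1))
      (fun c hc u hu => by simpa using hK.smul_mem hc hu)
      (fun c hc u hu => by simpa using hK.smul_mem hc hu)
      (fun c hc u hu => hK.anti (by linarith [show (1 : ℤ) ≤ H by exact_mod_cast hH])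
        (hK.smul_mem ((hq0 c).1 hc) hu))
  choose M i₁ i₂ μ hμ hM using hgr hL
  choose M' i₁' i₂' μ' hμ' hM' using hgr hL'
  have hfin : ∀ t, Finite (M t) := fun t =>
    Nat.finite_of_card_ne_zero (by rw [hM]; exact h.relIndex_ne_zero _)
  have hfin' : ∀ t, Finite (M' t) := fun t =>
    Nat.finite_of_card_ne_zero (by rw [hM']; exact h'.relIndex_ne_zero _)
  have φ : ∀ t, M t ≃ₗ[R] M' t := fun t =>
    (IsSimpleRing.nonempty_linearEquiv_of_card_eq (by rw [hM, hM', hind])).some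
  obtain ⟨n, hn0, hfree⟩ := IsSimpleRing.exists_free_pi R
  obtain ⟨ψ, hψL, hψ⟩ := h.exists_equiv hπD h' hC hH hL hL'
    (fun y => ⟨_, δ y, map_right_mem_prodFiltration hw fun _ => le_rfl, fun _ => rfl⟩) hq
    (fun c => (hq0 c).1) M M' μ hμ μ' hμ' (fun t => (φ t).toLinearMap) (fun t => (φ t).injective)
    n hn0 fun t => hfree (M t)
  exact ⟨ψ, hψL, fun x u => hψ _ (ρA x) (map_left_mem_prodFiltration hv fun _ => le_rfl) u⟩

theorem image_conj_eq_iff {A : Type*} [Monoid A] (g : Aˣ) (O O' : Set A) :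
    (fun a => (g : A) * a * ((g⁻¹ : Aˣ) : A)) '' O = O' ↔
      ∀ a, a ∈ O ↔ (g : A) * a * ((g⁻¹ : Aˣ) : A) ∈ O' := by
  constructor
  · rintro rfl a
    refine ⟨fun ha => ⟨a, ha, rfl⟩, ?_⟩
    rintro ⟨b, hb, hba⟩
    rwa [← g.mul_right_inj.1 (g⁻¹.mul_left_inj.1 hba)]
  · intro h
    ext a
    refine ⟨?_, fun ha => ⟨((g⁻¹ : Aˣ) : A) * a * g, (h _).2 ?_, ?_⟩⟩
    · rintro ⟨b, hb, rfl⟩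
      exact (h b).1 hb
    · simpa [mul_assoc] using ha
    · simp [mul_assoc]

theorem mem_latticeOrder_iff {D V : Type*} [DivisionRing D] [AddCommGroup V] [Module Dᵐᵒᵖ V]
    {Λ : ℝ → AddSubgroup V} {L : ℤ → AddSubgroup V} (h : Set.range L = Set.range Λ)
    {a : Module.End Dᵐᵒᵖ V} : a ∈ latticeOrder Λ ↔ ∀ i, ∀ u ∈ L i, a u ∈ L i := by
  have h1 := Set.forall_mem_range (f := L) (p := fun N => ∀ u ∈ N, a u ∈ N)
  rw [h, Set.forall_mem_range] at h1
  exact h1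

theorem IsDChain.exists_shift_of_unit {D V : Type*} [DivisionRing D] [AddCommGroup V] [Module D V]
    [FiniteDimensional D V] {v : D → ℤ} {hv : IsDiscVal v} {r r' : ℤ} {L L' : ℤ → AddSubgroup V}
    (h : IsDChain hv r L) (h' : IsDChain hv r' L') (hπ : ∃ π, π ≠ 0 ∧ v π = 1)
    (g : (Module.End D V)ˣ) (hg : ∀ a : Module.End D V, (∀ i, ∀ u ∈ L i, a u ∈ L i) ↔
      ∀ i, ∀ u ∈ L' i, ((g : Module.End D V) * a * ((g⁻¹ : (Module.End D V)ˣ) : Module.End D V)) u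
        ∈ L' i) :
    ∃ c, ∀ i u, (g : Module.End D V) u ∈ L' (i + c) ↔ u ∈ L i := by
  let G := LinearMap.GeneralLinearGroup.generalLinearEquiv D V g
  obtain ⟨c, hc⟩ := h.exists_shift_of_conj h' hπ G hg
  refine ⟨c, fun i u => ?_⟩
  rw [← hc]
  exact AddSubgroup.mem_map_iff_mem (f := (G.toAddEquiv : V →+ V)) G.injective

namespace IsDiscVal

theorem IsResidueMap.exists_map {k K κ₀ κ : Type*} [Field k] [DivisionRing K] [Algebra k K]
    [Field κ₀] [Field κ] {vk : k → ℤ} {v : K → ℤ} {hk : IsDiscVal vk} {hv : IsDiscVal v} {e : ℕ}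
    (he : 0 < e) (hcompat : ∀ c, c ≠ 0 → v (algebraMap k K c) = e * vk c)
    {rk : hk.integers →+* κ₀} {r : hv.integers →+* κ} (hrk : hk.IsResidueMap rk)
    (hr : hv.IsResidueMap r) :
    ∃ φ : κ₀ →+* κ, ∀ (c : hk.integers) (x : hv.integers), (x : K) = algebraMap k K c →
      r x = φ (rk c) := by
  have hball : ∀ j : ℤ, 0 ≤ j → ∀ c ∈ hk.ball j, algebraMap k K c ∈ hv.ball j := by
    intro j hj c hc
    by_cases hc0 : c = 0
    · rw [hc0, map_zero]; exact zero_mem _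
    · right
      have h1 := (hk.mem_ball_of_ne hc0).1 hc
      have h2 : (1 : ℤ) ≤ e := by exact_mod_cast he
      rw [hcompat c hc0]
      nlinarith
  let F : hk.integers →+* hv.integers :=
    ((algebraMap k K).comp hk.integers.subtype).codRestrict hv.integers fun c =>
      hball 0 le_rfl c c.2
  have hker : RingHom.ker rk ≤ RingHom.ker (r.comp F) := fun c hc =>
    (hr.eq_zero_iff _).2 (hball 1 zero_le_one c ((hrk.eq_zero_iff c).1 hc))
  refine ⟨RingHom.liftOfSurjective rk hrk.surj ⟨r.comp F, hker⟩, fun c x hx => ?_⟩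
  rw [show x = F c from Subtype.ext hx]
  exact (RingHom.liftOfRightInverse_comp_apply rk _ _ ⟨r.comp F, hker⟩ c).symm

end IsDiscVal

theorem IsLocalValuation.intVal_algebraMap {k K : Type*} [Field k] [DivisionRing K] [Algebra k K]
    {νk : k → EReal} {ν : K → EReal} {e q qK : ℕ} (hk : IsLocalValuation k νk 1 q)
    (h : IsLocalValuation K ν e qK) (hcompat : ∀ c, ν (algebraMap k K c) = νk c) (c : k)
    (hc : c ≠ 0) : intVal ν e (algebraMap k K c) = e * intVal νk 1 c := by
  have he : (e : ℝ) ≠ 0 := by exact_mod_cast h.e_pos.ne'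
  rw [h.intVal_eq_iff ((map_ne_zero _).2 hc), hcompat, hk.eq_intVal hc]
  push_cast
  congr 1
  field_simp

/-- `k` a non-Archimedean local field, `D` a central division
`k`-algebra of index `d`, `V` a finite-dimensional right `D`-vector space, `E|k` a
field extension inside `End_D(V)` (given by the embedding `ι`) such that
`d/gcd(d, e(E|k))` is coprime to `f(E|k)`, and `(E, 𝔞)`, `(E, 𝔞′)` embeddings, where
the hereditary orders `𝔞 = 𝔤_Λ(0)` and `𝔞′ = 𝔤_{Λ′}(0)` are normalized by `E^×`.
Then `𝔞` and `𝔞′` are conjugate by an element of `Aut_D(V)` commuting with every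
element of `E` if and only if they are conjugate by an element of `Aut_D(V)`. -/
theorem stmt_15
    {k D V E : Type*} [Field k] [DivisionRing D] [Algebra k D]
    [AddCommGroup V] [Module Dᵐᵒᵖ V] [Module k V]
    [IsScalarTower k Dᵐᵒᵖ V] [SMulCommClass Dᵐᵒᵖ k V] [Module.Finite Dᵐᵒᵖ V]
    [Field E] [Algebra k E] [FiniteDimensional k E]
    (νk : k → EReal) (νE : E → EReal) (νD : D → EReal) (e f q qE qD d : ℕ)
    (hk : IsLocalValuation k νk 1 q) (hE : IsLocalValuation E νE e qE)
    (hD : IsLocalValuation D νD d qD)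
    (hcompatE : ∀ c : k, νE (algebraMap k E c) = νk c)
    (hcompatD : ∀ c : k, νD (algebraMap k D c) = νk c)
    (hdeg : Module.finrank k E = e * f) (hresdeg : qE = q ^ f)
    (hdim : Module.finrank k D = d * d)
    (hcentral : ∀ z : D, (∀ w, z * w = w * z) → ∃ c : k, algebraMap k D c = z)
    -- the embedding of `E` into `End_D(V)`
    (ι : E →ₐ[k] Module.End Dᵐᵒᵖ V)
    -- the coprimality assumption
    (hcop : Nat.Coprime (d / Nat.gcd d e) f)
    -- the hereditary orders `𝔞 = 𝔤_Λ(0)`, `𝔞′ = 𝔤_{Λ′}(0)`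
    (Λ Λ' : ℝ → AddSubgroup V)
    (hΛ : IsLatticeFunction νD d Λ) (hΛ' : IsLatticeFunction νD d Λ')
    -- `(E, 𝔞)` and `(E, 𝔞′)` are embeddings: `E^×` normalizes `𝔞` and `𝔞′`
    (hnormΛ : ∀ x : E, x ≠ 0 → ∀ a : Module.End Dᵐᵒᵖ V,
      a ∈ latticeOrder Λ ↔ ι x * a * ι x⁻¹ ∈ latticeOrder Λ)
    (hnormΛ' : ∀ x : E, x ≠ 0 → ∀ a : Module.End Dᵐᵒᵖ V,
      a ∈ latticeOrder Λ' ↔ ι x * a * ι x⁻¹ ∈ latticeOrder Λ') :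
    (∃ g : (Module.End Dᵐᵒᵖ V)ˣ,
        (∀ x : E, (g : Module.End Dᵐᵒᵖ V) * ι x = ι x * (g : Module.End Dᵐᵒᵖ V)) ∧
        (fun a => (g : Module.End Dᵐᵒᵖ V) * a * ((g⁻¹ : (Module.End Dᵐᵒᵖ V)ˣ) :
          Module.End Dᵐᵒᵖ V)) '' latticeOrder Λ = latticeOrder Λ') ↔
    (∃ g : (Module.End Dᵐᵒᵖ V)ˣ,
        (fun a => (g : Module.End Dᵐᵒᵖ V) * a * ((g⁻¹ : (Module.End Dᵐᵒᵖ V)ˣ) :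
          Module.End Dᵐᵒᵖ V)) '' latticeOrder Λ = latticeOrder Λ') := by
  constructor
  · rintro ⟨g, -, hg⟩
    exact ⟨g, hg⟩
  rintro ⟨g, hg⟩
  rcases subsingleton_or_nontrivial V with hV | hV
  · have htop : ∀ Λ : ℝ → AddSubgroup V, latticeOrder (D := D) Λ = Set.univ := fun Λ =>
      Set.eq_univ_of_forall fun a t u hu => by rwa [Subsingleton.elim (a u) u]
    exact ⟨1, fun x => by simp, by simp [htop]⟩
  obtain ⟨L, r, hL, hLΛ⟩ := hΛ.exists_chain hD
  have hπD := hD.op.exists_intVal_eq_one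
  obtain ⟨L', r', hL', hLΛ', hgL⟩ : ∃ L' r', IsDChain hD.op.isDiscVal r' L' ∧
      Set.range L' = Set.range Λ' ∧ ∀ i u, (g : Module.End Dᵐᵒᵖ V) u ∈ L' i ↔ u ∈ L i := by
    obtain ⟨L', r', hL', hLΛ'⟩ := hΛ'.exists_chain hD
    rw [image_conj_eq_iff] at hg
    simp only [mem_latticeOrder_iff hLΛ, mem_latticeOrder_iff hLΛ'] at hg
    obtain ⟨c, hc⟩ := hL.exists_shift_of_unit hL' hπD g hg
    exact ⟨_, r', hL'.shift hπD c,
      ((Equiv.addRight c).surjective.range_comp L').trans hLΛ', hc⟩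
  let G := LinearMap.GeneralLinearGroup.generalLinearEquiv Dᵐᵒᵖ V g
  obtain rfl := hL.period_eq hπD hL' G hgL
  have hind : ∀ i, (L (i + 1)).relIndex (L i) = (L' (i + 1)).relIndex (L' i) := by
    have hmap : ∀ i, L' i = (L i).map (G.toAddEquiv : V →+ V) := fun i => by
      ext u
      obtain ⟨u, rfl⟩ := G.surjective u
      exact (hgL i u).trans
        (AddSubgroup.mem_map_iff_mem (f := (G.toAddEquiv : V →+ V)) G.injective).symm
    intro i
    rw [hmap, hmap, AddSubgroup.relIndex_map_map_of_injective _ _ G.injective]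
  have hn : ∀ {Λ : ℝ → AddSubgroup V} {L : ℤ → AddSubgroup V}, Set.range L = Set.range Λ →
      IsDChain hD.op.isDiscVal r L → (∀ x : E, x ≠ 0 → ∀ a : Module.End Dᵐᵒᵖ V,
        a ∈ latticeOrder Λ ↔ ι x * a * ι x⁻¹ ∈ latticeOrder Λ) →
      ∀ x : E, x ≠ 0 → ∃ n : ℤ, ∀ i u, ι x u ∈ L (i + n) ↔ u ∈ L i := by
    intro Λ L hLΛ hL h x hx
    simp only [mem_latticeOrder_iff hLΛ] at h
    exact hL.exists_shift_of_unit hL hπD (Units.map (ι : E →* Module.End Dᵐᵒᵖ V) (Units.mk0 x hx))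
      (h x hx)
  obtain ⟨κ₀, _, _, rk, hrk, hrk0, hcard₀⟩ := hk.exists_residueField
  obtain ⟨κE, _, _, rE, hrE, hrE0, hcardE⟩ := hE.exists_residueField
  obtain ⟨κD, _, _, rD, hrD, hrD0, -⟩ := hD.op.exists_residueField
  have hcE := hk.intVal_algebraMap hE hcompatE
  have hcD := hk.intVal_algebraMap hD.op hcompatD
  obtain ⟨φE, hφE⟩ := IsDiscVal.IsResidueMap.exists_map hE.e_pos hcE ⟨hrk, hrk0⟩ ⟨hrE, hrE0⟩
  obtain ⟨φD, hφD⟩ := IsDiscVal.IsResidueMap.exists_map hD.e_pos hcD ⟨hrk, hrk0⟩ ⟨hrD, hrD0⟩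
  let _ := φE.toAlgebra
  let _ := φD.toAlgebra
  have hf : Module.finrank κ₀ κE = f := by
    refine Nat.pow_right_injective hk.one_lt_q ?_
    change q ^ _ = q ^ f
    rw [← hresdeg, ← hcard₀, ← hcardE, ← Module.natCard_eq_pow_finrank]
  obtain ⟨ψ, hψL, hψ⟩ := hL.exists_commuting_equiv ⟨hrk, hrk0⟩ ⟨hrE, hrE0⟩ ⟨hrD, hrD0⟩ hφE hφD
    hE.isComplete hD.op.isComplete hD.e_pos hE.e_pos hcE hcD hk.exists_intVal_eq_one
    hE.exists_intVal_eq_one hπD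
    (fun z hz => (hcentral z.unop fun w => MulOpposite.op_injective (hz (.op w)).symm).imp
      fun c hc => MulOpposite.unop_injective hc)
    ((MulOpposite.opLinearEquiv k).finrank_eq.symm.trans hdim) hf hcop (ι : E →+* _)
    (fun c u => by
      rw [RingHom.coe_coe, AlgHom.commutes, Module.algebraMap_end_apply, algebraMap_smul])
    hL' (hn hLΛ hL hnormΛ) (hn hLΛ' hL' hnormΛ') hind
  let Ψ := (LinearMap.GeneralLinearGroup.generalLinearEquiv Dᵐᵒᵖ V).symm ψ
  refine ⟨Ψ, fun x => LinearMap.ext (hψ x), (image_conj_eq_iff _ _ _).2 fun a => ?_⟩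
  rw [mem_latticeOrder_iff hLΛ, mem_latticeOrder_iff hLΛ']
  refine forall_congr' fun i => ⟨fun h u hu => ?_, fun h u hu => ?_⟩
  · refine (hψL _ _).2 (h (ψ.symm u) ((hψL _ _).1 ?_))
    rwa [ψ.apply_symm_apply]
  · rw [← hψL]
    have := h (ψ u) ((hψL _ _).2 hu)
    change ψ (a (ψ.symm (ψ u))) ∈ _ at this
    rwa [ψ.symm_apply_apply] at this
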